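/- Jarnik's mean square formula for the sphere: there exists a constant c₃ > 0 such that ∫_0^X P₃(x)² dx = c₃·X² log X + O( X² (log X)^{1/2} ) as X → ∞. -/

import Mathlib

open Real Filter Asymptotics

/-- The number of integer lattice points in the closed origin-centered ball of radius `√x`
in `ℝ³`. -/
noncomputable def latticeA3 (x : ℝ) : ℕ :=
  {p : ℤ × ℤ × ℤ | (p.1 : ℝ) ^ 2 + (p.2.1 : ℝ) ^ 2 + (p.2.2 : ℝ) ^ 2 ≤ x}.ncard

/-- The lattice point discrepancy of the ball in `ℝ³`. -/
noncomputable def latticeP3 (x : ℝ) : ℝ :=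
  (latticeA3 x : ℝ) - (4 * Real.pi / 3) * x ^ ((3 : ℝ) / 2)

noncomputable section

namespace SphereLattice

open MeasureTheory Set Topology

/-- Points of the lattice `ℤ³`. -/
abbrev Z3 := ℤ × ℤ × ℤ

/-- The squared Euclidean length of a lattice point. -/
def normSq (p : Z3) : ℕ := p.1.natAbs ^ 2 + p.2.1.natAbs ^ 2 + p.2.2.natAbs ^ 2

lemma normSq_cast_int (p : Z3) : (normSq p : ℤ) = p.1 ^ 2 + p.2.1 ^ 2 + p.2.2 ^ 2 := by
  simp [normSq]

lemma normSq_cast (p : Z3) :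
    (normSq p : ℝ) = (p.1 : ℝ) ^ 2 + (p.2.1 : ℝ) ^ 2 + (p.2.2 : ℝ) ^ 2 := by
  have := normSq_cast_int p
  exact_mod_cast this

lemma summable_exp_neg_mul_sq {s : ℝ} (hs : 0 < s) :
    Summable fun m : ℤ => rexp (-s * (m : ℝ) ^ 2) := by
  have h := (Real.summable_one_div_int_pow (p := 2)).2 one_lt_two
  refine Summable.of_norm_bounded_eventually (h.mul_left (1 / s)) ?_
  have : ({0} : Set ℤ)ᶜ ∈ cofinite := (Set.finite_singleton 0).compl_mem_cofinite
  filter_upwards [this] with m hm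
  have hm' : (0 : ℝ) < (m : ℝ) ^ 2 := by
    have : (m : ℝ) ≠ 0 := by exact_mod_cast hm
    positivity
  rw [Real.norm_of_nonneg (exp_pos _).le, neg_mul, Real.exp_neg, inv_le_comm₀ (exp_pos _) (by positivity)]
  have := Real.add_one_le_exp (s * (m : ℝ) ^ 2)
  have e : (1 / s * (1 / (m : ℝ) ^ 2))⁻¹ = s * (m : ℝ) ^ 2 := by field_simp
  rw [e]; linarith

lemma summable_prod3 {f g h : ℤ → ℝ} (hf : Summable f) (hg : Summable g) (hh : Summable h)
    (f0 : 0 ≤ f) (g0 : 0 ≤ g) (h0 : 0 ≤ h) :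
    Summable fun p : Z3 => f p.1 * (g p.2.1 * h p.2.2) :=
  hf.mul_of_nonneg (hg.mul_of_nonneg hh g0 h0) f0 fun p => mul_nonneg (g0 p.1) (h0 p.2)

lemma summable_exp_normSq {s : ℝ} (hs : 0 < s) :
    Summable fun p : Z3 => rexp (-s * (normSq p : ℝ)) := by
  have h := summable_exp_neg_mul_sq hs
  refine (summable_prod3 h h h ?_ ?_ ?_).congr fun p => ?_
  iterate 3 exact fun m => (exp_pos _).le
  rw [← Real.exp_add, ← Real.exp_add, normSq_cast]
  ring_nf

lemma tsum_prod3 {f g h : ℤ → ℂ} (hf : Summable fun a => ‖f a‖) (hg : Summable fun a => ‖g a‖)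
    (hh : Summable fun a => ‖h a‖) :
    Summable (fun p : Z3 => ‖f p.1 * (g p.2.1 * h p.2.2)‖) ∧
    ∑' p : Z3, f p.1 * (g p.2.1 * h p.2.2) = (∑' a, f a) * ((∑' a, g a) * ∑' a, h a) := by
  have hgh : Summable fun p : ℤ × ℤ => ‖g p.1 * h p.2‖ := by
    simpa using hg.mul_of_nonneg hh (fun _ => norm_nonneg _) (fun _ => norm_nonneg _)
  constructor
  · simpa using hf.mul_of_nonneg hgh (fun _ => norm_nonneg _) (fun _ => norm_nonneg _)
  · rw [tsum_mul_tsum_of_summable_norm hg hh, tsum_mul_tsum_of_summable_norm hf hgh]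

/-- The shifted Gaussian carrying a character. -/
def gaussChar (s x y : ℝ) (a : ℤ) : ℂ :=
  Complex.exp (((-s * ((a : ℝ) - x) ^ 2 : ℝ) : ℂ) + ((2 * π * y * ((a : ℝ) - x) : ℝ) : ℂ) * Complex.I)

/-- The Gaussian on the dual side of Poisson summation for `gaussChar`. -/
def gaussCharDual (s x y : ℝ) (k : ℤ) : ℂ :=
  Complex.exp (((-(π ^ 2 / s) * ((k : ℝ) - y) ^ 2 : ℝ) : ℂ) + ((-2 * π * k * x : ℝ) : ℂ) * Complex.I)

lemma norm_gaussChar (s x y : ℝ) (a : ℤ) : ‖gaussChar s x y a‖ = rexp (-s * ((a : ℝ) - x) ^ 2) := by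
  rw [gaussChar, Complex.exp_add, norm_mul, Complex.norm_exp_ofReal_mul_I, mul_one,
    ← Complex.ofReal_exp, Complex.norm_real, Real.norm_of_nonneg (exp_pos _).le]

lemma norm_gaussCharDual (s x y : ℝ) (a : ℤ) :
    ‖gaussCharDual s x y a‖ = rexp (-(π ^ 2 / s) * ((a : ℝ) - y) ^ 2) := by
  rw [gaussCharDual, Complex.exp_add, norm_mul, Complex.norm_exp_ofReal_mul_I, mul_one,
    ← Complex.ofReal_exp, Complex.norm_real, Real.norm_of_nonneg (exp_pos _).le]

lemma summable_exp_neg_mul_sub_sq {s : ℝ} (hs : 0 < s) (x : ℝ) :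
    Summable fun m : ℤ => rexp (-s * ((m : ℝ) - x) ^ 2) := by
  refine Summable.of_nonneg_of_le (fun _ => (exp_pos _).le) (fun m => ?_)
    ((summable_exp_neg_mul_sq (half_pos hs)).mul_left (rexp (s * x ^ 2)))
  rw [← Real.exp_add]
  apply Real.exp_le_exp.2
  nlinarith [mul_nonneg hs.le (sq_nonneg ((m : ℝ) - 2 * x))]

lemma tsum_gaussChar {s : ℝ} (hs : 0 < s) (x y : ℝ) :
    ∑' a : ℤ, gaussChar s x y a = (√(π / s) : ℝ) * ∑' k : ℤ, gaussCharDual s x y k := by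
  have ha : 0 < ((s / π : ℝ) : ℂ).re := by
    rw [Complex.ofReal_re]; positivity
  have key := Complex.tsum_exp_neg_quadratic ha (((s * x / π : ℝ) : ℂ) + (y : ℂ) * Complex.I)
  have hπ : (π : ℂ) ≠ 0 := by exact_mod_cast Real.pi_ne_zero
  have hsc : (s : ℂ) ≠ 0 := by exact_mod_cast hs.ne'
  have e1 : ∀ a : ℤ, gaussChar s x y a = Complex.exp (-s * x ^ 2 - 2 * π * y * x * Complex.I) *
      Complex.exp (-π * ((s / π : ℝ) : ℂ) * (a : ℂ) ^ 2 +
        2 * π * (((s * x / π : ℝ) : ℂ) + (y : ℂ) * Complex.I) * a) := by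
    intro a
    rw [gaussChar, ← Complex.exp_add]
    congr 1
    push_cast
    field_simp
    ring
  have e2 : ∀ k : ℤ, gaussCharDual s x y k =
      Complex.exp (-s * x ^ 2 - 2 * π * y * x * Complex.I) *
      Complex.exp (-π / ((s / π : ℝ) : ℂ) *
        ((k : ℂ) + Complex.I * (((s * x / π : ℝ) : ℂ) + (y : ℂ) * Complex.I)) ^ 2) := by
    intro a
    rw [gaussCharDual, ← Complex.exp_add]
    congr 1
    push_cast
    field_simp
    ring_nf
    simp only [Complex.I_sq, show Complex.I ^ 3 = -Complex.I by rw [pow_succ, Complex.I_sq]; ring,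
      show Complex.I ^ 4 = 1 by exact Complex.I_pow_four]
    ring
  have e3 : (1 : ℂ) / ((s / π : ℝ) : ℂ) ^ (1 / 2 : ℂ) = (√(π / s) : ℝ) := by
    rw [show (1 / 2 : ℂ) = ((1 / 2 : ℝ) : ℂ) by push_cast; rfl,
      ← Complex.ofReal_cpow (by positivity), ← Real.sqrt_eq_rpow, ← inv_div s π, Real.sqrt_inv]
    push_cast
    rw [one_div]
  simp_rw [e1, e2, tsum_mul_left]
  rw [key, e3]
  ring

/-- Poisson summation on `ℤ³` for shifted Gaussians. -/
lemma tsum_gaussChar3 {s : ℝ} (hs : 0 < s) (x y : ℝ × ℝ × ℝ) :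
    ∑' a : Z3, gaussChar s x.1 y.1 a.1 * (gaussChar s x.2.1 y.2.1 a.2.1 *
        gaussChar s x.2.2 y.2.2 a.2.2) =
      ((√(π / s)) ^ 3 : ℝ) * ∑' k : Z3, gaussCharDual s x.1 y.1 k.1 *
        (gaussCharDual s x.2.1 y.2.1 k.2.1 * gaussCharDual s x.2.2 y.2.2 k.2.2) := by
  have h1 : ∀ x y : ℝ, Summable fun a => ‖gaussChar s x y a‖ := fun x y => by
    simp_rw [norm_gaussChar]; exact summable_exp_neg_mul_sub_sq hs x
  have h2 : ∀ x y : ℝ, Summable fun a => ‖gaussCharDual s x y a‖ := fun x y => by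
    simp_rw [norm_gaussCharDual]; exact summable_exp_neg_mul_sub_sq (by positivity) y
  rw [(tsum_prod3 (h1 _ _) (h1 _ _) (h1 _ _)).2, (tsum_prod3 (h2 _ _) (h2 _ _) (h2 _ _)).2]
  simp_rw [tsum_gaussChar hs]
  push_cast
  ring

/-- The one-dimensional theta series. -/
def theta (s : ℝ) : ℝ := ∑' m : ℤ, rexp (-s * (m : ℝ) ^ 2)

/-- The alternating one-dimensional theta series. -/
def thetaAlt (s : ℝ) : ℝ := ∑' m : ℤ, (-1 : ℝ) ^ m.natAbs * rexp (-s * (m : ℝ) ^ 2)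

lemma theta_sub_one_bound : ∃ C : ℝ, 1 ≤ C ∧ ∀ s : ℝ, 0 < s → |theta s - 1| ≤ C / s ^ 2 := by
  have h := (Real.summable_one_div_int_pow (p := 4)).2 (by norm_num)
  refine ⟨2 * (∑' m : ℤ, 1 / (m : ℝ) ^ 4) + 1, ?_, fun s hs => ?_⟩
  · have : 0 ≤ ∑' m : ℤ, 1 / (m : ℝ) ^ 4 := tsum_nonneg fun m => by positivity
    linarith
  have hsum := summable_exp_neg_mul_sq hs
  have hone : HasSum (fun m : ℤ => if m = 0 then (1 : ℝ) else 0) 1 := by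
    simpa using hasSum_ite_eq (0 : ℤ) (1 : ℝ)
  have e : theta s - 1 = ∑' m : ℤ, (rexp (-s * (m : ℝ) ^ 2) - if m = 0 then (1 : ℝ) else 0) := by
    rw [hsum.tsum_sub hone.summable, hone.tsum_eq, theta]
  have hterm : ∀ m : ℤ, 0 ≤ rexp (-s * (m : ℝ) ^ 2) - (if m = 0 then (1 : ℝ) else 0) ∧
      rexp (-s * (m : ℝ) ^ 2) - (if m = 0 then (1 : ℝ) else 0) ≤ 2 / s ^ 2 * (1 / (m : ℝ) ^ 4) := by
    intro m
    by_cases hm : m = 0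
    · simp [hm]
    · have hm' : (m : ℝ) ≠ 0 := by exact_mod_cast hm
      have hx : 0 < s * (m : ℝ) ^ 2 := by positivity
      simp only [hm, if_false, sub_zero]
      refine ⟨(exp_pos _).le, ?_⟩
      rw [neg_mul, Real.exp_neg, inv_le_comm₀ (exp_pos _) (by positivity)]
      have h1 := Real.quadratic_le_exp_of_nonneg hx.le
      have e : (2 / s ^ 2 * (1 / (m : ℝ) ^ 4))⁻¹ = (s * (m : ℝ) ^ 2) ^ 2 / 2 := by field_simp
      rw [e]; linarith
  have h4 : ∑' m : ℤ, (rexp (-s * (m : ℝ) ^ 2) - if m = 0 then (1 : ℝ) else 0) ≤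
      ∑' m : ℤ, 2 / s ^ 2 * (1 / (m : ℝ) ^ 4) :=
    (hsum.sub hone.summable).tsum_le_tsum (fun m => (hterm m).2) (h.mul_left _)
  rw [tsum_mul_left] at h4
  rw [e, abs_of_nonneg (tsum_nonneg fun m => (hterm m).1)]
  refine h4.trans ?_
  have : 0 ≤ 1 / s ^ 2 := by positivity
  rw [add_div, div_mul_eq_mul_div]
  linarith

lemma theta_functional_equation {s : ℝ} (hs : 0 < s) :
    theta s = √(π / s) * theta (π ^ 2 / s) := by
  have h := Real.tsum_exp_neg_mul_int_sq (a := s / π) (by positivity)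
  have e1 : -π * (s / π) = -s := by field_simp
  have e2 : -π / (s / π) = -(π ^ 2 / s) := by field_simp
  rw [e1, e2, ← Real.sqrt_eq_rpow, one_div, ← Real.sqrt_inv, inv_div] at h
  exact h

lemma theta_asymp : ∃ C : ℝ, 1 ≤ C ∧ (∀ s : ℝ, 0 < s → |theta s - 1| ≤ C / s ^ 2) ∧
    ∀ s : ℝ, 0 < s → s ≤ 4 → |theta s - √(π / s)| ≤ C := by
  obtain ⟨C, hC, h⟩ := theta_sub_one_bound
  refine ⟨8 * C, by linarith, fun s hs => (h s hs).trans ?_, fun s hs h4 => ?_⟩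
  · gcongr; linarith
  rw [theta_functional_equation hs, ← mul_sub_one, abs_mul, abs_of_nonneg (Real.sqrt_nonneg _)]
  have h1 := h (π ^ 2 / s) (by positivity)
  have h2 : √(π / s) ≤ π / s + 1 := by
    rw [Real.sqrt_le_left (by positivity)]
    nlinarith [show 0 < π / s by positivity]
  have hp := Real.pi_gt_three
  calc √(π / s) * |theta (π ^ 2 / s) - 1| ≤ (π / s + 1) * (C / (π ^ 2 / s) ^ 2) := by gcongr
    _ = C * ((π * s + s ^ 2) / π ^ 4) := by field_simp
    _ ≤ C * 8 := by
      gcongr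
      rw [div_le_iff₀ (by positivity)]
      have : (81 : ℝ) ≤ π ^ 4 := by
        calc (81 : ℝ) = 3 ^ 4 := by norm_num
          _ ≤ π ^ 4 := by gcongr
      nlinarith [Real.pi_lt_four]
    _ = 8 * C := by ring

lemma theta_pos {s : ℝ} (hs : 0 < s) : 1 ≤ theta s := by
  have := (summable_exp_neg_mul_sq hs).le_tsum 0 fun m _ => (exp_pos _).le
  simpa [theta] using this

lemma tsum_exp_normSq {s : ℝ} (hs : 0 < s) :
    ∑' p : Z3, rexp (-s * (normSq p : ℝ)) = theta s ^ 3 := by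
  have h := summable_exp_neg_mul_sq hs
  have h2 : Summable fun p : ℤ × ℤ => rexp (-s * (p.1 : ℝ) ^ 2) * rexp (-s * (p.2 : ℝ) ^ 2) :=
    h.mul_of_nonneg h (fun m => (exp_pos _).le) (fun m => (exp_pos _).le)
  have h3 := summable_prod3 h h h (fun m => (exp_pos _).le) (fun m => (exp_pos _).le)
    (fun m => (exp_pos _).le)
  rw [theta, pow_succ', pow_two, h.tsum_mul_tsum h h2, h.tsum_mul_tsum h2 h3]
  refine tsum_congr fun p => ?_
  rw [← Real.exp_add, ← Real.exp_add, normSq_cast]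
  ring_nf

lemma summable_alt {s : ℝ} (hs : 0 < s) :
    Summable fun m : ℤ => ‖(-1 : ℝ) ^ m.natAbs * rexp (-s * (m : ℝ) ^ 2)‖ := by
  refine (summable_exp_neg_mul_sq hs).congr fun m => ?_
  simp

lemma thetaAlt_eq {s : ℝ} (hs : 0 < s) : thetaAlt s = 2 * theta (4 * s) - theta s := by
  have hs4 : 0 < 4 * s := by positivity
  have h4 : HasSum (fun m : ℤ => if Even m then rexp (-s * (m : ℝ) ^ 2) else 0) (theta (4 * s)) := by
    have h : HasSum _ (theta (4 * s)) := (summable_exp_neg_mul_sq hs4).hasSum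
    have hinj : Function.Injective fun m : ℤ => 2 * m := fun a b h => by simpa using h
    have := (hinj.hasSum_iff (f := fun m : ℤ => if Even m then rexp (-s * (m : ℝ) ^ 2) else 0)
      (a := theta (4 * s)) (fun m hm => by
        have : ¬ Even m := fun ⟨k, hk⟩ => hm ⟨k, by simp only; omega⟩
        simp [this])).1
    apply this
    convert h using 2 with m
    simp only [Function.comp, even_two_mul, if_true]
    push_cast
    ring_nf
  have h1 : HasSum _ (theta s) := (summable_exp_neg_mul_sq hs).hasSum
  rw [thetaAlt, ← ((h4.mul_left 2).sub h1).tsum_eq]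
  refine tsum_congr fun m => ?_
  by_cases hm : Even m
  · have : Even m.natAbs := Int.natAbs_even.2 hm
    simp [hm, this.neg_one_pow]; ring
  · have : Odd m.natAbs := Int.natAbs_odd.2 (Int.not_even_iff_odd.1 hm)
    simp [hm, this.neg_one_pow]

lemma tsum_exp_normSq_even {s : ℝ} (hs : 0 < s) :
    ∑' p : Z3, (if Even (normSq p) then rexp (-s * (normSq p : ℝ)) else 0) =
      (theta s ^ 3 + thetaAlt s ^ 3) / 2 := by
  have h := summable_alt hs
  have h2 : Summable fun p : ℤ × ℤ => ‖((-1 : ℝ) ^ p.1.natAbs * rexp (-s * (p.1 : ℝ) ^ 2)) *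
      ((-1 : ℝ) ^ p.2.natAbs * rexp (-s * (p.2 : ℝ) ^ 2))‖ := by
    simpa only [norm_mul] using h.mul_of_nonneg h (fun m => norm_nonneg _) (fun m => norm_nonneg _)
  have hprod : HasSum (fun p : Z3 => ((-1 : ℝ) ^ p.1.natAbs * rexp (-s * (p.1 : ℝ) ^ 2)) *
      (((-1 : ℝ) ^ p.2.1.natAbs * rexp (-s * (p.2.1 : ℝ) ^ 2)) *
      ((-1 : ℝ) ^ p.2.2.natAbs * rexp (-s * (p.2.2 : ℝ) ^ 2)))) (thetaAlt s ^ 3) := by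
    rw [thetaAlt, pow_succ', pow_two, tsum_mul_tsum_of_summable_norm h h,
      tsum_mul_tsum_of_summable_norm h h2]
    exact (summable_mul_of_summable_norm h h2).hasSum
  have h3 := (summable_exp_normSq hs).hasSum
  rw [tsum_exp_normSq hs] at h3
  rw [← ((h3.add hprod).div_const 2).tsum_eq]
  refine tsum_congr fun p => ?_
  have e : ((-1 : ℝ) ^ p.1.natAbs * rexp (-s * (p.1 : ℝ) ^ 2)) *
      (((-1 : ℝ) ^ p.2.1.natAbs * rexp (-s * (p.2.1 : ℝ) ^ 2)) *
      ((-1 : ℝ) ^ p.2.2.natAbs * rexp (-s * (p.2.2 : ℝ) ^ 2))) =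
      (-1 : ℝ) ^ (normSq p) * rexp (-s * (normSq p : ℝ)) := by
    have e1 : (-1 : ℝ) ^ (normSq p) =
        (-1) ^ p.1.natAbs * ((-1) ^ p.2.1.natAbs * (-1) ^ p.2.2.natAbs) := by
      rw [← pow_add, ← pow_add]
      apply neg_one_pow_congr
      simp only [normSq, Nat.even_add, Nat.even_pow]
      tauto
    have e2 : rexp (-s * (normSq p : ℝ)) = rexp (-s * (p.1 : ℝ) ^ 2) *
        (rexp (-s * (p.2.1 : ℝ) ^ 2) * rexp (-s * (p.2.2 : ℝ) ^ 2)) := by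
      rw [← Real.exp_add, ← Real.exp_add, normSq_cast]; ring_nf
    rw [e1, e2]; ring
  rw [e]
  by_cases hp : Even (normSq p)
  · simp [hp, hp.neg_one_pow]
  · simp [hp, (Nat.not_even_iff_odd.1 hp).neg_one_pow]

lemma abs_cube_sub_cube_le {a b ε C : ℝ} (h : |a - b| ≤ ε) (hε : ε ≤ C) (hb : 1 ≤ b) :
    |a ^ 3 - b ^ 3| ≤ ε * (3 + 3 * C + C ^ 2) * b ^ 2 := by
  have h0 : 0 ≤ |a - b| := abs_nonneg _
  have e : a ^ 3 - b ^ 3 = (a - b) * (3 * b ^ 2 + 3 * b * (a - b) + (a - b) ^ 2) := by ring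
  have h2 : |3 * b ^ 2 + 3 * b * (a - b) + (a - b) ^ 2| ≤ (3 + 3 * C + C ^ 2) * b ^ 2 := by
    refine (abs_add_le _ _).trans ?_
    refine (add_le_add_left (abs_add_le _ _) _).trans ?_
    rw [abs_mul (3 * b), abs_of_nonneg (by positivity : 0 ≤ 3 * b ^ 2),
      abs_of_nonneg (by positivity : 0 ≤ 3 * b), abs_of_nonneg (sq_nonneg (a - b)), ← sq_abs (a - b)]
    have hd : |a - b| ≤ C := h.trans hε
    have hC : 0 ≤ C := h0.trans hd
    have h3 : 3 * b * |a - b| ≤ 3 * C * b ^ 2 := by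
      calc 3 * b * |a - b| ≤ 3 * b * C := by gcongr
        _ ≤ 3 * b * C * b := le_mul_of_one_le_right (by positivity) hb
        _ = _ := by ring
    have h4 : |a - b| ^ 2 ≤ C ^ 2 * b ^ 2 := by
      calc |a - b| ^ 2 ≤ C ^ 2 := by gcongr
        _ ≤ _ := le_mul_of_one_le_right (by positivity) (by nlinarith)
    linarith
  rw [e, abs_mul, mul_assoc ε]
  exact mul_le_mul h h2 (abs_nonneg _) (h0.trans h)

lemma theta_cube_asymp : ∃ C : ℝ, 0 ≤ C ∧ ∀ s : ℝ, 0 < s →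
    |theta s ^ 3 - 1 - √(π / s) ^ 3| ≤ C * s ^ (-(5 / 4) : ℝ) ∧
    |(theta s ^ 3 + thetaAlt s ^ 3) / 2 - 1 - √(π / s) ^ 3 / 2| ≤ C * s ^ (-(5 / 4) : ℝ) := by
  obtain ⟨C, hC, h1, h2⟩ := theta_asymp
  set D := 3 + 3 * (3 * C) + (3 * C) ^ 2 with hD
  have hD0 : 0 ≤ D := by positivity
  refine ⟨4 * C * D + 8 + 27 * C ^ 3 + 3 * C * D + 1, by positivity, fun s hs => ?_⟩
  have hpow : 0 < s ^ (-(5 / 4) : ℝ) := by positivity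
  have h32 : 0 ≤ √(π / s) := Real.sqrt_nonneg _
  rw [thetaAlt_eq hs]
  rcases le_total 1 s with hs1 | hs1
  · have a1 : 1 / s ^ 2 ≤ s ^ (-(5 / 4) : ℝ) := by
      rw [one_div, ← Real.rpow_natCast, ← Real.rpow_neg hs.le]
      exact Real.rpow_le_rpow_of_exponent_le hs1 (by norm_num)
    have a2 : √(π / s) ^ 3 ≤ 8 * s ^ (-(5 / 4) : ℝ) := by
      have : √(π / s) ≤ 2 * s ^ (-(1 / 2) : ℝ) := by
        rw [Real.sqrt_eq_rpow, Real.div_rpow Real.pi_pos.le hs.le, Real.rpow_neg hs.le,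
          ← Real.sqrt_eq_rpow π, div_eq_mul_inv]
        gcongr
        rw [Real.sqrt_le_left (by norm_num)]
        linarith [Real.pi_lt_four]
      calc √(π / s) ^ 3 ≤ (2 * s ^ (-(1 / 2) : ℝ)) ^ 3 := by gcongr
        _ = 8 * s ^ (-(3 / 2) : ℝ) := by
          rw [mul_pow, ← Real.rpow_natCast (s ^ _), ← Real.rpow_mul hs.le]; norm_num
        _ ≤ _ := by
          gcongr 8 * ?_
          exact Real.rpow_le_rpow_of_exponent_le hs1 (by norm_num)
    have b1 : |theta s - 1| ≤ 3 * C / s ^ 2 := (h1 s hs).trans (by gcongr; linarith)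
    have hle : 3 * C / s ^ 2 ≤ 3 * C := div_le_self (by positivity) (by nlinarith)
    have b2 : |(2 * theta (4 * s) - theta s) - 1| ≤ 3 * C / s ^ 2 := by
      have h4 := h1 (4 * s) (by positivity)
      have h4' : C / (4 * s) ^ 2 ≤ C / s ^ 2 := by
        gcongr; linarith
      have e : (2 * theta (4 * s) - theta s) - 1 = 2 * (theta (4 * s) - 1) - (theta s - 1) := by ring
      rw [e]
      refine (abs_sub _ _).trans ?_
      rw [abs_mul, abs_two]
      have h5 := h1 s hs
      have : 3 * C / s ^ 2 = 2 * (C / s ^ 2) + C / s ^ 2 := by ring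
      linarith
    have c1 := abs_cube_sub_cube_le b1 hle le_rfl
    have c2 := abs_cube_sub_cube_le b2 hle le_rfl
    rw [one_pow, one_pow, mul_one, ← hD] at c1 c2
    have c3 : 3 * C / s ^ 2 * D ≤ 3 * C * D * s ^ (-(5 / 4) : ℝ) := by
      calc 3 * C / s ^ 2 * D = 3 * C * D * (1 / s ^ 2) := by ring
        _ ≤ _ := by gcongr
    have hx : 0 ≤ (4 * C * D + 27 * C ^ 3 + 1) * s ^ (-(5 / 4) : ℝ) := by positivity
    have h33 : 0 ≤ √(π / s) ^ 3 := by positivity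
    constructor
    · rw [abs_le] at c1 ⊢; constructor <;> nlinarith
    · rw [abs_le] at c1 c2 ⊢; constructor <;> nlinarith
  · have a1 : 1 / s ≤ s ^ (-(5 / 4) : ℝ) := by
      rw [one_div, ← Real.rpow_neg_one]
      exact Real.rpow_le_rpow_of_exponent_ge hs hs1 (by norm_num)
    have a0 : 1 ≤ s ^ (-(5 / 4) : ℝ) := by
      refine le_trans ?_ a1
      rw [le_div_iff₀ hs]; linarith
    have b0 : 1 ≤ √(π / s) := by
      rw [Real.one_le_sqrt, le_div_iff₀ hs]
      linarith [Real.pi_gt_three]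
    have b1 : |theta s - √(π / s)| ≤ C := h2 s hs (by linarith)
    have b2 : |2 * theta (4 * s) - theta s| ≤ 3 * C := by
      have h4 := h2 (4 * s) (by positivity) (by linarith)
      have e : √(π / (4 * s)) = √(π / s) / 2 := by
        rw [mul_comm, ← div_div, Real.sqrt_div (by positivity)]
        congr 1
        rw [show (4 : ℝ) = 2 ^ 2 by norm_num, Real.sqrt_sq (by norm_num)]
      rw [e] at h4
      rw [abs_le] at h4 b1 ⊢
      constructor <;> linarith
    have c1 := abs_cube_sub_cube_le b1 (by linarith : C ≤ 3 * C) b0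
    rw [← hD, Real.sq_sqrt (by positivity)] at c1
    have c2 : |(2 * theta (4 * s) - theta s) ^ 3| ≤ 27 * C ^ 3 := by
      rw [abs_pow]
      calc _ ≤ (3 * C) ^ 3 := by gcongr
        _ = _ := by ring
    have c3 : C * D * (π / s) ≤ 4 * C * D * s ^ (-(5 / 4) : ℝ) := by
      calc C * D * (π / s) ≤ C * D * (4 / s) := by
            gcongr; exact Real.pi_lt_four.le
        _ = 4 * C * D * (1 / s) := by ring
        _ ≤ _ := by gcongr
    have c4 : 27 * C ^ 3 ≤ 27 * C ^ 3 * s ^ (-(5 / 4) : ℝ) := le_mul_of_one_le_right (by positivity) a0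
    have hx : 0 ≤ (8 + 3 * C * D) * s ^ (-(5 / 4) : ℝ) := by positivity
    have hx2 : 0 ≤ 4 * C * D * s ^ (-(5 / 4) : ℝ) := by positivity
    constructor
    · rw [abs_le] at c1 ⊢; constructor <;> nlinarith
    · rw [abs_le] at c1 c2 ⊢; constructor <;> nlinarith

/-- The number of representations of `n` as a sum of three squares. -/
def r3 (n : ℕ) : ℕ := {p : Z3 | normSq p = n}.ncard

/-- The Laplace transform of the squares of the representation numbers. -/
def laplaceSq (s : ℝ) : ℝ := ∑' n : ℕ, (r3 n : ℝ) ^ 2 * rexp (-s * n)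

lemma finite_normSq_le (n : ℕ) : {p : Z3 | normSq p ≤ n}.Finite := by
  refine ((Set.finite_Icc (-(n : ℤ)) n).prod
    ((Set.finite_Icc (-(n : ℤ)) n).prod (Set.finite_Icc (-(n : ℤ)) n))).subset ?_
  rintro ⟨a, b, c⟩ h
  have h1 : a.natAbs ≤ a.natAbs ^ 2 := Nat.le_self_pow two_ne_zero _
  have h2 : b.natAbs ≤ b.natAbs ^ 2 := Nat.le_self_pow two_ne_zero _
  have h3 : c.natAbs ≤ c.natAbs ^ 2 := Nat.le_self_pow two_ne_zero _
  simp only [normSq, mem_ofPred_eq, Set.mem_prod, Set.mem_Icc] at h ⊢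
  omega

lemma finite_normSq_eq (n : ℕ) : {p : Z3 | normSq p = n}.Finite :=
  (finite_normSq_le n).subset fun _ h => le_of_eq h

lemma hasSum_fiber {f : ℕ → ℝ} (hf : Summable fun p : Z3 => f (normSq p)) :
    HasSum (fun n => (r3 n : ℝ) * f n) (∑' p : Z3, f (normSq p)) := by
  have h := (Equiv.sigmaFiberEquiv normSq).hasSum_iff.2 hf.hasSum
  refine h.sigma fun n => ?_
  have : Finite {p : Z3 // normSq p = n} := finite_normSq_eq n
  have := Fintype.ofFinite {p : Z3 // normSq p = n}
  have e : (r3 n : ℝ) * f n = ∑ p : {p : Z3 // normSq p = n}, f n := by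
    rw [Finset.sum_const, nsmul_eq_mul, Finset.card_univ, ← Nat.card_eq_fintype_card]
    rfl
  rw [e]
  convert hasSum_fintype _ using 2
  rename_i i _
  simp [Equiv.sigmaFiberEquiv, i.2]

lemma tsum_ite_normSq_eq (n : ℕ) :
    ∑' p : Z3, (if normSq p = n then (1 : ℝ) else 0) = r3 n := by
  rw [r3, Set.ncard_eq_toFinset_card _ (finite_normSq_eq n), tsum_eq_sum (s := (finite_normSq_eq n).toFinset)]
  · rw [Finset.sum_congr rfl (g := fun _ => (1 : ℝ))]
    · simp
    · intro p hp; simp at hp; simp [hp]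
  · intro p hp; simp at hp; simp [hp]

lemma summable_pairs {s : ℝ} (hs : 0 < s) : Summable fun x : Z3 × Z3 =>
    if normSq x.1 = normSq x.2 then rexp (-s * (normSq x.1 : ℝ)) else 0 := by
  have h := summable_exp_normSq (half_pos hs)
  refine Summable.of_nonneg_of_le (fun x => ?_) (fun x => ?_)
    (h.mul_of_nonneg h (fun _ => (exp_pos _).le) (fun _ => (exp_pos _).le))
  · split_ifs <;> positivity
  · split_ifs with hx
    · rw [← Real.exp_add, hx]
      apply le_of_eq; ring_nf
    · positivity

lemma summable_r3_comp {s : ℝ} (hs : 0 < s) :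
    Summable fun p : Z3 => (r3 (normSq p) : ℝ) * rexp (-s * (normSq p : ℝ)) := by
  refine (summable_pairs hs).prod.congr fun p => ?_
  rw [← tsum_ite_normSq_eq, ← tsum_mul_right]
  exact tsum_congr fun q => by simp [eq_comm]

lemma hasSum_laplaceSq {s : ℝ} (hs : 0 < s) :
    HasSum (fun n : ℕ => (r3 n : ℝ) ^ 2 * rexp (-s * n)) (laplaceSq s) := by
  have h := hasSum_fiber (f := fun n => (r3 n : ℝ) * rexp (-s * n)) (summable_r3_comp hs)
  simp_rw [← mul_assoc, ← pow_two] at h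
  exact h.summable.hasSum

lemma hasSum_pairs {s : ℝ} (hs : 0 < s) : HasSum (fun x : Z3 × Z3 =>
    if normSq x.1 = normSq x.2 then rexp (-s * (normSq x.1 : ℝ)) else 0) (laplaceSq s) := by
  have h := hasSum_fiber (f := fun n => (r3 n : ℝ) * rexp (-s * n)) (summable_r3_comp hs)
  simp_rw [← mul_assoc, ← pow_two] at h
  have e := h.unique (hasSum_laplaceSq hs)
  have h2 := (summable_pairs hs).hasSum
  rw [(summable_pairs hs).tsum_prod] at h2
  convert h2 using 1
  rw [← e]
  refine tsum_congr fun p => ?_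
  simp only
  rw [← tsum_ite_normSq_eq, ← tsum_mul_right]
  exact tsum_congr fun q => by simp [eq_comm]

/-- The standard bilinear form on `ℤ³`. -/
def dot (p q : Z3) : ℤ := p.1 * q.1 + p.2.1 * q.2.1 + p.2.2 * q.2.2

/-- The Gaussian sum over the lattice points equidistant from `0` and `u`. -/
def planeSum (s : ℝ) (u : Z3) : ℝ :=
  ∑' a : Z3, if 2 * dot a u = normSq u then
    rexp (-s * (((a.1 : ℝ) - u.1 / 2) ^ 2 + ((a.2.1 : ℝ) - u.2.1 / 2) ^ 2 +
      ((a.2.2 : ℝ) - u.2.2 / 2) ^ 2)) else 0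

lemma hasSum_planeSum {s : ℝ} (hs : 0 < s) :
    HasSum (fun u : Z3 => rexp (-(s / 4) * (normSq u : ℝ)) * planeSum s u) (laplaceSq s) := by
  let e : Z3 × Z3 ≃ Z3 × Z3 :=
    { toFun := fun x => (x.2, x.2 - x.1)
      invFun := fun x => (x.1 - x.2, x.1)
      left_inv := fun x => by simp
      right_inv := fun x => by simp }
  have h := e.hasSum_iff.2 (hasSum_pairs hs)
  have h2 := h.prod_fiberwise fun u => (h.summable.prod_factor u).hasSum
  convert h2 using 1
  ext u
  rw [planeSum, ← tsum_mul_left]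
  refine tsum_congr fun a => ?_
  simp only [Function.comp, e, Equiv.coe_fn_mk]
  have hiff : 2 * dot a u = normSq u ↔ normSq a = normSq (a - u) := by
    rw [← @Nat.cast_inj ℤ, normSq_cast_int, normSq_cast_int, normSq_cast_int]
    simp only [dot, Prod.fst_sub, Prod.snd_sub]
    constructor <;> intro h <;> linarith
  by_cases hc : 2 * dot a u = normSq u
  · rw [if_pos hc, if_pos (hiff.1 hc), ← Real.exp_add]
    congr 1
    have hc' : 2 * ((a.1 : ℝ) * u.1 + a.2.1 * u.2.1 + a.2.2 * u.2.2) = normSq u := by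
      have := congrArg (Int.cast (R := ℝ)) hc
      simpa [dot] using this
    rw [normSq_cast] at hc' ⊢
    rw [normSq_cast]
    linear_combination (s / 2) * hc'
  · rw [if_neg hc, if_neg (fun h => hc (hiff.2 h)), mul_zero]

lemma hasSum_integral_zero_one {ι E : Type*} [Countable ι] [NormedAddCommGroup E] [NormedSpace ℝ E]
    {f : ι → ℝ → E} (hf : ∀ i, Continuous (f i)) {b : ι → ℝ} (hb : Summable b)
    (hfb : ∀ i, ∀ x ∈ Icc (0 : ℝ) 1, ‖f i x‖ ≤ b i) [CompleteSpace E] :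
    HasSum (fun i => ∫ x in (0 : ℝ)..1, f i x) (∫ x in (0 : ℝ)..1, ∑' i, f i x) := by
  have hm : ∀ x ∈ uIoc (0 : ℝ) 1, x ∈ Icc (0 : ℝ) 1 := fun x hx => by
    rw [uIoc_of_le zero_le_one] at hx; exact ⟨hx.1.le, hx.2⟩
  refine intervalIntegral.hasSum_integral_of_dominated_convergence (fun i _ => b i)
    (fun i => (hf i).aestronglyMeasurable) (fun i => ae_of_all _ fun x hx => hfb i x (hm x hx))
    (ae_of_all _ fun _ _ => hb) (by simp) (ae_of_all _ fun x hx => ?_)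
  exact (Summable.of_norm_bounded hb fun i => hfb i x (hm x hx)).hasSum

/-- The Gaussian of the lattice point `k`, averaged along the segment from `0` to `u`. -/
def segInt (s : ℝ) (u k : Z3) : ℝ :=
  ∫ β in (0 : ℝ)..1, rexp (-(π ^ 2 / s) * (((k.1 : ℝ) - β * u.1) ^ 2 + ((k.2.1 : ℝ) - β * u.2.1) ^ 2 +
    ((k.2.2 : ℝ) - β * u.2.2) ^ 2))

lemma integral_exp_int_mul (n : ℤ) :
    ∫ β in (0 : ℝ)..1, Complex.exp (((2 * π * β * n : ℝ) : ℂ) * Complex.I) = if n = 0 then 1 else 0 := by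
  split_ifs with h
  · simp [h]
  · have hc : (2 * π * n * Complex.I : ℂ) ≠ 0 := by
      simp [h, Real.pi_ne_zero]
    have := integral_exp_mul_complex (a := 0) (b := 1) hc
    calc _ = ∫ β in (0 : ℝ)..1, Complex.exp ((2 * π * n * Complex.I) * (β : ℂ)) := by
          refine intervalIntegral.integral_congr fun β _ => ?_
          congr 1; push_cast; ring
      _ = _ := by
          rw [this]
          have : Complex.exp (2 * π * n * Complex.I * ((1 : ℝ) : ℂ)) = 1 := by
            rw [Complex.exp_eq_one_iff]; exact ⟨n, by push_cast; ring⟩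
          rw [this]; simp

lemma neg_one_pow_natAbs_eq_exp (n : ℤ) :
    Complex.exp (((-π * n : ℝ) : ℂ) * Complex.I) = (((-1 : ℝ) ^ n.natAbs : ℝ) : ℂ) := by
  have h1 : ((-1 : ℝ) ^ n.natAbs : ℝ) = Real.cos (n * π) := by
    rw [Real.cos_int_mul_pi]
    rcases Int.even_or_odd n with h | h
    · rw [h.neg_one_zpow, (Int.natAbs_even.2 h).neg_one_pow]
    · rw [h.neg_one_zpow, (Int.natAbs_odd.2 h).neg_one_pow]
  rw [h1, Complex.exp_mul_I, ← Complex.ofReal_cos, ← Complex.ofReal_sin]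
  have : (-π * n : ℝ) = -(n * π) := by ring
  rw [this, Real.sin_neg, Real.sin_int_mul_pi, Real.cos_neg]
  simp

lemma summable_norm_segInt_bound {s : ℝ} (hs : 0 < s) (M : ℝ) :
    Summable fun k : Z3 => rexp (M) * rexp (-(π ^ 2 / s / 2) * (normSq k : ℝ)) :=
  (summable_exp_normSq (by positivity)).mul_left _

lemma seg_bound {s : ℝ} (hs : 0 < s) (u k : Z3) {β : ℝ} (hβ : β ∈ Icc (0 : ℝ) 1) :
    rexp (-(π ^ 2 / s) * (((k.1 : ℝ) - β * u.1) ^ 2 + ((k.2.1 : ℝ) - β * u.2.1) ^ 2 +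
    ((k.2.2 : ℝ) - β * u.2.2) ^ 2)) ≤
      rexp (π ^ 2 / s * normSq u) * rexp (-(π ^ 2 / s / 2) * (normSq k : ℝ)) := by
  rw [← Real.exp_add, normSq_cast, normSq_cast]
  apply Real.exp_le_exp.2
  have hA : 0 ≤ π ^ 2 / s := by positivity
  have hb : β ^ 2 ≤ 1 := by nlinarith [hβ.1, hβ.2]
  have key : ∀ x y : ℝ, x ^ 2 / 2 - y ^ 2 ≤ (x - β * y) ^ 2 := fun x y => by
    nlinarith [sq_nonneg (x - 2 * (β * y)), sq_nonneg y]
  have := mul_le_mul_of_nonneg_left (add_le_add (add_le_add (key k.1 u.1) (key k.2.1 u.2.1)) (key k.2.2 u.2.2)) hA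
  linarith

lemma summable_segInt {s : ℝ} (hs : 0 < s) (u : Z3) : Summable (segInt s u) := by
  refine (hasSum_integral_zero_one (b := fun k => rexp (π ^ 2 / s * normSq u) *
    rexp (-(π ^ 2 / s / 2) * (normSq k : ℝ))) (fun k => by fun_prop) (summable_norm_segInt_bound hs _)
    fun k β hβ => ?_).summable
  rw [Real.norm_of_nonneg (exp_pos _).le]
  exact seg_bound hs u k hβ

lemma segInt_nonneg (s : ℝ) (u k : Z3) : 0 ≤ segInt s u k :=
  intervalIntegral.integral_nonneg zero_le_one fun _ _ => (exp_pos _).le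

lemma planeSum_eq {s : ℝ} (hs : 0 < s) {u : Z3} (he : Even (normSq u)) :
    planeSum s u = √(π / s) ^ 3 * ∑' k : Z3, (-1 : ℝ) ^ (dot k u).natAbs * segInt s u k := by
  obtain ⟨h, hh⟩ := he
  have hhR : (u.1 : ℝ) ^ 2 + (u.2.1 : ℝ) ^ 2 + (u.2.2 : ℝ) ^ 2 = 2 * h := by
    rw [← normSq_cast, hh]; push_cast; ring
  have P := fun β : ℝ => tsum_gaussChar3 hs ((u.1 : ℝ) / 2, (u.2.1 : ℝ) / 2, (u.2.2 : ℝ) / 2)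
    (β * (u.1 : ℝ), β * (u.2.1 : ℝ), β * (u.2.2 : ℝ))
  simp only at P
  have e1 : ∀ (a : Z3) (β : ℝ), gaussChar s ((u.1 : ℝ) / 2) (β * (u.1 : ℝ)) a.1 *
      (gaussChar s ((u.2.1 : ℝ) / 2) (β * (u.2.1 : ℝ)) a.2.1 *
        gaussChar s ((u.2.2 : ℝ) / 2) (β * (u.2.2 : ℝ)) a.2.2) =
      (rexp (-s * (((a.1 : ℝ) - u.1 / 2) ^ 2 + ((a.2.1 : ℝ) - u.2.1 / 2) ^ 2 +
      ((a.2.2 : ℝ) - u.2.2 / 2) ^ 2)) : ℂ) * 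
      Complex.exp (((2 * π * β * (dot a u - h : ℤ) : ℝ) : ℂ) * Complex.I) := by
    intro a β
    simp only [gaussChar]
    rw [Complex.ofReal_exp, ← Complex.exp_add, ← Complex.exp_add, ← Complex.exp_add]
    congr 1
    have hhC : (u.1 : ℂ) ^ 2 + (u.2.1 : ℂ) ^ 2 + (u.2.2 : ℂ) ^ 2 = 2 * h := by exact_mod_cast hhR
    simp only [dot]
    push_cast
    linear_combination (-π * β * Complex.I) * hhC
  have e2 : ∀ (k : Z3) (β : ℝ), gaussCharDual s ((u.1 : ℝ) / 2) (β * (u.1 : ℝ)) k.1 *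
      (gaussCharDual s ((u.2.1 : ℝ) / 2) (β * (u.2.1 : ℝ)) k.2.1 *
        gaussCharDual s ((u.2.2 : ℝ) / 2) (β * (u.2.2 : ℝ)) k.2.2) =
      (((-1 : ℝ) ^ (dot k u).natAbs * rexp (-(π ^ 2 / s) * (((k.1 : ℝ) - β * u.1) ^ 2 + ((k.2.1 : ℝ) - β * u.2.1) ^ 2 +
    ((k.2.2 : ℝ) - β * u.2.2) ^ 2)) : ℝ) : ℂ) := by
    intro k β
    simp only [gaussCharDual]
    rw [Complex.ofReal_mul ((-1 : ℝ) ^ _), ← neg_one_pow_natAbs_eq_exp, Complex.ofReal_exp,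
      ← Complex.exp_add, ← Complex.exp_add, ← Complex.exp_add]
    congr 1
    simp only [dot]
    push_cast
    ring
  simp_rw [e1, e2] at P
  have H1 := hasSum_integral_zero_one (f := fun (a : Z3) (β : ℝ) => 
      ((rexp (-s * (((a.1 : ℝ) - u.1 / 2) ^ 2 + ((a.2.1 : ℝ) - u.2.1 / 2) ^ 2 +
      ((a.2.2 : ℝ) - u.2.2 / 2) ^ 2)) : ℝ) : ℂ) * 
      Complex.exp (((2 * π * β * (dot a u - h : ℤ) : ℝ) : ℂ) * Complex.I))
      (b := fun a => rexp (-s * (((a.1 : ℝ) - u.1 / 2) ^ 2 + ((a.2.1 : ℝ) - u.2.1 / 2) ^ 2 +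
      ((a.2.2 : ℝ) - u.2.2 / 2) ^ 2))) (fun a => by fun_prop) ?_ ?_
  rotate_left
  · refine (summable_prod3 (summable_exp_neg_mul_sub_sq hs ((u.1 : ℝ) / 2))
      (summable_exp_neg_mul_sub_sq hs ((u.2.1 : ℝ) / 2))
      (summable_exp_neg_mul_sub_sq hs ((u.2.2 : ℝ) / 2)) (fun _ => (exp_pos _).le)
      (fun _ => (exp_pos _).le) (fun _ => (exp_pos _).le)).congr fun a => ?_
    rw [← Real.exp_add, ← Real.exp_add]; congr 1; ring
  · intro a β _
    rw [norm_mul, Complex.norm_exp_ofReal_mul_I, mul_one, Complex.norm_real,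
      Real.norm_of_nonneg (exp_pos _).le]
  have H2 := hasSum_integral_zero_one (f := fun (k : Z3) (β : ℝ) => 
      (((-1 : ℝ) ^ (dot k u).natAbs * rexp (-(π ^ 2 / s) * (((k.1 : ℝ) - β * u.1) ^ 2 + ((k.2.1 : ℝ) - β * u.2.1) ^ 2 +
    ((k.2.2 : ℝ) - β * u.2.2) ^ 2)) : ℝ) : ℂ))
      (b := fun k => rexp (π ^ 2 / s * normSq u) * rexp (-(π ^ 2 / s / 2) * (normSq k : ℝ)))
      (fun a => by fun_prop) (summable_norm_segInt_bound hs _) ?_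
  rotate_left
  · intro k β hβ
    rw [Complex.norm_real, norm_mul, norm_pow, norm_neg, norm_one, one_pow, one_mul,
      Real.norm_of_nonneg (exp_pos _).le]
    exact seg_bound hs u k hβ
  simp_rw [P] at H1
  rw [intervalIntegral.integral_const_mul, ← H2.tsum_eq] at H1
  have H3 := H1.tsum_eq
  have e3 : ∀ k : Z3, (∫ x in (0 : ℝ)..1, (((-1 : ℝ) ^ (dot k u).natAbs *
    rexp (-(π ^ 2 / s) * (((k.1 : ℝ) - x * u.1) ^ 2 + ((k.2.1 : ℝ) - x * u.2.1) ^ 2 +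
    ((k.2.2 : ℝ) - x * u.2.2) ^ 2)) : ℝ) : ℂ)) = (((-1 : ℝ) ^ (dot k u).natAbs * segInt s u k : ℝ) : ℂ) := by
    intro k
    rw [intervalIntegral.integral_ofReal, intervalIntegral.integral_const_mul, segInt]
  have e4 : ∀ a : Z3, (∫ x in (0 : ℝ)..1, ((rexp (-s * (((a.1 : ℝ) - u.1 / 2) ^ 2 + ((a.2.1 : ℝ) - u.2.1 / 2) ^ 2 +
      ((a.2.2 : ℝ) - u.2.2 / 2) ^ 2)) : ℝ) : ℂ) * 
      Complex.exp (((2 * π * x * (dot a u - h : ℤ) : ℝ) : ℂ) * Complex.I)) =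
      ((if 2 * dot a u = normSq u then
    rexp (-s * (((a.1 : ℝ) - u.1 / 2) ^ 2 + ((a.2.1 : ℝ) - u.2.1 / 2) ^ 2 +
      ((a.2.2 : ℝ) - u.2.2 / 2) ^ 2)) else 0 : ℝ) : ℂ) := by
    intro a
    rw [intervalIntegral.integral_const_mul, integral_exp_int_mul]
    have : dot a u - h = 0 ↔ 2 * dot a u = normSq u := by rw [hh]; push_cast; omega
    by_cases hc : 2 * dot a u = normSq u
    · rw [if_pos hc, if_pos (this.2 hc), mul_one]
    · rw [if_neg hc, if_neg (fun h => hc (this.1 h))]; simp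
  simp_rw [e3, e4] at H3
  rw [← Complex.ofReal_tsum, ← Complex.ofReal_tsum] at H3
  rw [planeSum]
  exact_mod_cast H3

lemma planeSum_odd (s : ℝ) {u : Z3} (ho : ¬ Even (normSq u)) : planeSum s u = 0 := by
  rw [planeSum]
  convert tsum_zero with a
  rw [if_neg]
  intro h
  apply ho
  rw [← Int.even_coe_nat, ← h]
  exact even_two_mul _

lemma hasSum_congr {ι : Type*} {f g : ι → ℝ} {a : ℝ} (h : ∀ i, f i = g i) : HasSum f a ↔ HasSum g a := by
  rw [funext h]

lemma hasSum_gauss_segments {B : ℝ} (hB : 0 < B) (c : ℝ) {d : ℕ} (hd : 0 < d) :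
    HasSum (fun j : ℤ => ∫ β in (0 : ℝ)..1, rexp (-B * (c + j / d - β) ^ 2)) (d * √(π / B)) := by
  have : NeZero d := ⟨hd.ne'⟩
  have hdR : (d : ℝ) ≠ 0 := by exact_mod_cast hd.ne'
  have h1 : ∀ c : ℝ, HasSum (fun n : ℤ => ∫ β in (0 : ℝ)..1, rexp (-B * (c + n - β) ^ 2)) (√(π / B)) := by
    intro c
    have hi : Integrable fun x : ℝ => rexp (-B * (x - c) ^ 2) := (integrable_exp_neg_mul_sq hB).comp_sub_right c
    have h := hi.hasSum_intervalIntegral_comp_add_int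
    rw [integral_sub_right_eq_self (fun x : ℝ => rexp (-B * x ^ 2)) c, integral_gaussian] at h
    rw [← (Equiv.neg ℤ).hasSum_iff] at h
    refine (hasSum_congr fun n => ?_).mpr h
    simp only [Function.comp_apply, Equiv.neg_apply, Int.cast_neg]
    congr 1
    ext β
    congr 1
    ring
  let f : Fin d × ℤ → ℝ := fun p => ∫ β in (0 : ℝ)..1, rexp (-B * (c + (p.1 : ℕ) / d + p.2 - β) ^ 2)
  have hf : HasSum f (d * √(π / B)) := by
    have hsum : Summable f := by
      refine (summable_prod_of_nonneg (f := f) ?_).2 ⟨fun r => (h1 (c + (r : ℕ) / d)).summable, (hasSum_fintype _).summable⟩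
      intro p
      exact intervalIntegral.integral_nonneg zero_le_one fun _ _ => (exp_pos _).le
    have h2 := hsum.hasSum.prod_fiberwise (fun r => h1 (c + (r : ℕ) / d))
    have h3 := h2.unique (hasSum_fintype _)
    simp only [Finset.sum_const, Finset.card_univ, Fintype.card_fin, nsmul_eq_mul] at h3
    rw [← h3]; exact hsum.hasSum
  rw [← ((Int.divModEquiv d).trans (Equiv.prodComm ℤ (Fin d))).symm.hasSum_iff]
  refine (hasSum_congr fun p => ?_).mpr hf
  simp only [f, Function.comp_apply, Int.divModEquiv, Equiv.symm_trans_apply, Equiv.prodComm_symm,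
    Equiv.prodComm_apply, Prod.swap, Equiv.coe_fn_symm_mk]
  congr 1
  ext β
  congr 3
  push_cast
  field_simp
  ring

/-- The cross product on `ℤ³`. -/
def cross (k u : Z3) : Z3 :=
  (k.2.1 * u.2.2 - k.2.2 * u.2.1, k.2.2 * u.1 - k.1 * u.2.2, k.1 * u.2.1 - k.2.1 * u.1)

/-- The greatest common divisor of the coordinates. -/
def gcd3 (u : Z3) : ℕ := Int.gcd u.1 (Int.gcd u.2.1 u.2.2)

lemma gcd3_dvd (u : Z3) : (gcd3 u : ℤ) ∣ u.1 ∧ (gcd3 u : ℤ) ∣ u.2.1 ∧ (gcd3 u : ℤ) ∣ u.2.2 :=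
  ⟨Int.gcd_dvd_left .., (Int.gcd_dvd_right ..).trans (Int.gcd_dvd_left ..),
    (Int.gcd_dvd_right ..).trans (Int.gcd_dvd_right ..)⟩

lemma dvd_gcd3 {u : Z3} {e : ℕ} : e ∣ gcd3 u ↔ (e : ℤ) ∣ u.1 ∧ (e : ℤ) ∣ u.2.1 ∧ (e : ℤ) ∣ u.2.2 := by
  rw [gcd3, Int.dvd_gcd_iff, Int.dvd_coe_gcd_iff]

lemma normSq_eq_zero {u : Z3} : normSq u = 0 ↔ u = 0 := by
  rcases u with ⟨a, b, c⟩
  simp [normSq, Prod.ext_iff, and_assoc]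

lemma normSq_pos {u : Z3} (hu : u ≠ 0) : 0 < normSq u :=
  Nat.pos_of_ne_zero fun h => hu (normSq_eq_zero.1 h)

lemma gcd3_pos {u : Z3} (hu : u ≠ 0) : 0 < gcd3 u := by
  refine Nat.pos_of_ne_zero fun h => hu ?_
  have := gcd3_dvd u
  rw [h] at this
  simp only [Nat.cast_zero, zero_dvd_iff] at this
  exact Prod.ext this.1 (Prod.ext this.2.1 this.2.2)

lemma gcd3_bezout (u : Z3) : ∃ b : Z3, dot b u = gcd3 u := by
  refine ⟨(Int.gcdA u.1 (Int.gcd u.2.1 u.2.2), Int.gcdB u.1 (Int.gcd u.2.1 u.2.2) * Int.gcdA u.2.1 u.2.2,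
    Int.gcdB u.1 (Int.gcd u.2.1 u.2.2) * Int.gcdB u.2.1 u.2.2), ?_⟩
  have h1 := Int.gcd_eq_gcd_ab u.2.1 u.2.2
  have h2 := Int.gcd_eq_gcd_ab u.1 (Int.gcd u.2.1 u.2.2)
  simp only [dot, gcd3]
  linear_combination (-Int.gcdB u.1 (Int.gcd u.2.1 u.2.2)) * h1 - h2

/-- A point of the primitive sublattice on the line through `u`. -/
lemma exists_primitive {u : Z3} (hu : u ≠ 0) : ∃ v : Z3, u = (gcd3 u : ℤ) • v ∧
    ∀ k, cross k u = 0 → ∃ j : ℤ, k = j • v := by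
  obtain ⟨⟨v1, h1⟩, ⟨v2, h2⟩, ⟨v3, h3⟩⟩ := gcd3_dvd u
  have hd : (gcd3 u : ℤ) ≠ 0 := by exact_mod_cast (gcd3_pos hu).ne'
  refine ⟨(v1, v2, v3), Prod.ext (by simpa using h1) (Prod.ext (by simpa using h2) (by simpa using h3)), ?_⟩
  intro k hk
  obtain ⟨b, hb⟩ := gcd3_bezout u
  have hb1 : b.1 * v1 + b.2.1 * v2 + b.2.2 * v3 = 1 := by
    apply mul_left_cancel₀ hd
    simp only [dot] at hb
    linear_combination hb - b.1 * h1 - b.2.1 * h2 - b.2.2 * h3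
  simp only [cross, Prod.mk_eq_zero] at hk
  obtain ⟨c1, c2, c3⟩ := hk
  have c1' : k.2.1 * v3 - k.2.2 * v2 = 0 := mul_left_cancel₀ hd (by
    linear_combination c1 - k.2.1 * h3 + k.2.2 * h2)
  have c2' : k.2.2 * v1 - k.1 * v3 = 0 := mul_left_cancel₀ hd (by
    linear_combination c2 - k.2.2 * h1 + k.1 * h3)
  have c3' : k.1 * v2 - k.2.1 * v1 = 0 := mul_left_cancel₀ hd (by
    linear_combination c3 - k.1 * h2 + k.2.1 * h1)
  refine ⟨k.1 * b.1 + k.2.1 * b.2.1 + k.2.2 * b.2.2, Prod.ext ?_ (Prod.ext ?_ ?_)⟩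
  · simp; linear_combination -k.1 * hb1 + b.2.1 * c3' - b.2.2 * c2'
  · simp; linear_combination -k.2.1 * hb1 - b.1 * c3' + b.2.2 * c1'
  · simp; linear_combination -k.2.2 * hb1 + b.1 * c2' - b.2.1 * c1'

lemma hasSum_segInt_fiber {s : ℝ} (hs : 0 < s) {u : Z3} (hu : u ≠ 0) (k₀ : Z3) :
    HasSum (fun k : {k : Z3 // cross k u = cross k₀ u} => segInt s u k)
      (rexp (-(π ^ 2 / s) * (normSq (cross k₀ u) / normSq u)) *
        (gcd3 u * (√(s / π) / √(normSq u)))) := by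
  obtain ⟨v, hv, hvk⟩ := exists_primitive hu
  have hd := gcd3_pos hu
  have hdR : (gcd3 u : ℝ) ≠ 0 := by exact_mod_cast hd.ne'
  have hU : (0 : ℝ) < normSq u := by exact_mod_cast normSq_pos hu
  have hv0 : v ≠ 0 := by rintro rfl; exact hu (by simpa using hv)
  have hu1 : (u.1 : ℝ) = gcd3 u * v.1 := by exact_mod_cast congrArg Prod.fst hv
  have hu2 : (u.2.1 : ℝ) = gcd3 u * v.2.1 := by exact_mod_cast congrArg (fun x => x.2.1) hv
  have hu3 : (u.2.2 : ℝ) = gcd3 u * v.2.2 := by exact_mod_cast congrArg (fun x => x.2.2) hv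
  have cv : ∀ j : ℤ, cross (k₀ + j • v) u = cross k₀ u := by
    intro j
    conv_lhs => rw [hv]
    conv_rhs => rw [hv]
    simp only [cross, Prod.mk.injEq, Prod.fst_add, Prod.snd_add, Prod.smul_fst, Prod.smul_snd, smul_eq_mul]
    refine ⟨?_, ?_, ?_⟩ <;> ring
  let e : ℤ ≃ {k : Z3 // cross k u = cross k₀ u} := Equiv.ofBijective (fun j => ⟨k₀ + j • v, cv j⟩) (by
    constructor
    · intro i j hij
      have := congrArg Subtype.val hij
      simp only [add_right_inj] at this
      have hinj : Function.Injective fun i : ℤ => i • v := smul_left_injective ℤ hv0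
      exact hinj this
    · rintro ⟨k, hk⟩
      have : cross (k - k₀) u = 0 := by
        simp only [cross, Prod.mk.injEq, Prod.mk_eq_zero, Prod.fst_sub, Prod.snd_sub] at hk ⊢
        refine ⟨by linear_combination hk.1, by linear_combination hk.2.1, by linear_combination hk.2.2⟩
      obtain ⟨j, hj⟩ := hvk _ this
      exact ⟨j, Subtype.ext (by simp [← hj])⟩)
  rw [← e.hasSum_iff]
  have hB : 0 < π ^ 2 / s * normSq u := by positivity
  have h := (hasSum_gauss_segments hB ((dot k₀ u : ℝ) / normSq u) hd).mul_left
    (rexp (-(π ^ 2 / s) * (normSq (cross k₀ u) / normSq u)))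
  have hval : √(s / π) / √(normSq u) = √(π / (π ^ 2 / s * normSq u)) := by
    rw [← Real.sqrt_div (by positivity)]
    congr 1
    field_simp
  rw [hval]
  refine (hasSum_congr fun j => ?_).mpr h
  · simp only [Function.comp, segInt, ← intervalIntegral.integral_const_mul]
    refine intervalIntegral.integral_congr fun β _ => ?_
    have hej : ((e j : {k : Z3 // cross k u = cross k₀ u}) : Z3) = k₀ + j • v := rfl
    simp only [hej, ← Real.exp_add]
    congr 1
    have hc : (normSq (cross k₀ u) : ℝ) = ((k₀.2.1 : ℝ) * u.2.2 - k₀.2.2 * u.2.1) ^ 2 + 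
      ((k₀.2.2 : ℝ) * u.1 - k₀.1 * u.2.2) ^ 2 + ((k₀.1 : ℝ) * u.2.1 - k₀.2.1 * u.1) ^ 2 := by
      rw [normSq_cast]; simp only [cross]; push_cast; ring
    have hdt : (dot k₀ u : ℝ) = k₀.1 * u.1 + k₀.2.1 * u.2.1 + k₀.2.2 * u.2.2 := by
      simp only [dot]; push_cast; ring
    have key : (normSq (cross k₀ u) : ℝ) / normSq u + normSq u * ((dot k₀ u : ℝ) / normSq u + j / gcd3 u - β) ^ 2 =
      ((((k₀ + j • v).1 : ℤ) : ℝ) - β * u.1) ^ 2 + ((((k₀ + j • v).2.1 : ℤ) : ℝ) - β * u.2.1) ^ 2 +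
      ((((k₀ + j • v).2.2 : ℤ) : ℝ) - β * u.2.2) ^ 2 := by
      have hj : ∀ x : ℝ, (j : ℝ) * x = (j / gcd3 u) * (gcd3 u * x) := fun x => by field_simp
      simp only [Prod.fst_add, Prod.snd_add, Prod.smul_fst, Prod.smul_snd, smul_eq_mul, Int.cast_add, Int.cast_mul]
      rw [hj, hj, hj, ← hu1, ← hu2, ← hu3]
      rw [hc, hdt]
      rw [normSq_cast] at hU ⊢
      generalize (j : ℝ) / gcd3 u = J
      field_simp
      ring
    rw [← key]
    ring

/-- A summable weight on `ℤ³`. -/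
def weight (w : Z3) : ℝ :=
  (1 + (w.1 : ℝ) ^ 2)⁻¹ * ((1 + (w.2.1 : ℝ) ^ 2)⁻¹ * (1 + (w.2.2 : ℝ) ^ 2)⁻¹)

lemma weight_pos (w : Z3) : 0 < weight w := by
  unfold weight; positivity

lemma summable_weight : Summable weight := by
  have h : Summable fun m : ℤ => (1 + (m : ℝ) ^ 2)⁻¹ := by
    refine Summable.of_nonneg_of_le (fun _ => by positivity) (fun m => ?_)
      (((Real.summable_one_div_int_pow (p := 2)).2 one_lt_two).add
        (hasSum_ite_eq (0 : ℤ) (1 : ℝ)).summable)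
    rcases eq_or_ne m 0 with rfl | hm
    · simp
    · simp only [if_neg hm, add_zero]
      rw [one_div]
      have : 0 < (m : ℝ) ^ 2 := by positivity
      gcongr
      linarith
  have h0 : 0 ≤ fun m : ℤ => (1 + (m : ℝ) ^ 2)⁻¹ := fun m => by
    have : (0 : ℝ) ≤ (1 + (m : ℝ) ^ 2)⁻¹ := by positivity
    exact this
  exact (summable_prod3 h h h h0 h0 h0).congr fun w => by rw [weight]

lemma inv_normSq_cube_le {w : Z3} (hw : w ≠ 0) : ((normSq w : ℝ) ^ 3)⁻¹ ≤ 8 * weight w := by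
  have h1 : (1 : ℝ) ≤ normSq w := by exact_mod_cast normSq_pos hw
  have e := normSq_cast w
  have h2 : (1 + (w.1 : ℝ) ^ 2) * ((1 + (w.2.1 : ℝ) ^ 2) * (1 + (w.2.2 : ℝ) ^ 2)) ≤
      (2 * normSq w) * ((2 * normSq w) * (2 * normSq w)) := by
    gcongr <;> nlinarith [sq_nonneg (w.1 : ℝ), sq_nonneg (w.2.1 : ℝ), sq_nonneg (w.2.2 : ℝ)]
  unfold weight
  rw [← mul_inv, ← mul_inv, inv_le_comm₀ (by positivity) (by positivity), mul_inv, inv_inv]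
  linarith

lemma exp_neg_le_pow_four {x : ℝ} (hx : 0 < x) : rexp (-x) ≤ 24 / x ^ 4 := by
  have := Real.pow_div_factorial_le_exp x hx.le 4
  rw [Real.exp_neg, inv_le_comm₀ (by positivity) (by positivity), inv_div]
  simpa [Nat.factorial] using this

lemma dot_cross (k u : Z3) : dot (cross k u) u = 0 := by
  simp only [dot, cross]; ring

lemma gcd3_le_normSq_cross {k u : Z3} (h : cross k u ≠ 0) : gcd3 u ≤ normSq (cross k u) := by
  obtain ⟨h1, h2, h3⟩ := gcd3_dvd u
  have key : ∀ x : ℤ, (gcd3 u : ℤ) ∣ x → x ≠ 0 → gcd3 u ≤ x.natAbs ^ 2 := fun x hd hx =>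
    (Nat.le_of_dvd (Int.natAbs_pos.2 hx) (Int.natCast_dvd.1 hd)).trans (Nat.le_self_pow two_ne_zero _)
  have d1 : (gcd3 u : ℤ) ∣ (cross k u).1 := dvd_sub (h3.mul_left _) (h2.mul_left _)
  have d2 : (gcd3 u : ℤ) ∣ (cross k u).2.1 := dvd_sub (h1.mul_left _) (h3.mul_left _)
  have d3 : (gcd3 u : ℤ) ∣ (cross k u).2.2 := dvd_sub (h2.mul_left _) (h1.mul_left _)
  have : (cross k u).1 ≠ 0 ∨ (cross k u).2.1 ≠ 0 ∨ (cross k u).2.2 ≠ 0 := by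
    by_contra! hc
    exact h (Prod.ext hc.1 (Prod.ext hc.2.1 hc.2.2))
  unfold normSq
  rcases this with h | h | h
  · have := key _ d1 h; omega
  · have := key _ d2 h; omega
  · have := key _ d3 h; omega

lemma even_dot_of_cross_eq_zero {k u : Z3} (hu : u ≠ 0) (he : Even (normSq u)) (hk : cross k u = 0) :
    Even (dot k u) := by
  obtain ⟨v, hv, hvk⟩ := exists_primitive hu
  obtain ⟨j, rfl⟩ := hvk k hk
  have h1 : (normSq u : ℤ) = gcd3 u * (gcd3 u * normSq v) := by
    conv_lhs => rw [hv]
    rw [normSq_cast_int, normSq_cast_int]; simp; ring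
  have h2 : dot (j • v) u = j * (gcd3 u * normSq v) := by
    conv_lhs => rw [hv]
    rw [normSq_cast_int]; simp [dot]; ring
  rw [← Int.even_coe_nat, h1] at he
  rw [h2]
  apply Even.mul_left
  simp only [Int.even_mul] at he ⊢
  tauto

lemma planeSum_bound {s : ℝ} (hs : 0 < s) {u : Z3} (hu : u ≠ 0) (he : Even (normSq u)) :
    |planeSum s u - π / s * (gcd3 u / √(normSq u))| ≤
      π / s / √(normSq u) * (192 * (s * normSq u) ^ 4) *
        ∑' w : Z3, if w ≠ 0 ∧ dot w u = 0 then weight w else 0 := by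
  classical
  have hU : (0 : ℝ) < normSq u := by exact_mod_cast normSq_pos hu
  set K : ℝ := √(s / π) / √(normSq u) with hK
  have hK0 : 0 ≤ K := by positivity
  have hS := summable_segInt hs u
  have hS0 := segInt_nonneg s u
  have hq : Summable fun k => (-1 : ℝ) ^ (dot k u).natAbs * segInt s u k :=
    Summable.of_norm_bounded hS fun k => by
      rw [norm_mul, norm_pow, norm_neg, norm_one, one_pow, one_mul, Real.norm_of_nonneg (hS0 k)]
  have hz : HasSum ({k : Z3 | cross k u = 0}.indicator (segInt s u)) (gcd3 u * K) := by
    rw [← hasSum_subtype_iff_indicator]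
    have h := hasSum_segInt_fiber hs hu 0
    have c0 : cross 0 u = 0 := by simp [cross]
    rw [c0] at h
    have n0 : normSq (0 : Z3) = 0 := normSq_eq_zero.2 rfl
    rw [n0, Nat.cast_zero, zero_div, mul_zero, Real.exp_zero, one_mul] at h
    exact h
  have hn : Summable ({k : Z3 | cross k u ≠ 0}.indicator (segInt s u)) := hS.indicator _
  have hw : Summable fun w : Z3 => if w ≠ 0 ∧ dot w u = 0 then weight w else 0 :=
    Summable.of_nonneg_of_le (fun w => by split_ifs; exacts [(weight_pos w).le, le_rfl])
      (fun w => by split_ifs; exacts [le_rfl, (weight_pos w).le]) summable_weight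
  have hE : ∑' k, {k : Z3 | cross k u ≠ 0}.indicator (segInt s u) k ≤
      K * (192 * (s * normSq u) ^ 4) * ∑' w : Z3, if w ≠ 0 ∧ dot w u = 0 then weight w else 0 := by
    have h1 := (Equiv.sigmaFiberEquiv (fun k => cross k u)).hasSum_iff.2 hn.hasSum
    have h2 := h1.sigma fun w => (h1.summable.sigma_factor w).hasSum
    refine hasSum_le (fun w => ?_) h2 (hw.hasSum.mul_left _)
    simp only [Function.comp_apply, Equiv.sigmaFiberEquiv_apply]
    by_cases hem : Nonempty {k // cross k u = w}
    · obtain ⟨k₀, rfl⟩ := hem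
      by_cases h0 : cross k₀ u = 0
      · rw [if_neg (by simp [h0]), mul_zero]
        refine le_of_eq ?_
        convert tsum_zero with k
        rw [indicator_of_notMem]
        simp [k.2, h0]
      · rw [if_pos ⟨h0, dot_cross _ _⟩]
        have e : ∀ k : {k // cross k u = cross k₀ u}, {k : Z3 | cross k u ≠ 0}.indicator (segInt s u) k = segInt s u k := by
          intro k
          rw [indicator_of_mem]
          simp [k.2, h0]
        simp_rw [e]
        rw [(hasSum_segInt_fiber hs hu k₀).tsum_eq, ← hK]
        have hN : (0 : ℝ) < normSq (cross k₀ u) := by exact_mod_cast normSq_pos h0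
        have hd : (gcd3 u : ℝ) ≤ normSq (cross k₀ u) := by exact_mod_cast gcd3_le_normSq_cross h0
        have b1 : rexp (-(π ^ 2 / s) * (normSq (cross k₀ u) / normSq u)) ≤
            24 * (s * normSq u) ^ 4 / (normSq (cross k₀ u) : ℝ) ^ 4 := by
          have h1 : rexp (-(π ^ 2 / s) * (normSq (cross k₀ u) / normSq u)) ≤
              rexp (-((normSq (cross k₀ u) : ℝ) / (s * normSq u))) := by
            apply Real.exp_le_exp.2
            have : (1 : ℝ) ≤ π ^ 2 := by nlinarith [Real.pi_gt_three]
            have h3 : 0 ≤ (normSq (cross k₀ u) : ℝ) / (s * normSq u) := by positivity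
            have h4 : -(π ^ 2 / s) * ((normSq (cross k₀ u) : ℝ) / normSq u) =
                -(π ^ 2 * ((normSq (cross k₀ u) : ℝ) / (s * normSq u))) := by
              field_simp
            rw [h4]
            nlinarith
          refine h1.trans ((exp_neg_le_pow_four (by positivity)).trans (le_of_eq ?_))
          field_simp
        calc _ ≤ 24 * (s * normSq u) ^ 4 / (normSq (cross k₀ u) : ℝ) ^ 4 * (normSq (cross k₀ u) * K) := by
              gcongr
          _ = K * (24 * (s * normSq u) ^ 4) * ((normSq (cross k₀ u) : ℝ) ^ 3)⁻¹ := by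
              field_simp
          _ ≤ K * (24 * (s * normSq u) ^ 4) * (8 * weight (cross k₀ u)) := by
              gcongr; exact inv_normSq_cube_le h0
          _ = _ := by ring
    · rw [not_nonempty_iff] at hem
      rw [tsum_empty]
      have := (weight_pos w).le
      split_ifs <;> positivity
  have hsq : √(π / s) ^ 3 * K = π / s / √(normSq u) := by
    rw [hK]
    have e1 : √(π / s) * √(s / π) = 1 := by
      rw [← Real.sqrt_mul (by positivity)]
      rw [Real.sqrt_eq_one]; field_simp
    have e2 : √(π / s) ^ 2 = π / s := Real.sq_sqrt (by positivity)
    calc _ = √(π / s) ^ 2 * (√(π / s) * √(s / π)) / √(normSq u) := by ring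
      _ = _ := by rw [e1, e2, mul_one]
  have hdiff : |(∑' k : Z3, (-1 : ℝ) ^ (dot k u).natAbs * segInt s u k) - gcd3 u * K| ≤
      ∑' k, {k : Z3 | cross k u ≠ 0}.indicator (segInt s u) k := by
    rw [← hz.tsum_eq, ← hq.tsum_sub hz.summable, ← Real.norm_eq_abs]
    refine tsum_of_norm_bounded hn.hasSum fun k => ?_
    by_cases h0 : cross k u = 0
    · rw [indicator_of_mem (by exact h0), indicator_of_notMem (by simp [h0]),
        (Int.natAbs_even.2 (even_dot_of_cross_eq_zero hu he h0)).neg_one_pow]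
      simp
    · rw [indicator_of_notMem (by exact h0), indicator_of_mem (by exact h0), sub_zero,
        norm_mul, norm_pow, norm_neg, norm_one, one_pow, one_mul, Real.norm_of_nonneg (hS0 k)]
  rw [planeSum_eq hs he]
  have e3 : π / s * (gcd3 u / √(normSq u)) = √(π / s) ^ 3 * (gcd3 u * K) := by
    rw [mul_left_comm, hsq]; ring
  rw [e3, ← mul_sub, abs_mul, abs_of_nonneg (by positivity : 0 ≤ √(π / s) ^ 3)]
  calc _ ≤ √(π / s) ^ 3 * (K * (192 * (s * normSq u) ^ 4) * ∑' w : Z3, if w ≠ 0 ∧ dot w u = 0 then weight w else 0) := by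
        gcongr; exact hdiff.trans hE
    _ = _ := by rw [← hsq]; ring

lemma theta_le : ∃ C : ℝ, 1 ≤ C ∧ ∀ s : ℝ, 0 < s → s ≤ 1 → theta s ≤ C / √s := by
  obtain ⟨C, hC, -, h⟩ := theta_asymp
  refine ⟨√π + C, by linarith [Real.sqrt_nonneg π], fun s hs hs1 => ?_⟩
  have h1 := (abs_le.1 (h s hs (by linarith))).2
  have h2 : √s ≤ 1 := Real.sqrt_le_one.2 hs1
  have h3 : 0 < √s := Real.sqrt_pos.2 hs
  rw [Real.sqrt_div pi_pos.le] at h1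
  rw [add_div]
  have : C ≤ C / √s := by rw [le_div_iff₀ h3]; nlinarith
  linarith

lemma hasSum_theta_sq {s : ℝ} (hs : 0 < s) :
    HasSum (fun p : ℤ × ℤ => rexp (-s * ((p.1 : ℝ) ^ 2 + (p.2 : ℝ) ^ 2))) (theta s ^ 2) := by
  have h := summable_exp_neg_mul_sq hs
  have h2 := h.hasSum.mul h.hasSum (h.mul_of_nonneg h (fun _ => (exp_pos _).le) (fun _ => (exp_pos _).le))
  rw [pow_two]
  refine (hasSum_congr fun p => ?_).mpr h2
  rw [← Real.exp_add]; ring_nf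

lemma tsum_plane_le_of_injOn {s : ℝ} (hs : 0 < s) {w : Z3} (φ : Z3 → ℤ × ℤ)
    (hφ : ∀ u : Z3, ((φ u).1 : ℝ) ^ 2 + ((φ u).2 : ℝ) ^ 2 ≤ normSq u)
    (hinj : InjOn φ {u | dot w u = 0}) :
    ∑' u : Z3, (if dot w u = 0 then rexp (-s * (normSq u : ℝ)) else 0) ≤ theta s ^ 2 := by
  classical
  have hsub : ∑' u : Z3, (if dot w u = 0 then rexp (-s * (normSq u : ℝ)) else 0) =
      ∑' u : {u : Z3 | dot w u = 0}, rexp (-s * (normSq (u : Z3) : ℝ)) := by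
    rw [tsum_subtype {u : Z3 | dot w u = 0} (fun u => rexp (-s * (normSq u : ℝ)))]
    refine tsum_congr fun u => ?_
    simp [indicator_apply]
  rw [hsub, ← (hasSum_theta_sq hs).tsum_eq]
  refine Summable.tsum_le_tsum_of_inj (fun u : {u : Z3 | dot w u = 0} => φ u)
    (fun a b h => Subtype.ext (hinj a.2 b.2 h)) (fun _ _ => (exp_pos _).le) (fun u => ?_)
    ((summable_exp_normSq hs).subtype _) (hasSum_theta_sq hs).summable
  apply Real.exp_le_exp.2
  nlinarith [hφ u]

lemma tsum_plane_le {s : ℝ} (hs : 0 < s) {w : Z3} (hw : w ≠ 0) :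
    ∑' u : Z3, (if dot w u = 0 then rexp (-s * (normSq u : ℝ)) else 0) ≤ theta s ^ 2 := by
  have h3 : w.1 ≠ 0 ∨ w.2.1 ≠ 0 ∨ w.2.2 ≠ 0 := by
    by_contra! hc
    exact hw (Prod.ext hc.1 (Prod.ext hc.2.1 hc.2.2))
  rcases h3 with h | h | h
  · refine tsum_plane_le_of_injOn hs (fun u => u.2) (fun u => ?_) ?_
    · rw [normSq_cast]; nlinarith [sq_nonneg (u.1 : ℝ)]
    · rintro ⟨a, b, c⟩ h1 ⟨a', b', c'⟩ h2 e
      simp only [Prod.mk.injEq] at e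
      obtain ⟨rfl, rfl⟩ := e
      simp only [dot, mem_ofPred_eq] at h1 h2
      have : a = a' := mul_left_cancel₀ h (by linarith)
      rw [this]
  · refine tsum_plane_le_of_injOn hs (fun u => (u.1, u.2.2)) (fun u => ?_) ?_
    · rw [normSq_cast]; nlinarith [sq_nonneg (u.2.1 : ℝ)]
    · rintro ⟨a, b, c⟩ h1 ⟨a', b', c'⟩ h2 e
      simp only [Prod.mk.injEq] at e
      obtain ⟨rfl, rfl⟩ := e
      simp only [dot, mem_ofPred_eq] at h1 h2
      have : b = b' := mul_left_cancel₀ h (by linarith)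
      rw [this]
  · refine tsum_plane_le_of_injOn hs (fun u => (u.1, u.2.1)) (fun u => ?_) ?_
    · rw [normSq_cast]; nlinarith [sq_nonneg (u.2.2 : ℝ)]
    · rintro ⟨a, b, c⟩ h1 ⟨a', b', c'⟩ h2 e
      simp only [Prod.mk.injEq] at e
      obtain ⟨rfl, rfl⟩ := e
      simp only [dot, mem_ofPred_eq] at h1 h2
      have : c = c' := mul_left_cancel₀ h (by linarith)
      rw [this]

lemma summable_plane_weight {s : ℝ} (hs : 0 < s) : Summable fun x : Z3 × Z3 =>
    rexp (-s * (normSq x.1 : ℝ)) * (if x.2 ≠ 0 ∧ dot x.2 x.1 = 0 then weight x.2 else 0) := by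
  refine Summable.of_nonneg_of_le (fun x => ?_) (fun x => ?_)
    ((summable_exp_normSq hs).mul_of_nonneg summable_weight (fun _ => (exp_pos _).le)
      (fun w => (weight_pos w).le))
  · have := (weight_pos x.2).le
    split_ifs <;> positivity
  · have := (weight_pos x.2).le
    split_ifs
    · exact le_rfl
    · rw [mul_zero]; positivity

lemma tsum_plane_weight_le {s : ℝ} (hs : 0 < s) :
    ∑' u : Z3, rexp (-s * (normSq u : ℝ)) * ∑' w : Z3, (if w ≠ 0 ∧ dot w u = 0 then weight w else 0) ≤
      theta s ^ 2 * ∑' w, weight w := by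
  simp_rw [← tsum_mul_left]
  have hsum := summable_plane_weight hs
  rw [← hsum.tsum_comm (f := fun u w : Z3 => rexp (-s * (normSq u : ℝ)) * (if w ≠ 0 ∧ dot w u = 0 then weight w else 0))]
  refine Summable.tsum_le_tsum (fun w => ?_) hsum.prod_symm.prod (summable_weight.mul_left _)
  rcases eq_or_ne w 0 with rfl | hw
  · simp only [ne_eq, not_true_eq_false, false_and, if_false, mul_zero, tsum_zero]
    have := (weight_pos 0).le
    positivity
  · calc _ = (∑' u : Z3, (if dot w u = 0 then rexp (-s * (normSq u : ℝ)) else 0)) * weight w := by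
          rw [← tsum_mul_right]
          refine tsum_congr fun u => ?_
          by_cases hd : dot w u = 0 <;> simp [hd, hw]
      _ ≤ _ := by
          have := (weight_pos w).le
          gcongr; exact tsum_plane_le hs hw

/-- The main term of the shifted convolution sums, as a function of the difference vector. -/
def gcdTerm (s : ℝ) (u : Z3) : ℝ :=
  if u ≠ 0 ∧ Even (normSq u) then gcd3 u / √(normSq u) * rexp (-(s / 4) * (normSq u : ℝ)) else 0

lemma exp_mul_pow_le {y : ℝ} (hy : 0 ≤ y) :
    rexp (-(1 / 4) * y) * (y ^ 3 * √y) ≤ 101376 * rexp (-(1 / 8) * y) := by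
  have h1 : √y ≤ 1 + y := by
    rw [Real.sqrt_le_left (by linarith)]; nlinarith
  have h3 := Real.pow_div_factorial_le_exp (y / 8) (by positivity) 3
  have h4 := Real.pow_div_factorial_le_exp (y / 8) (by positivity) 4
  simp only [Nat.factorial] at h3 h4
  norm_num at h3 h4
  have h5 : y ^ 3 * √y ≤ 101376 * rexp (y / 8) := by
    have : y ^ 3 * √y ≤ y ^ 3 * (1 + y) := by gcongr
    refine this.trans ?_
    nlinarith
  calc _ ≤ rexp (-(1 / 4) * y) * (101376 * rexp (y / 8)) := by gcongr
    _ = 101376 * (rexp (-(1 / 4) * y) * rexp (y / 8)) := by ring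
    _ = _ := by rw [← Real.exp_add]; ring_nf

lemma laplaceSq_sub_gcdTerm : ∃ C : ℝ, 0 ≤ C ∧ ∀ s : ℝ, 0 < s → s ≤ 1 →
    Summable (gcdTerm s) ∧ |laplaceSq s - π / s * ∑' u, gcdTerm s u| ≤ C / (s * √s) := by
  obtain ⟨C, hC, hθ⟩ := theta_le
  set W := ∑' w, weight w
  have hW : 0 ≤ W := tsum_nonneg fun w => (weight_pos w).le
  refine ⟨C ^ 3 + π * 192 * 101376 * (8 * C ^ 2 * W), by positivity, fun s hs hs1 => ?_⟩
  have hsq : 0 < √s := Real.sqrt_pos.2 hs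
  have hss : √s * √s = s := Real.mul_self_sqrt hs.le
  have hP := hasSum_planeSum hs
  have hs8 : 0 < s / 8 := by positivity
  let A : Z3 → ℝ := fun u => rexp (-(s / 8) * (normSq u : ℝ)) *
    ∑' w : Z3, (if w ≠ 0 ∧ dot w u = 0 then weight w else 0)
  have hA : Summable A := by
    have := (summable_plane_weight hs8).prod
    simp_rw [tsum_mul_left] at this
    exact this
  let E : Z3 → ℝ := fun u => (if u = 0 then theta s ^ 3 else 0) + π * 192 * 101376 / √s * A u
  have hE : Summable E := (hasSum_ite_eq (0 : Z3) (theta s ^ 3)).summable.add (hA.mul_left _)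
  have hAnn : ∀ u, 0 ≤ A u := fun u => mul_nonneg (exp_pos _).le
    (tsum_nonneg fun w => by split_ifs; exacts [(weight_pos w).le, le_rfl])
  have hbound : ∀ u, ‖rexp (-(s / 4) * (normSq u : ℝ)) * planeSum s u - π / s * gcdTerm s u‖ ≤ E u := by
    intro u
    rw [Real.norm_eq_abs]
    have hA2 : 0 ≤ π * 192 * 101376 / √s * A u := mul_nonneg (by positivity) (hAnn u)
    have hθ0 : 0 ≤ theta s ^ 3 := by have := theta_pos hs; positivity
    by_cases hu : u = 0
    · subst hu
      have n0 : normSq (0 : Z3) = 0 := normSq_eq_zero.2 rfl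
      have hp0 : planeSum s 0 = theta s ^ 3 := by
        rw [planeSum, ← tsum_exp_normSq hs]
        refine tsum_congr fun a => ?_
        rw [if_pos (by simp [dot, n0]), normSq_cast]
        simp
      simp only [gcdTerm, E, hp0, n0]
      simp only [ne_eq, not_true_eq_false, false_and, if_false, mul_zero, sub_zero, if_true,
        Nat.cast_zero, Real.exp_zero, one_mul, abs_of_nonneg hθ0]
      linarith
    · by_cases he : Even (normSq u)
      · simp only [gcdTerm, if_pos (And.intro hu he), E, if_neg hu, zero_add]
        have hU : (0 : ℝ) < normSq u := by exact_mod_cast normSq_pos hu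
        have hb := planeSum_bound hs hu he
        have hy := exp_mul_pow_le (y := s * normSq u) (by positivity)
        have e1 : rexp (-(s / 4) * (normSq u : ℝ)) * planeSum s u -
            π / s * (gcd3 u / √(normSq u) * rexp (-(s / 4) * (normSq u : ℝ))) =
            rexp (-(s / 4) * (normSq u : ℝ)) * (planeSum s u - π / s * (gcd3 u / √(normSq u))) := by ring
        rw [e1, abs_mul, abs_of_pos (exp_pos _)]
        simp only [A]
        set S := ∑' w : Z3, (if w ≠ 0 ∧ dot w u = 0 then weight w else 0)
        have hS : 0 ≤ S := tsum_nonneg fun w => by split_ifs; exacts [(weight_pos w).le, le_rfl]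
        have e2 : π / s / √(normSq u) * (192 * (s * normSq u) ^ 4) =
            π * 192 / √s * ((s * normSq u) ^ 3 * √(s * normSq u)) := by
          rw [Real.sqrt_mul hs.le]
          have hUs : 0 < √(normSq u : ℝ) := Real.sqrt_pos.2 hU
          have hUU : √(normSq u : ℝ) * √(normSq u : ℝ) = normSq u := Real.mul_self_sqrt hU.le
          field_simp
          rw [pow_two, hUU]
        rw [e2] at hb
        calc _ ≤ rexp (-(s / 4) * (normSq u : ℝ)) * (π * 192 / √s * ((s * normSq u) ^ 3 * √(s * normSq u)) * S) := by gcongr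
          _ = π * 192 / √s * S * (rexp (-(1 / 4) * (s * normSq u)) * ((s * normSq u) ^ 3 * √(s * normSq u))) := by
              rw [show -(s / 4) * (normSq u : ℝ) = -(1 / 4) * (s * normSq u) by ring]; ring
          _ ≤ π * 192 / √s * S * (101376 * rexp (-(1 / 8) * (s * normSq u))) := by gcongr
          _ = _ := by rw [show -(1 / 8) * (s * (normSq u : ℝ)) = -(s / 8) * normSq u by ring]; ring
      · simp only [gcdTerm, planeSum_odd s he, E, he, and_false, if_false, if_neg hu]
        simpa using hA2
  have hD : Summable fun u => rexp (-(s / 4) * (normSq u : ℝ)) * planeSum s u - π / s * gcdTerm s u :=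
    Summable.of_norm_bounded hE hbound
  have hG : Summable (gcdTerm s) := by
    have := (hP.summable.sub hD).mul_left (s / π)
    refine this.congr fun u => ?_
    rw [sub_sub_cancel]
    field_simp
  refine ⟨hG, ?_⟩
  rw [← hP.tsum_eq, ← tsum_mul_left, ← hP.summable.tsum_sub (hG.mul_left _), ← Real.norm_eq_abs]
  refine (tsum_of_norm_bounded hE.hasSum hbound).trans ?_
  have e : ∑' u, E u = theta s ^ 3 + π * 192 * 101376 / √s * ∑' u, A u := by
    rw [Summable.tsum_add (hasSum_ite_eq (0 : Z3) (theta s ^ 3)).summable (hA.mul_left _), tsum_ite_eq, tsum_mul_left]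
  have hθs : theta s ^ 3 ≤ C ^ 3 / (s * √s) := by
    have := theta_pos hs
    calc theta s ^ 3 ≤ (C / √s) ^ 3 := by gcongr; exact hθ s hs hs1
      _ = C ^ 3 / (√s * √s * √s) := by rw [div_pow]; ring
      _ = _ := by rw [hss]
  have hθ8 : theta (s / 8) ^ 2 ≤ 8 * C ^ 2 / s := by
    have := theta_pos hs8
    calc theta (s / 8) ^ 2 ≤ (C / √(s / 8)) ^ 2 := by gcongr; exact hθ _ hs8 (by linarith)
      _ = _ := by rw [div_pow, Real.sq_sqrt hs8.le]; field_simp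
  have hAs : ∑' u, A u ≤ 8 * C ^ 2 / s * W := (tsum_plane_weight_le hs8).trans (by gcongr)
  rw [e]
  calc _ ≤ C ^ 3 / (s * √s) + π * 192 * 101376 / √s * (8 * C ^ 2 / s * W) := by gcongr
    _ = _ := by field_simp

lemma integral_add_sq_rpow {p : ℝ} (hp : 1 / 2 < p) {s : ℝ} (hs : 0 < s) :
    Integrable (fun y : ℝ => (s + y ^ 2) ^ (-p)) ∧
      ∫ y : ℝ, (s + y ^ 2) ^ (-p) = s ^ (1 / 2 - p) * ∫ y : ℝ, (1 + y ^ 2) ^ (-p) := by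
  have h1 : Integrable (fun y : ℝ => (1 + y ^ 2) ^ (-p)) := by
    have := integrable_rpow_neg_one_add_norm_sq (E := ℝ) (μ := volume) (r := 2 * p) (by simp; linarith)
    refine this.congr (ae_of_all _ fun y => ?_)
    simp only [Real.norm_eq_abs, sq_abs]
    congr 1; ring
  have hsq : 0 < √s := Real.sqrt_pos.2 hs
  have e : ∀ y : ℝ, (s + y ^ 2) ^ (-p) = s ^ (-p) * (1 + ((√s)⁻¹ * y) ^ 2) ^ (-p) := fun y => by
    rw [← Real.mul_rpow hs.le (by positivity), mul_pow, inv_pow, Real.sq_sqrt hs.le]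
    congr 1; field_simp
  simp_rw [e]
  refine ⟨(h1.comp_mul_left' (inv_ne_zero hsq.ne')).const_mul _, ?_⟩
  rw [integral_const_mul, Measure.integral_comp_mul_left (fun y : ℝ => (1 + y ^ 2) ^ (-p)), inv_inv,
    abs_of_pos hsq, smul_eq_mul, ← mul_assoc, Real.sqrt_eq_rpow, ← Real.rpow_add hs]
  congr 2; ring

lemma integral_one_add_sq_rpow_pos {p : ℝ} (hp : 1 / 2 < p) :
    0 < ∫ y : ℝ, (1 + y ^ 2) ^ (-p) := by
  refine integral_pos_of_integrable_nonneg_nonzero (x := 0) ?_ (integral_add_sq_rpow hp one_pos).1 (fun y => ?_) ?_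
  · refine Continuous.rpow_const (by fun_prop) fun y => Or.inl (by positivity)
  · positivity
  · simp

lemma hasSum_inv_norm_exp {P : Z3 → Prop} [DecidablePred P] {c C : ℝ} (hc : 0 < c) (hC : 0 ≤ C) (hP : P 0)
    (h : ∀ s : ℝ, 0 < s → |(∑' p : Z3, if P p then rexp (-s * (normSq p : ℝ)) else 0) - 1 - c * √(π / s) ^ 3| ≤
      C * s ^ (-(5 / 4) : ℝ)) :
    ∃ κ D : ℝ, 0 < κ ∧ 0 ≤ D ∧ ∀ s : ℝ, 0 < s →
      Summable (fun p : Z3 => if p ≠ 0 ∧ P p then (√(normSq p))⁻¹ * rexp (-s * (normSq p : ℝ)) else 0) ∧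
      |(∑' p : Z3, if p ≠ 0 ∧ P p then (√(normSq p))⁻¹ * rexp (-s * (normSq p : ℝ)) else 0) - κ / s| ≤
        D * s ^ (-(3 / 4) : ℝ) := by
  have I1 := integral_one_add_sq_rpow_pos (p := 3 / 2) (by norm_num)
  have I2 := integral_one_add_sq_rpow_pos (p := 5 / 4) (by norm_num)
  refine ⟨(√π)⁻¹ * (c * √π ^ 3 * ∫ y : ℝ, (1 + y ^ 2) ^ (-(3 / 2) : ℝ)),
    (√π)⁻¹ * (C * ∫ y : ℝ, (1 + y ^ 2) ^ (-(5 / 4) : ℝ)), by positivity, by positivity, fun s hs => ?_⟩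
  let F : Z3 → ℝ → ℝ := fun p y => if p ≠ 0 ∧ P p then rexp (-(s + y ^ 2) * (normSq p : ℝ)) else 0
  have hF : ∀ p, F p = fun y => (if p ≠ 0 ∧ P p then rexp (-s * (normSq p : ℝ)) else 0) * rexp (-(normSq p : ℝ) * y ^ 2) := by
    intro p; ext y
    simp only [F]
    split_ifs
    · rw [← Real.exp_add]; ring_nf
    · simp
  have hFi : ∀ p, Integrable (F p) := by
    intro p
    by_cases hp : p ≠ 0 ∧ P p
    · rw [hF p]
      exact (integrable_exp_neg_mul_sq (by exact_mod_cast normSq_pos hp.1)).const_mul _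
    · simp [F, hp]
  have hFint : ∀ p, ∫ y, F p y = √π * if p ≠ 0 ∧ P p then (√(normSq p))⁻¹ * rexp (-s * (normSq p : ℝ)) else 0 := by
    intro p
    rw [hF p, integral_const_mul, integral_gaussian, Real.sqrt_div pi_pos.le]
    split_ifs
    · ring
    · simp
  have hsm : Summable (fun p : Z3 => if p ≠ 0 ∧ P p then (√(normSq p))⁻¹ * rexp (-s * (normSq p : ℝ)) else 0) := by
    refine Summable.of_nonneg_of_le (fun p => by split_ifs <;> positivity) (fun p => ?_) (summable_exp_normSq hs)
    split_ifs with hp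
    · have h1 : (1 : ℝ) ≤ √(normSq p) := by
        rw [Real.one_le_sqrt]; exact_mod_cast normSq_pos hp.1
      have := inv_le_one_of_one_le₀ h1
      have h2 := exp_pos (-s * (normSq p : ℝ))
      nlinarith
    · positivity
  refine ⟨hsm, ?_⟩
  have hF0 : ∀ p y, 0 ≤ F p y := fun p y => by simp only [F]; split_ifs <;> positivity
  have hsw := hasSum_integral_of_summable_integral_norm (μ := volume) (F := F) hFi (by
    simp_rw [Real.norm_of_nonneg (hF0 _ _), hFint]
    exact hsm.mul_left _)
  simp_rw [hFint] at hsw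
  have e1 := (hsm.hasSum.mul_left √π).unique hsw
  have e2 : ∀ y : ℝ, ∑' p, F p y = (∑' p : Z3, if P p then rexp (-(s + y ^ 2) * (normSq p : ℝ)) else 0) - 1 := by
    intro y
    have hsy : 0 < s + y ^ 2 := by positivity
    have hs1 : Summable fun p : Z3 => if P p then rexp (-(s + y ^ 2) * (normSq p : ℝ)) else 0 :=
      Summable.of_nonneg_of_le (fun p => by split_ifs <;> positivity)
        (fun p => by split_ifs; exacts [le_rfl, (exp_pos _).le]) (summable_exp_normSq hsy)
    rw [← tsum_ite_eq (0 : Z3) (fun _ => (1 : ℝ)), ← hs1.tsum_sub (hasSum_ite_eq (0 : Z3) (1 : ℝ)).summable]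
    refine tsum_congr fun p => ?_
    simp only [F]
    by_cases hp : p = 0
    · subst hp; simp [hP, normSq_eq_zero.2]
    · simp [hp]
  simp_rw [e2] at e1
  obtain ⟨J1, J1e⟩ := integral_add_sq_rpow (p := 3 / 2) (by norm_num) hs
  obtain ⟨J2, J2e⟩ := integral_add_sq_rpow (p := 5 / 4) (by norm_num) hs
  have e3 : ∀ y : ℝ, √(π / (s + y ^ 2)) ^ 3 = √π ^ 3 * (s + y ^ 2) ^ (-(3 / 2) : ℝ) := by
    intro y
    have hsy : 0 < s + y ^ 2 := by positivity
    rw [Real.sqrt_div pi_pos.le, div_pow, Real.sqrt_eq_rpow (s + y ^ 2), ← Real.rpow_natCast,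
      ← Real.rpow_natCast, ← Real.rpow_mul hsy.le, div_eq_mul_inv, ← Real.rpow_neg hsy.le]
    norm_num
  have hmain : Integrable fun y : ℝ => c * √π ^ 3 * (s + y ^ 2) ^ (-(3 / 2) : ℝ) := J1.const_mul _
  have hle : ∀ y : ℝ, ‖((∑' p : Z3, if P p then rexp (-(s + y ^ 2) * (normSq p : ℝ)) else 0) - 1) -
      c * √π ^ 3 * (s + y ^ 2) ^ (-(3 / 2) : ℝ)‖ ≤ C * (s + y ^ 2) ^ (-(5 / 4) : ℝ) := by
    intro y
    have := h (s + y ^ 2) (by positivity)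
    rwa [e3, ← mul_assoc] at this
  by_cases hfi : Integrable fun y : ℝ => (∑' p : Z3, if P p then rexp (-(s + y ^ 2) * (normSq p : ℝ)) else 0) - 1
  swap
  · exfalso
    apply hfi
    have hm : AEStronglyMeasurable (fun y : ℝ => (∑' p : Z3, if P p then rexp (-(s + y ^ 2) * (normSq p : ℝ)) else 0) - 1) := by
      have : Measurable fun y => ∑' p, F p y := Measurable.tsum fun p => by
        rw [hF p]; fun_prop
      simp_rw [e2] at this
      exact this.aestronglyMeasurable
    refine Integrable.mono' ((J2.const_mul C).add (hmain.norm)) hm (ae_of_all _ fun y => ?_)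
    have := hle y
    simp only [Pi.add_apply]
    calc _ = ‖((∑' p : Z3, if P p then rexp (-(s + y ^ 2) * (normSq p : ℝ)) else 0) - 1 -
          c * √π ^ 3 * (s + y ^ 2) ^ (-(3 / 2) : ℝ)) + c * √π ^ 3 * (s + y ^ 2) ^ (-(3 / 2) : ℝ)‖ := by
            rw [sub_add_cancel]
      _ ≤ _ := (norm_add_le _ _).trans (by gcongr)
  have hb := norm_integral_le_of_norm_le (J2.const_mul C) (ae_of_all _ hle)
  rw [integral_sub hfi hmain, integral_const_mul, integral_const_mul, J1e, J2e, ← e1, Real.norm_eq_abs] at hb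
  have hs1 : s ^ ((1 : ℝ) / 2 - 3 / 2) = s⁻¹ := by rw [← Real.rpow_neg_one]; norm_num
  have hs2 : s ^ ((1 : ℝ) / 2 - 5 / 4) = s ^ (-(3 / 4) : ℝ) := by norm_num
  rw [hs1, hs2] at hb
  have hπ : 0 < √π := Real.sqrt_pos.2 pi_pos
  have hfin := mul_le_mul_of_nonneg_left hb (inv_nonneg.2 hπ.le)
  rw [← abs_of_pos (inv_pos.2 hπ), ← abs_mul, mul_sub, inv_mul_cancel_left₀ hπ.ne', abs_of_pos (inv_pos.2 hπ)] at hfin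
  generalize s ^ (-(3 / 4) : ℝ) = a at hfin ⊢
  generalize (∫ y : ℝ, (1 + y ^ 2) ^ (-(3 / 2) : ℝ)) = i₁ at hfin ⊢
  generalize (∫ y : ℝ, (1 + y ^ 2) ^ (-(5 / 4) : ℝ)) = i₂ at hfin ⊢
  rw [show (√π)⁻¹ * (c * √π ^ 3 * i₁) / s = (√π)⁻¹ * (c * √π ^ 3 * (s⁻¹ * i₁)) by ring,
    show (√π)⁻¹ * (C * i₂) * a = (√π)⁻¹ * (C * (a * i₂)) by ring]
  exact hfin

lemma normSq_nsmul (e : ℕ) (w : Z3) : normSq (e • w) = e ^ 2 * normSq w := by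
  rw [← @Nat.cast_inj ℤ]
  push_cast
  rw [normSq_cast_int, normSq_cast_int]
  simp; ring

lemma gcdTerm_eq (s : ℝ) (u : Z3) : HasSum (fun e : ℕ => if 0 < e ∧ e ∣ gcd3 u then
    (e.totient : ℝ) * (if u ≠ 0 ∧ Even (normSq u) then
      (√(normSq u))⁻¹ * rexp (-(s / 4) * (normSq u : ℝ)) else 0) else 0) (gcdTerm s u) := by
  classical
  by_cases hu : u ≠ 0 ∧ Even (normSq u)
  · have hd := gcd3_pos hu.1
    have : gcdTerm s u = ∑ e ∈ (gcd3 u).divisors, (if 0 < e ∧ e ∣ gcd3 u then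
      (e.totient : ℝ) * (if u ≠ 0 ∧ Even (normSq u) then
      (√(normSq u))⁻¹ * rexp (-(s / 4) * (normSq u : ℝ)) else 0) else 0) := by
      rw [gcdTerm, if_pos hu]
      conv_lhs => rw [← Nat.sum_totient (gcd3 u)]
      push_cast
      rw [Finset.sum_div, Finset.sum_mul]
      refine Finset.sum_congr rfl fun e he => ?_
      have he' := Nat.dvd_of_mem_divisors he
      rw [if_pos ⟨Nat.pos_of_mem_divisors he, he'⟩, if_pos hu, div_eq_mul_inv, mul_assoc]
    rw [this]
    refine hasSum_sum_of_ne_finset_zero fun e he => ?_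
    rw [if_neg]
    rintro ⟨-, h⟩
    exact he (Nat.mem_divisors.2 ⟨h, hd.ne'⟩)
  · simp only [if_neg hu, mul_zero, ite_self, gcdTerm]
    exact hasSum_zero

lemma dvd_gcd3_iff_exists {e : ℕ} {u : Z3} : e ∣ gcd3 u ↔ ∃ w : Z3, e • w = u := by
  rw [dvd_gcd3]
  constructor
  · rintro ⟨⟨a, ha⟩, ⟨b, hb⟩, ⟨c, hc⟩⟩
    exact ⟨(a, b, c), Prod.ext (by simp [ha]) (Prod.ext (by simp [hb]) (by simp [hc]))⟩
  · rintro ⟨w, rfl⟩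
    simp

lemma laplaceSq_asymp : ∃ c C : ℝ, 0 < c ∧ 0 ≤ C ∧ ∀ s : ℝ, 0 < s → s ≤ 1 →
    |laplaceSq s - c / s ^ 2| ≤ C * s ^ (-(7 / 4) : ℝ) := by
  classical
  obtain ⟨Cθ, hCθ, hθ⟩ := theta_cube_asymp
  obtain ⟨κ₁, D₁, hκ₁, hD₁, K₁⟩ := hasSum_inv_norm_exp (P := fun _ => True) (c := 1) (C := Cθ) one_pos hCθ trivial
    (fun s hs => by simp only [if_true, tsum_exp_normSq hs, one_mul]; exact (hθ s hs).1)
  obtain ⟨κ₂, D₂, hκ₂, hD₂, K₂⟩ := hasSum_inv_norm_exp (P := fun p => Even (normSq p)) (c := 1 / 2) (C := Cθ)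
    (by norm_num) hCθ (by rw [normSq_eq_zero.2 rfl]; exact Even.zero)
    (fun s hs => by
      have := (hθ s hs).2
      rw [tsum_exp_normSq_even hs]
      convert this using 3; ring)
  obtain ⟨C₀, hC₀, hB⟩ := laplaceSq_sub_gcdTerm
  let κ : ℕ → ℝ := fun e => if Even e then κ₁ else κ₂
  let D := D₁ + D₂
  have hκ0 : ∀ e, 0 ≤ κ e := fun e => by simp only [κ]; split_ifs <;> positivity
  have hκle : ∀ e, κ e ≤ κ₁ + κ₂ := fun e => by simp only [κ]; split_ifs <;> linarith
  have htot : ∀ e : ℕ, 0 < e → (e.totient : ℝ) / e ≤ 1 := fun e he => by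
    rw [div_le_one (by exact_mod_cast he)]; exact_mod_cast Nat.totient_le e
  let m : ℕ → ℝ := fun e => (e.totient : ℝ) / e * (κ e * 4 / (e : ℝ) ^ 2)
  have hm0 : ∀ e, 0 ≤ m e := fun e => by have := hκ0 e; positivity
  have hm : Summable m := by
    refine Summable.of_nonneg_of_le hm0 (fun e => ?_)
      ((Real.summable_one_div_nat_pow (p := 2)).2 one_lt_two |>.mul_left ((κ₁ + κ₂) * 4))
    rcases Nat.eq_zero_or_pos e with rfl | he
    · simp [m]
    · have h1 := htot e he
      have h2 := hκle e
      have h0 : (0 : ℝ) < e := by exact_mod_cast he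
      have h3 := hκ0 e
      calc m e ≤ 1 * ((κ₁ + κ₂) * 4 / (e : ℝ) ^ 2) := by simp only [m]; gcongr
        _ = _ := by ring
  let r : ℕ → ℝ := fun e => (e : ℝ) ^ (-(3 / 2) : ℝ)
  have hr : Summable r := Real.summable_nat_rpow.2 (by norm_num)
  have hM : 0 < ∑' e, m e := by
    refine hm.tsum_pos hm0 1 ?_
    have : 0 < κ 1 := by simp [κ, hκ₂]
    simp only [m]; simp; exact this
  have key : ∀ s : ℝ, 0 < s → s ≤ 1 →
      |∑' u, gcdTerm s u - (∑' e, m e) / s| ≤ (D * 4 ^ (3 / 4 : ℝ) * ∑' e, r e) * s ^ (-(3 / 4) : ℝ) := by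
    intro s hs hs1
    have hG := (hB s hs hs1).1
    let h : Z3 → ℝ := fun u => if u ≠ 0 ∧ Even (normSq u) then
      (√(normSq u))⁻¹ * rexp (-(s / 4) * (normSq u : ℝ)) else 0
    have hh0 : ∀ u, 0 ≤ h u := fun u => by simp only [h]; split_ifs <;> positivity
    let F : Z3 × ℕ → ℝ := fun x => if 0 < x.2 ∧ x.2 ∣ gcd3 x.1 then (x.2.totient : ℝ) * h x.1 else 0
    have hF0 : 0 ≤ F := fun x => by
      have := hh0 x.1
      simp only [F, Pi.zero_apply]; split_ifs <;> positivity
    have hF : Summable F := by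
      refine (summable_prod_of_nonneg hF0).2 ⟨fun u => (gcdTerm_eq s u).summable, ?_⟩
      exact hG.congr fun u => ((gcdTerm_eq s u).tsum_eq).symm
    have hFG : ∑' u, gcdTerm s u = ∑' u, ∑' e, F (u, e) :=
      tsum_congr fun u => ((gcdTerm_eq s u).tsum_eq).symm
    have hsw : ∑' u, gcdTerm s u = ∑' e, ∑' u, F (u, e) := by
      rw [hFG]; exact (hF.tsum_comm (f := fun u e => F (u, e))).symm
    have hFe : Summable fun e => ∑' u, F (u, e) := hF.prod_symm.prod
    have hterm : ∀ e, ‖(∑' u, F (u, e)) - m e / s‖ ≤ D * 4 ^ (3 / 4 : ℝ) * s ^ (-(3 / 4) : ℝ) * r e := by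
      intro e
      rcases Nat.eq_zero_or_pos e with rfl | he
      · simp [F, m, r]
      have heR : (0 : ℝ) < e := by exact_mod_cast he
      have hinj : Function.Injective fun w : Z3 => e • w := smul_right_injective Z3 he.ne'
      have e1 : ∑' u, F (u, e) = (e.totient : ℝ) * ∑' w : Z3, h (e • w) := by
        have hsub : ∑' u, F (u, e) = ∑' w : Z3, F (e • w, e) := by
          refine (hinj.tsum_eq (f := fun u => F (u, e)) ?_).symm
          intro u hu
          simp only [Function.mem_support, F] at hu
          have : 0 < e ∧ e ∣ gcd3 u := by
            by_contra hc; rw [if_neg hc] at hu; exact hu rfl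
          exact dvd_gcd3_iff_exists.1 this.2
        rw [hsub, ← tsum_mul_left]
        refine tsum_congr fun w => ?_
        simp only [F]
        rw [if_pos ⟨he, dvd_gcd3_iff_exists.2 ⟨w, rfl⟩⟩]
      have e2 : ∀ w : Z3, h (e • w) = (e : ℝ)⁻¹ * (if w ≠ 0 ∧ Even (e ^ 2 * normSq w) then
          (√(normSq w))⁻¹ * rexp (-(s * e ^ 2 / 4) * (normSq w : ℝ)) else 0) := by
        intro w
        simp only [h, normSq_nsmul]
        have : e • w ≠ 0 ↔ w ≠ 0 :=
          ⟨fun h hw => h (by rw [hw, smul_zero]), fun h h0 => h (hinj (by simpa using h0))⟩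
        simp only [this]
        split_ifs
        · push_cast
          rw [Real.sqrt_mul (by positivity), Real.sqrt_sq heR.le, mul_inv, mul_assoc]
          congr 3; ring
        · simp
      simp_rw [e1, e2, tsum_mul_left]
      have hse : 0 < s * (e : ℝ) ^ 2 / 4 := by positivity
      have hK : |(∑' w : Z3, if w ≠ 0 ∧ Even (e ^ 2 * normSq w) then
          (√(normSq w))⁻¹ * rexp (-(s * e ^ 2 / 4) * (normSq w : ℝ)) else 0) - κ e / (s * e ^ 2 / 4)| ≤
          D * (s * e ^ 2 / 4) ^ (-(3 / 4) : ℝ) := by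
        have hp : 0 ≤ (s * (e : ℝ) ^ 2 / 4) ^ (-(3 / 4) : ℝ) := by positivity
        by_cases hev : Even e
        · have h1 := (K₁ _ hse).2
          simp only [κ, if_pos hev, Nat.even_mul, Nat.even_pow, hev, ne_eq, two_ne_zero, not_false_eq_true, true_or, and_true] at h1 ⊢
          refine h1.trans ?_
          simp only [D]; gcongr; linarith
        · have h1 := (K₂ _ hse).2
          simp only [κ, if_neg hev, Nat.even_mul, Nat.even_pow, hev, false_and, false_or] at h1 ⊢
          refine h1.trans ?_
          simp only [D]; gcongr; linarith
      have hre : (s * (e : ℝ) ^ 2 / 4) ^ (-(3 / 4) : ℝ) = 4 ^ (3 / 4 : ℝ) * s ^ (-(3 / 4) : ℝ) * r e := by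
        rw [Real.div_rpow (by positivity) (by norm_num), Real.mul_rpow hs.le (by positivity),
          Real.rpow_neg (by norm_num : (0 : ℝ) ≤ 4), div_inv_eq_mul, ← Real.rpow_natCast, ← Real.rpow_mul heR.le]
        simp only [r]
        norm_num
        ring
      rw [hre] at hK
      set T := ∑' w : Z3, if w ≠ 0 ∧ Even (e ^ 2 * normSq w) then
          (√(normSq w))⁻¹ * rexp (-(s * e ^ 2 / 4) * (normSq w : ℝ)) else 0
      have e3 : (e.totient : ℝ) * ((e : ℝ)⁻¹ * T) - m e / s =
          (e.totient : ℝ) / e * (T - κ e / (s * e ^ 2 / 4)) := by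
        simp only [m]; field_simp
      rw [e3, norm_mul, Real.norm_of_nonneg (by positivity), Real.norm_eq_abs]
      calc _ ≤ 1 * (D * (4 ^ (3 / 4 : ℝ) * s ^ (-(3 / 4) : ℝ) * r e)) := by
            gcongr; exact htot e he
        _ = _ := by ring
    have := tsum_of_norm_bounded (hr.hasSum.mul_left (D * 4 ^ (3 / 4 : ℝ) * s ^ (-(3 / 4) : ℝ))) hterm
    rw [hFe.tsum_sub (hm.div_const s), tsum_div_const, ← hsw, Real.norm_eq_abs] at this
    refine this.trans (le_of_eq ?_)
    ring
  have hR : 0 ≤ ∑' e, r e := tsum_nonneg fun e => by simp only [r]; positivity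
  refine ⟨π * ∑' e, m e, C₀ + π * (D * 4 ^ (3 / 4 : ℝ) * ∑' e, r e), by positivity, by positivity,
    fun s hs hs1 => ?_⟩
  have h1 := (hB s hs hs1).2
  have h2 := key s hs hs1
  have e1 : laplaceSq s - π * (∑' e, m e) / s ^ 2 = (laplaceSq s - π / s * ∑' u, gcdTerm s u) +
      π / s * (∑' u, gcdTerm s u - (∑' e, m e) / s) := by field_simp; ring
  have e2 : C₀ / (s * √s) ≤ C₀ * s ^ (-(7 / 4) : ℝ) := by
    rw [div_eq_mul_inv]
    gcongr
    rw [Real.sqrt_eq_rpow, ← Real.rpow_one_add' hs.le (by norm_num), ← Real.rpow_neg hs.le]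
    exact Real.rpow_le_rpow_of_exponent_ge hs hs1 (by norm_num)
  have e3 : π / s * ((D * 4 ^ (3 / 4 : ℝ) * ∑' e, r e) * s ^ (-(3 / 4) : ℝ)) =
      π * (D * 4 ^ (3 / 4 : ℝ) * ∑' e, r e) * s ^ (-(7 / 4) : ℝ) := by
    have : s ^ (-(7 / 4) : ℝ) = s⁻¹ * s ^ (-(3 / 4) : ℝ) := by
      rw [← Real.rpow_neg_one, ← Real.rpow_add hs]; norm_num
    rw [this]; ring
  rw [e1]
  refine (abs_add_le _ _).trans ?_
  rw [abs_mul, abs_of_pos (by positivity : 0 < π / s)]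
  calc _ ≤ C₀ * s ^ (-(7 / 4) : ℝ) + π / s * ((D * 4 ^ (3 / 4 : ℝ) * ∑' e, r e) * s ^ (-(3 / 4) : ℝ)) := by
        gcongr
        exact h1.trans e2
    _ = _ := by rw [e3]; ring

lemma integral_exp_neg_mul_nat {n : ℕ} (hn : n ≠ 0) (s : ℝ) :
    ∫ x in s..1, rexp (-x * n) = rexp (-s * n) / n - rexp (-n) / n := by
  have hn' : (n : ℝ) ≠ 0 := Nat.cast_ne_zero.2 hn
  rw [intervalIntegral.integral_eq_sub_of_hasDerivAt (f := fun x => -(rexp (-x * n) / n))]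
  · simp only [neg_mul, one_mul]; ring
  · intro x _
    have : HasDerivAt (fun x => -(rexp (-x * n) / n)) (-(rexp (-x * n) * (-1 * n) / n)) x :=
      ((((hasDerivAt_id x).neg.mul_const (n : ℝ)).exp).div_const (n : ℝ)).neg
    refine this.congr_deriv ?_
    field_simp
  · exact (by fun_prop : Continuous fun x : ℝ => rexp (-x * n)).intervalIntegrable _ _

lemma integral_sub_mul_exp_neg_mul_nat {n : ℕ} (hn : n ≠ 0) (s : ℝ) :
    ∫ x in s..1, (x - s) * rexp (-x * n) =
      rexp (-s * n) / n ^ 2 - rexp (-n) * (1 / n ^ 2 + (1 - s) / n) := by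
  have hn' : (n : ℝ) ≠ 0 := Nat.cast_ne_zero.2 hn
  rw [intervalIntegral.integral_eq_sub_of_hasDerivAt
    (f := fun x => -(rexp (-x * n) * (1 / n ^ 2 + (x - s) / n)))]
  · simp only [neg_mul, one_mul]; ring
  · intro x _
    have h1 := ((hasDerivAt_id x).neg.mul_const (n : ℝ)).exp
    have h2 := (((hasDerivAt_id x).sub_const s).div_const (n : ℝ)).const_add (1 / (n : ℝ) ^ 2)
    have h3 : HasDerivAt (fun x => -(rexp (-x * n) * (1 / n ^ 2 + (x - s) / n)))
        (-(rexp (-x * n) * (-1 * n) * (1 / n ^ 2 + (x - s) / n) + rexp (-x * n) * (1 / n))) x :=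
      (h1.mul h2).neg
    refine h3.congr_deriv ?_
    field_simp
    ring
  · exact (by fun_prop : Continuous fun x : ℝ => (x - s) * rexp (-x * n)).intervalIntegrable _ _

/-- The mean square of the sequence `r3` away from the origin. -/
def r3Sq (n : ℕ) : ℝ := if n = 0 then 0 else (r3 n : ℝ) ^ 2

lemma r3Sq_nonneg (n : ℕ) : 0 ≤ r3Sq n := by unfold r3Sq; split_ifs <;> positivity

lemma r3Sq_zero : r3Sq 0 = 0 := by simp [r3Sq]

lemma r3_zero : r3 0 = 1 := by
  simp only [r3, normSq_eq_zero]
  exact Set.ncard_singleton (0 : Z3)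

lemma hasSum_r3Sq {s : ℝ} (hs : 0 < s) :
    HasSum (fun n : ℕ => r3Sq n * rexp (-s * n)) (laplaceSq s - 1) := by
  have h := (hasSum_laplaceSq hs).sub (hasSum_ite_eq (0 : ℕ) (1 : ℝ))
  refine (hasSum_congr fun n => ?_).2 h
  by_cases hn : n = 0
  · subst hn; simp [r3Sq, r3_zero]
  · simp [r3Sq, hn]

lemma hasSum_integral_r3Sq {s : ℝ} (hs : 0 < s) (hs1 : s ≤ 1) {g : ℝ → ℝ} (hg : Continuous g) :
    HasSum (fun n : ℕ => r3Sq n * ∫ x in s..1, g x * rexp (-x * n))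
      (∫ x in s..1, g x * (laplaceSq x - 1)) := by
  obtain ⟨G, hG⟩ := (isCompact_Icc (a := s) (b := 1)).exists_bound_of_continuousOn hg.continuousOn
  have h := intervalIntegral.hasSum_integral_of_dominated_convergence (a := s) (b := 1) (μ := volume)
    (F := fun (n : ℕ) x => r3Sq n * (g x * rexp (-x * n)))
    (f := fun x => g x * (laplaceSq x - 1)) (fun n _ => G * (r3Sq n * rexp (-s * n)))
    (fun n => (by fun_prop : Continuous fun x : ℝ =>
      r3Sq n * (g x * rexp (-x * n))).aestronglyMeasurable) ?_ ?_ ?_ ?_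
  · simpa only [intervalIntegral.integral_const_mul] using h
  · refine fun n => ae_of_all _ fun x hx => ?_
    rw [uIoc_of_le hs1] at hx
    have hG' := hG x ⟨hx.1.le, hx.2⟩
    rw [norm_mul, norm_mul, Real.norm_of_nonneg (r3Sq_nonneg n), Real.norm_of_nonneg (exp_pos _).le]
    have : rexp (-x * n) ≤ rexp (-s * n) := by gcongr; exact hx.1.le
    have h0 := r3Sq_nonneg n
    calc r3Sq n * (‖g x‖ * rexp (-x * n)) ≤ r3Sq n * (G * rexp (-s * n)) := by gcongr; exact (norm_nonneg _).trans hG'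
      _ = _ := by ring
  · exact ae_of_all _ fun x _ => (hasSum_r3Sq hs).summable.mul_left G
  · simp
  · refine ae_of_all _ fun x hx => ?_
    rw [uIoc_of_le hs1] at hx
    refine (hasSum_congr fun n => ?_).2 ((hasSum_r3Sq (hs.trans hx.1)).mul_left (g x))
    ring

lemma continuousOn_laplaceSq : ContinuousOn laplaceSq (Ioi 0) := by
  intro s hs
  have hs : 0 < s := hs
  have : ContinuousOn (fun x => ∑' n : ℕ, (r3 n : ℝ) ^ 2 * rexp (-x * n)) (Ioi (s / 2)) := by
    refine continuousOn_tsum (u := fun n : ℕ => (r3 n : ℝ) ^ 2 * rexp (-(s / 2) * n)) (fun n => by fun_prop)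
      (hasSum_laplaceSq (half_pos hs)).summable fun n x hx => ?_
    rw [Real.norm_of_nonneg (by positivity)]
    gcongr
    exact (mem_Ioi.1 hx).le
  exact (this.continuousAt (Ioi_mem_nhds (by linarith))).continuousWithinAt

lemma logSum_asymp : ∃ c C : ℝ, 0 < c ∧ 0 ≤ C ∧
    (∀ s : ℝ, 0 < s → s ≤ 1 → |∑' n : ℕ, r3Sq n / n ^ 2 * rexp (-s * n) - c * log (1 / s)| ≤ C) ∧
    (∀ s : ℝ, 0 < s → s ≤ 1 → ∑' n : ℕ, r3Sq n / n * rexp (-s * n) ≤ C / s) ∧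
    (∀ s : ℝ, 0 < s → s ≤ 1 → laplaceSq s ≤ C / s ^ 2) := by
  obtain ⟨c, D, hc, hD, hL⟩ := laplaceSq_asymp
  have hL1 : 0 ≤ laplaceSq 1 - 1 := by
    rw [← (hasSum_r3Sq one_pos).tsum_eq]
    exact tsum_nonneg fun n => mul_nonneg (r3Sq_nonneg n) (exp_pos _).le
  have hrp : ∀ x : ℝ, 0 < x → x ≤ 1 → x ^ (-(7 / 4) : ℝ) ≤ 1 / x ^ 2 := by
    intro x hx hx1
    rw [one_div, ← Real.rpow_natCast, ← Real.rpow_neg hx.le]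
    exact Real.rpow_le_rpow_of_exponent_ge hx hx1 (by norm_num)
  have hLup : ∀ x : ℝ, 0 < x → x ≤ 1 → laplaceSq x ≤ (c + D) / x ^ 2 := by
    intro x hx hx1
    have h1 := (abs_le.1 (hL x hx hx1)).2
    have h2 := mul_le_mul_of_nonneg_left (hrp x hx hx1) hD
    have : (c + D) / x ^ 2 = c / x ^ 2 + D * (1 / x ^ 2) := by ring
    linarith
  have hLpos : ∀ x : ℝ, 0 < x → 1 ≤ laplaceSq x := by
    intro x hx
    have : 0 ≤ laplaceSq x - 1 := by
      rw [← (hasSum_r3Sq hx).tsum_eq]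
      exact tsum_nonneg fun n => mul_nonneg (r3Sq_nonneg n) (exp_pos _).le
    linarith
  have hcont : ∀ {s : ℝ}, 0 < s → s ≤ 1 → ContinuousOn laplaceSq (uIcc s 1) := by
    intro s hs hs1
    rw [uIcc_of_le hs1]
    exact continuousOn_laplaceSq.mono fun x hx => hs.trans_le hx.1
  have hinv : ∀ {s : ℝ}, 0 < s → s ≤ 1 → ∀ a : ℝ, IntervalIntegrable (fun x => a / x ^ 2) volume s 1 := by
    intro s hs hs1 a
    refine ContinuousOn.intervalIntegrable ?_
    rw [uIcc_of_le hs1]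
    refine fun x hx => ContinuousAt.continuousWithinAt ?_
    have hx0 : x ^ 2 ≠ 0 := (pow_pos (hs.trans_le hx.1) 2).ne'
    fun_prop (disch := assumption)
  refine ⟨c, c + (4 * D + 1) + 2 * (laplaceSq 1 - 1) + (c + D) , hc, by positivity, ?_, ?_, ?_⟩
  · intro s hs hs1
    have h := hasSum_integral_r3Sq hs hs1 (g := fun x => x - s) (by fun_prop)
    have hnn : ∀ n : ℕ, 0 ≤ r3Sq n * (rexp (-n) * (1 / n ^ 2 + (1 - s) / n)) := fun n => by
      have := r3Sq_nonneg n
      have : 0 ≤ 1 - s := by linarith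
      positivity
    have hle : ∀ n : ℕ, r3Sq n * (rexp (-n) * (1 / n ^ 2 + (1 - s) / n)) ≤ 2 * (r3Sq n * rexp (-1 * n)) := by
      intro n
      rcases Nat.eq_zero_or_pos n with rfl | hn
      · simp [r3Sq_zero]
      · have hn1 : (1 : ℝ) ≤ n := by exact_mod_cast hn
        have h1 : 1 / (n : ℝ) ^ 2 ≤ 1 := div_le_one_of_le₀ (one_le_pow₀ hn1) (by positivity)
        have h2 : (1 - s) / (n : ℝ) ≤ 1 := div_le_one_of_le₀ (by linarith) (by positivity)
        rw [neg_one_mul, mul_left_comm 2, mul_comm 2]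
        have := r3Sq_nonneg n
        gcongr
        linarith
    have hrem : Summable fun n : ℕ => r3Sq n * (rexp (-n) * (1 / n ^ 2 + (1 - s) / n)) := by
      exact Summable.of_nonneg_of_le hnn hle ((hasSum_r3Sq one_pos).summable.mul_left 2)
    have hremle : |∑' n : ℕ, r3Sq n * (rexp (-n) * (1 / n ^ 2 + (1 - s) / n))| ≤ 2 * (laplaceSq 1 - 1) := by
      rw [abs_of_nonneg (tsum_nonneg hnn), ← ((hasSum_r3Sq one_pos).mul_left 2).tsum_eq]
      exact hrem.tsum_le_tsum hle ((hasSum_r3Sq one_pos).summable.mul_left 2)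
    have hJ : ∑' n : ℕ, r3Sq n / n ^ 2 * rexp (-s * n) = (∫ x in s..1, (x - s) * (laplaceSq x - 1)) +
        ∑' n : ℕ, r3Sq n * (rexp (-n) * (1 / n ^ 2 + (1 - s) / n)) := by
      refine ((hasSum_congr fun n => ?_).2 (h.add hrem.hasSum)).tsum_eq
      by_cases hn : n = 0
      · simp [hn, r3Sq_zero]
      · rw [integral_sub_mul_exp_neg_mul_nat hn]; ring
    have hmain : ∫ x in s..1, (x - s) * (c / x ^ 2) = c * log (1 / s) - c * (1 - s) := by
      rw [intervalIntegral.integral_eq_sub_of_hasDerivAt (f := fun x => c * (log x + s / x))]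
      · rw [log_one, one_div, log_inv]; field_simp; ring
      · intro x hx
        rw [uIcc_of_le hs1] at hx
        have hx0 : x ≠ 0 := (hs.trans_le hx.1).ne'
        have h1 := ((Real.hasDerivAt_log hx0).fun_add ((hasDerivAt_inv hx0).const_mul s)).const_mul c
        have h2 : HasDerivAt (fun x => c * (log x + s / x)) (c * (x⁻¹ + s * -(x ^ 2)⁻¹)) x := by
          simpa only [div_eq_mul_inv] using h1
        refine h2.congr_deriv ?_
        field_simp
        ring
      · refine ContinuousOn.intervalIntegrable ?_
        rw [uIcc_of_le hs1]
        refine fun x hx => ContinuousAt.continuousWithinAt ?_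
        have hx0 : x ^ 2 ≠ 0 := (pow_pos (hs.trans_le hx.1) 2).ne'
        fun_prop (disch := assumption)
    have hdiff : |(∫ x in s..1, (x - s) * (laplaceSq x - 1)) - ∫ x in s..1, (x - s) * (c / x ^ 2)| ≤ 4 * D + 1 := by
      have hi1 : IntervalIntegrable (fun x => (x - s) * (laplaceSq x - 1)) volume s 1 :=
        (ContinuousOn.mul (by fun_prop) ((hcont hs hs1).sub continuousOn_const)).intervalIntegrable
      have hi2 : IntervalIntegrable (fun x => (x - s) * (c / x ^ 2)) volume s 1 :=
        (hinv hs hs1 c).continuousOn_mul (by fun_prop)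
      have hi3 : IntervalIntegrable (fun x : ℝ => D * x ^ (-(3 / 4) : ℝ) + 1) volume s 1 :=
        ((intervalIntegral.intervalIntegrable_rpow' (by norm_num)).const_mul D).add intervalIntegrable_const
      rw [← intervalIntegral.integral_sub hi1 hi2, ← Real.norm_eq_abs]
      refine (intervalIntegral.norm_integral_le_of_norm_le hs1 ?_ hi3).trans ?_
      · refine ae_of_all _ fun x hx => ?_
        have hx0 : 0 < x := hs.trans hx.1
        rw [← mul_sub, norm_mul, Real.norm_of_nonneg (sub_nonneg.2 hx.1.le), Real.norm_eq_abs]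
        have h1 : |laplaceSq x - 1 - c / x ^ 2| ≤ D * x ^ (-(7 / 4) : ℝ) + 1 := by
          have := abs_le.1 (hL x hx0 hx.2)
          rw [abs_le]; constructor <;> linarith [this.1, this.2]
        calc (x - s) * |laplaceSq x - 1 - c / x ^ 2| ≤ x * (D * x ^ (-(7 / 4) : ℝ) + 1) := by
              gcongr; linarith
          _ = D * (x ^ (1 : ℝ) * x ^ (-(7 / 4) : ℝ)) + x := by rw [Real.rpow_one]; ring
          _ ≤ D * x ^ (-(3 / 4) : ℝ) + 1 := by
              rw [← Real.rpow_add hx0]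
              norm_num
              linarith [hx.2]
      · rw [intervalIntegral.integral_add ((intervalIntegral.intervalIntegrable_rpow' (by norm_num)).const_mul D)
          intervalIntegrable_const, intervalIntegral.integral_const_mul, integral_rpow (Or.inl (by norm_num))]
        have : 0 ≤ s ^ (-(3 / 4) + 1 : ℝ) := by positivity
        simp only [intervalIntegral.integral_const, Real.one_rpow, smul_eq_mul, mul_one]
        have h4 : (1 - s ^ (-(3 / 4) + 1 : ℝ)) / (-(3 / 4) + 1 : ℝ) ≤ 4 := by
          rw [div_le_iff₀ (by norm_num)]; linarith
        have := mul_le_mul_of_nonneg_left h4 hD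
        linarith
    rw [hJ]
    rw [hmain] at hdiff
    rw [abs_le] at *
    have : 0 ≤ c * (1 - s) := mul_nonneg hc.le (by linarith)
    have : c * (1 - s) ≤ c := by nlinarith
    constructor <;> linarith [hdiff.1, hdiff.2, hremle.1, hremle.2]
  · intro s hs hs1
    have h := hasSum_integral_r3Sq hs hs1 (g := fun x => 1) (by fun_prop)
    simp only [one_mul] at h
    have hle : ∀ n : ℕ, r3Sq n / n * rexp (-n) ≤ r3Sq n * rexp (-1 * n) := by
      intro n
      rw [neg_one_mul]
      gcongr
      rcases Nat.eq_zero_or_pos n with rfl | hn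
      · simp [r3Sq_zero]
      · exact div_le_self (r3Sq_nonneg n) (by exact_mod_cast hn)
    have hrem : Summable fun n : ℕ => r3Sq n / n * rexp (-n) :=
      Summable.of_nonneg_of_le (fun n => by have := r3Sq_nonneg n; positivity) hle
        (hasSum_r3Sq one_pos).summable
    have hremle : ∑' n : ℕ, r3Sq n / n * rexp (-n) ≤ laplaceSq 1 - 1 := by
      rw [← (hasSum_r3Sq one_pos).tsum_eq]
      exact hrem.tsum_le_tsum hle (hasSum_r3Sq one_pos).summable
    have hJ : ∑' n : ℕ, r3Sq n / n * rexp (-s * n) = (∫ x in s..1, (laplaceSq x - 1)) +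
        ∑' n : ℕ, r3Sq n / n * rexp (-n) := by
      refine ((hasSum_congr fun n => ?_).2 (h.add hrem.hasSum)).tsum_eq
      by_cases hn : n = 0
      · simp [hn, r3Sq_zero]
      · rw [integral_exp_neg_mul_nat hn]; ring
    have hint : ∫ x in s..1, (laplaceSq x - 1) ≤ (c + D) / s := by
      calc ∫ x in s..1, (laplaceSq x - 1) ≤ ∫ x in s..1, (c + D) / x ^ 2 := by
            refine intervalIntegral.integral_mono_on hs1 ((hcont hs hs1).sub continuousOn_const).intervalIntegrable
              (hinv hs hs1 _) fun x hx => ?_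
            linarith [hLup x (hs.trans_le hx.1) hx.2]
        _ = (c + D) / s - (c + D) := by
            rw [intervalIntegral.integral_eq_sub_of_hasDerivAt (f := fun x => -(c + D) * x⁻¹) _ (hinv hs hs1 _)]
            · rw [inv_one]; ring
            · intro x hx
              rw [uIcc_of_le hs1] at hx
              have hx0 : x ≠ 0 := (hs.trans_le hx.1).ne'
              refine ((hasDerivAt_inv hx0).const_mul (-(c + D))).congr_deriv ?_
              field_simp
        _ ≤ _ := by linarith
    have hs' : laplaceSq 1 - 1 ≤ (laplaceSq 1 - 1) / s := (le_div_iff₀ hs).2 (by nlinarith)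
    have hfin : 0 ≤ (c + (4 * D + 1) + (laplaceSq 1 - 1)) / s := by positivity
    rw [hJ]
    calc _ ≤ (c + D) / s + (laplaceSq 1 - 1) / s + (c + (4 * D + 1) + (laplaceSq 1 - 1)) / s := by linarith
      _ = _ := by ring
  · intro s hs hs1
    refine (hLup s hs hs1).trans ?_
    refine div_le_div_of_nonneg_right ?_ (by positivity)
    linarith

lemma abs_integral_pow_mul_sin_le (k : ℕ) {a b ξ : ℝ} (ha : 0 ≤ a) (hab : a ≤ b) (hξ : 0 < ξ) :
    |∫ t in a..b, t ^ k * sin (ξ * t)| ≤ 2 * b ^ k / ξ := by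
  have hd : ∀ t : ℝ, HasDerivAt (fun t => -(cos (ξ * t) / ξ)) (sin (ξ * t)) t := by
    intro t
    have : HasDerivAt (fun t => -(cos (ξ * t) / ξ)) (-(-sin (ξ * t) * (ξ * 1) / ξ)) t :=
      ((((hasDerivAt_id t).const_mul ξ).cos).div_const ξ).neg
    refine this.congr_deriv ?_
    field_simp
  have hp : ∀ t : ℝ, HasDerivAt (fun t : ℝ => t ^ k) (k * t ^ (k - 1)) t := fun t => hasDerivAt_pow k t
  have hc' : ∀ t : ℝ, |cos (ξ * t) / ξ| ≤ 1 / ξ := by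
    intro t
    rw [abs_div, abs_of_pos hξ]
    exact div_le_div_of_nonneg_right (abs_cos_le_one _) hξ.le
  have hI : |∫ t in a..b, (k * t ^ (k - 1)) * -(cos (ξ * t) / ξ)| ≤ (b ^ k - a ^ k) * (1 / ξ) := by
    rw [← intervalIntegral.integral_eq_sub_of_hasDerivAt (fun t _ => hp t)
      ((by fun_prop : Continuous fun t : ℝ => k * t ^ (k - 1)).intervalIntegrable _ _),
      ← intervalIntegral.integral_mul_const, ← Real.norm_eq_abs]
    refine intervalIntegral.norm_integral_le_of_norm_le hab ?_
      ((by fun_prop : Continuous fun t : ℝ => k * t ^ (k - 1) * (1 / ξ)).intervalIntegrable _ _)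
    refine ae_of_all _ fun t ht => ?_
    have ht0 : 0 ≤ t := ha.trans ht.1.le
    rw [norm_mul, norm_neg, Real.norm_of_nonneg (by positivity), Real.norm_eq_abs]
    gcongr
    exact hc' t
  rw [intervalIntegral.integral_mul_deriv_eq_deriv_mul (fun t _ => hp t) (fun t _ => hd t)
    ((by fun_prop : Continuous fun t : ℝ => k * t ^ (k - 1)).intervalIntegrable _ _)
    ((by fun_prop : Continuous fun t : ℝ => sin (ξ * t)).intervalIntegrable _ _)]
  have h1 : |b ^ k * -(cos (ξ * b) / ξ)| ≤ b ^ k * (1 / ξ) := by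
    rw [abs_mul, abs_neg, abs_of_nonneg (pow_nonneg (ha.trans hab) _)]
    exact mul_le_mul_of_nonneg_left (hc' b) (pow_nonneg (ha.trans hab) _)
  have h2 : |a ^ k * -(cos (ξ * a) / ξ)| ≤ a ^ k * (1 / ξ) := by
    rw [abs_mul, abs_neg, abs_of_nonneg (pow_nonneg ha _)]
    exact mul_le_mul_of_nonneg_left (hc' a) (pow_nonneg ha _)
  have : 2 * b ^ k / ξ = b ^ k * (1 / ξ) + a ^ k * (1 / ξ) + (b ^ k - a ^ k) * (1 / ξ) := by ring
  rw [this]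
  exact (abs_sub _ _).trans (add_le_add ((abs_sub _ _).trans (add_le_add h1 h2)) hI)

/-- The cosine moment whose average over the endpoint is small. -/
def cosMoment (ξ R : ℝ) : ℝ := ∫ t in 0..R, t ^ 3 * cos (ξ * t)

lemma continuous_cosMoment (ξ : ℝ) : Continuous (cosMoment ξ) :=
  intervalIntegral.continuous_primitive
    (fun a b => (by fun_prop : Continuous fun t : ℝ => t ^ 3 * cos (ξ * t)).intervalIntegrable a b) 0

lemma cosMoment_zero (R : ℝ) : cosMoment 0 R = R ^ 4 / 4 := by
  simp [cosMoment]; norm_num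

lemma cosMoment_neg (ξ R : ℝ) : cosMoment (-ξ) R = cosMoment ξ R := by
  simp [cosMoment]

lemma cosMoment_eq {ξ : ℝ} (hξ : ξ ≠ 0) (R : ℝ) :
    cosMoment ξ R = R ^ 3 * sin (ξ * R) / ξ - 3 / ξ * ∫ t in 0..R, t ^ 2 * sin (ξ * t) := by
  have hd : ∀ t : ℝ, HasDerivAt (fun t => sin (ξ * t) / ξ) (cos (ξ * t)) t := by
    intro t
    have : HasDerivAt (fun t => sin (ξ * t) / ξ) (cos (ξ * t) * (ξ * 1) / ξ) t :=
      (((hasDerivAt_id t).const_mul ξ).sin).div_const ξ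
    refine this.congr_deriv ?_
    field_simp
  have hp : ∀ t : ℝ, HasDerivAt (fun t : ℝ => t ^ 3) (3 * t ^ 2) t := fun t => by
    simpa using hasDerivAt_pow 3 t
  rw [cosMoment, intervalIntegral.integral_mul_deriv_eq_deriv_mul (fun t _ => hp t) (fun t _ => hd t)
    ((by fun_prop : Continuous fun t : ℝ => 3 * t ^ 2).intervalIntegrable _ _)
    ((by fun_prop : Continuous fun t : ℝ => cos (ξ * t)).intervalIntegrable _ _),
    ← intervalIntegral.integral_const_mul]
  congr 1
  · simp [mul_div_assoc]
  · refine intervalIntegral.integral_congr fun t _ => ?_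
    ring

lemma abs_integral_cosMoment_le {R₁ R₂ ξ : ℝ} (h0 : 0 ≤ R₁) (h : R₁ ≤ R₂) (hξ : ξ ≠ 0) :
    |∫ R in R₁..R₂, cosMoment ξ R| ≤ 8 * R₂ ^ 3 / ξ ^ 2 := by
  wlog hpos : 0 < ξ generalizing ξ
  · have := this (ξ := -ξ) (neg_ne_zero.2 hξ) (by
      have := lt_of_le_of_ne (not_lt.1 hpos) hξ; linarith)
    simpa [cosMoment_neg] using this
  have hcs : Continuous fun R : ℝ => ∫ t in 0..R, t ^ 2 * sin (ξ * t) :=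
    intervalIntegral.continuous_primitive
      (fun a b => (by fun_prop : Continuous fun t : ℝ => t ^ 2 * sin (ξ * t)).intervalIntegrable a b) 0
  simp_rw [cosMoment_eq hξ]
  rw [intervalIntegral.integral_sub
    ((by fun_prop : Continuous fun R : ℝ => R ^ 3 * sin (ξ * R) / ξ).intervalIntegrable _ _)
    ((hcs.const_mul _).intervalIntegrable _ _), intervalIntegral.integral_div,
    intervalIntegral.integral_const_mul]
  have h1 := abs_integral_pow_mul_sin_le 3 h0 h hpos
  have h2 : |∫ R in R₁..R₂, ∫ t in 0..R, t ^ 2 * sin (ξ * t)| ≤ 2 * R₂ ^ 2 / ξ * |R₂ - R₁| := by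
    rw [← Real.norm_eq_abs]
    refine intervalIntegral.norm_integral_le_of_norm_le_const fun R hR => ?_
    rw [uIoc_of_le h] at hR
    have hR0 : 0 ≤ R := h0.trans hR.1.le
    refine (abs_integral_pow_mul_sin_le 2 le_rfl hR0 hpos).trans ?_
    gcongr
    exact hR.2
  rw [abs_of_nonneg (sub_nonneg.2 h)] at h2
  have hR2 : 0 ≤ R₂ := h0.trans h
  calc _ ≤ |(∫ R in R₁..R₂, R ^ 3 * sin (ξ * R)) / ξ| +
        |3 / ξ * ∫ R in R₁..R₂, ∫ t in 0..R, t ^ 2 * sin (ξ * t)| := abs_sub _ _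
    _ ≤ (2 * R₂ ^ 3 / ξ) / ξ + 3 / ξ * (2 * R₂ ^ 2 / ξ * R₂) := by
        rw [abs_div, abs_mul, abs_of_pos hpos, abs_of_pos (by positivity : 0 < 3 / ξ)]
        gcongr
        refine h2.trans ?_
        gcongr; linarith
    _ = _ := by field_simp; ring

lemma inv_sqrt_sub_sq_le {x y : ℝ} (hx : 1 ≤ x) (hxy : x ^ 2 + 1 ≤ y ^ 2) (hy : 0 ≤ y) :
    1 / (x - y) ^ 2 + 1 / (x + y) ^ 2 ≤ 12 * (x * y) * (y ^ 2 - x ^ 2) ^ (-(3 / 2) : ℝ) := by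
  have hxy' : x < y := by nlinarith
  have hD : 1 ≤ y ^ 2 - x ^ 2 := by linarith
  have hD0 : 0 < y ^ 2 - x ^ 2 := by linarith
  have e : (y ^ 2 - x ^ 2) ^ (-(3 / 2) : ℝ) = √(y ^ 2 - x ^ 2) / (y ^ 2 - x ^ 2) ^ 2 := by
    generalize y ^ 2 - x ^ 2 = D at hD0
    rw [Real.sqrt_eq_rpow, ← Real.rpow_natCast, ← Real.rpow_sub hD0]; norm_num
  have h1 : 1 / (x + y) ^ 2 ≤ 1 / (x - y) ^ 2 := by
    apply one_div_le_one_div_of_le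
    · nlinarith
    · nlinarith
  have h2 : (x + y) ^ 2 ≤ 6 * (x * y) * √(y ^ 2 - x ^ 2) := by
    have h3 : 2 * y ≤ 3 * x * √(y ^ 2 - x ^ 2) := by
      refine (sq_le_sq₀ (by positivity) (by positivity)).1 ?_
      · rw [mul_pow (3 * x), Real.sq_sqrt hD0.le]
        have : 0 ≤ (x ^ 2 - 1) * (y ^ 2 - x ^ 2 - 1) := mul_nonneg (by nlinarith) (by linarith)
        nlinarith
    have := mul_le_mul_of_nonneg_left h3 hy
    nlinarith
  have h4 : 1 / (x - y) ^ 2 ≤ 6 * (x * y) * (y ^ 2 - x ^ 2) ^ (-(3 / 2) : ℝ) := by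
    have : (y ^ 2 - x ^ 2) ^ 2 = (x - y) ^ 2 * (x + y) ^ 2 := by ring
    rw [e, this, ← mul_div_assoc, div_le_div_iff₀ (by nlinarith) (by nlinarith)]
    nlinarith [sq_nonneg (x - y)]
  linarith

lemma pair_kernel_le {a : ℕ → ℝ} (ha : ∀ n, 0 ≤ a n) (ha0 : a 0 = 0) (m n : ℕ) :
    a m * a n * (1 / (√m - √n) ^ 2 + 1 / (√m + √n) ^ 2) ≤
      (m * a m ^ 2 + n * a n ^ 2) / 2 *
        (12 * |(((n : ℤ) - m : ℤ) : ℝ)| ^ (-(3 / 2) : ℝ) + if (n : ℤ) - m = 0 then 1 else 0) := by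
  rcases Nat.eq_zero_or_pos m with rfl | hm
  · simp only [ha0, zero_mul]
    have := ha n
    have : (0 : ℝ) ≤ if (n : ℤ) - (0 : ℕ) = 0 then 1 else 0 := by split_ifs <;> norm_num
    positivity
  rcases Nat.eq_zero_or_pos n with rfl | hn
  · simp only [ha0, zero_mul, mul_zero]
    have := ha m
    have : (0 : ℝ) ≤ if ((0 : ℕ) : ℤ) - m = 0 then 1 else 0 := by split_ifs <;> norm_num
    positivity
  have hm1 : (1 : ℝ) ≤ m := by exact_mod_cast hm
  have hn1 : (1 : ℝ) ≤ n := by exact_mod_cast hn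
  have hk : a m * a n * (√m * √n) ≤ (m * a m ^ 2 + n * a n ^ 2) / 2 := by
    have := two_mul_le_add_sq (√m * a m) (√n * a n)
    rw [mul_pow, mul_pow, Real.sq_sqrt (by positivity), Real.sq_sqrt (by positivity)] at this
    linarith
  have h00 := mul_nonneg (ha m) (ha n)
  have main : ∀ p q : ℕ, 1 ≤ p → p < q → 1 / (√p - √q) ^ 2 + 1 / (√p + √q) ^ 2 ≤
      √p * √q * (12 * ((q : ℝ) - p) ^ (-(3 / 2) : ℝ)) := by
    intro p q hp hpq
    have h := inv_sqrt_sub_sq_le (x := √p) (y := √q) (Real.one_le_sqrt.2 (by exact_mod_cast hp)) (by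
      rw [Real.sq_sqrt (by positivity), Real.sq_sqrt (by positivity)]; exact_mod_cast hpq) (by positivity)
    rw [Real.sq_sqrt (by positivity), Real.sq_sqrt (by positivity)] at h
    linarith
  rcases lt_trichotomy m n with h | h | h
  · have hne : (n : ℤ) - m ≠ 0 := by omega
    have hlt : (m : ℝ) < n := by exact_mod_cast h
    rw [if_neg hne, add_zero, Int.cast_sub, Int.cast_natCast, Int.cast_natCast, abs_of_pos (by linarith)]
    calc _ ≤ a m * a n * (√m * √n * (12 * ((n : ℝ) - m) ^ (-(3 / 2) : ℝ))) :=
          mul_le_mul_of_nonneg_left (main m n hm h) h00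
      _ = a m * a n * (√m * √n) * (12 * ((n : ℝ) - m) ^ (-(3 / 2) : ℝ)) := by ring
      _ ≤ _ := mul_le_mul_of_nonneg_right hk
          (mul_nonneg (by norm_num) (Real.rpow_nonneg (by linarith) _))
  · subst h
    have hs := Real.sq_sqrt (Nat.cast_nonneg (α := ℝ) m)
    have hz : (0 : ℝ) ^ (-(3 / 2) : ℝ) = 0 := Real.zero_rpow (by norm_num)
    simp only [sub_self, Int.cast_zero, abs_zero, hz, mul_zero, if_true, zero_add, mul_one, ne_eq,
      OfNat.ofNat_ne_zero, not_false_eq_true, zero_pow, div_zero]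
    rw [← two_mul, mul_pow, hs, add_self_div_two, ← sq, mul_comm]
    refine mul_le_mul_of_nonneg_right ?_ (sq_nonneg _)
    rw [div_le_iff₀ (by positivity)]
    nlinarith
  · have hne : (n : ℤ) - m ≠ 0 := by omega
    have hlt : (n : ℝ) < m := by exact_mod_cast h
    rw [if_neg hne, add_zero, Int.cast_sub, Int.cast_natCast, Int.cast_natCast, abs_sub_comm,
      abs_of_pos (by linarith)]
    have := main n m hn h
    rw [← neg_sub (√n), neg_sq, add_comm (√m)]
    calc _ ≤ a m * a n * (√n * √m * (12 * ((m : ℝ) - n) ^ (-(3 / 2) : ℝ))) :=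
          mul_le_mul_of_nonneg_left this h00
      _ = a m * a n * (√m * √n) * (12 * ((m : ℝ) - n) ^ (-(3 / 2) : ℝ)) := by ring
      _ ≤ _ := mul_le_mul_of_nonneg_right hk
          (mul_nonneg (by norm_num) (Real.rpow_nonneg (by linarith) _))

lemma schur_sqrt : ∃ K : ℝ, 0 ≤ K ∧ ∀ a : ℕ → ℝ, (∀ n, 0 ≤ a n) → a 0 = 0 → ∀ N : ℕ,
    ∑ m ∈ Finset.range N, ∑ n ∈ Finset.range N,
      a m * a n * (1 / (√m - √n) ^ 2 + 1 / (√m + √n) ^ 2) ≤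
      K * ∑ n ∈ Finset.range N, n * a n ^ 2 := by
  let k : ℤ → ℝ := fun d => 12 * |(d : ℝ)| ^ (-(3 / 2) : ℝ) + if d = 0 then 1 else 0
  have hk : Summable k :=
    ((Real.summable_abs_int_rpow (by norm_num : (1 : ℝ) < 3 / 2)).mul_left 12).add
      (hasSum_ite_eq (0 : ℤ) (1 : ℝ)).summable
  have hk0 : ∀ d, 0 ≤ k d := by
    intro d
    simp only [k]
    split_ifs <;> positivity
  have hksymm : ∀ d, k (-d) = k d := by
    intro d; simp [k]
  have hrow : ∀ (m N : ℕ), ∑ n ∈ Finset.range N, k ((n : ℤ) - m) ≤ ∑' d, k d := by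
    intro m N
    have hinj : Function.Injective fun n : ℕ => (n : ℤ) - m := fun x y h => by
      simp only at h; omega
    refine (Finset.sum_map (Finset.range N) ⟨_, hinj⟩ k).symm.trans_le ?_
    exact hk.sum_le_tsum _ fun d _ => hk0 d
  refine ⟨∑' d, k d, tsum_nonneg hk0, fun a ha ha0 N => ?_⟩
  have hB : ∀ n : ℕ, 0 ≤ (n : ℝ) * a n ^ 2 := fun n => by positivity
  have hone : ∑ m ∈ Finset.range N, ∑ n ∈ Finset.range N, (m : ℝ) * a m ^ 2 * k ((n : ℤ) - m) ≤
      (∑' d, k d) * ∑ n ∈ Finset.range N, n * a n ^ 2 := by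
    rw [Finset.mul_sum]
    refine Finset.sum_le_sum fun m _ => ?_
    rw [← Finset.mul_sum, mul_comm (∑' d, k d)]
    exact mul_le_mul_of_nonneg_left (hrow m N) (hB m)
  have htwo : ∑ m ∈ Finset.range N, ∑ n ∈ Finset.range N, (n : ℝ) * a n ^ 2 * k ((n : ℤ) - m) ≤
      (∑' d, k d) * ∑ n ∈ Finset.range N, n * a n ^ 2 := by
    rw [Finset.sum_comm]
    refine le_trans (le_of_eq ?_) hone
    refine Finset.sum_congr rfl fun m _ => Finset.sum_congr rfl fun n _ => ?_
    rw [← hksymm, neg_sub]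
  calc _ ≤ ∑ m ∈ Finset.range N, ∑ n ∈ Finset.range N,
        (m * a m ^ 2 + n * a n ^ 2) / 2 * k ((n : ℤ) - m) :=
        Finset.sum_le_sum fun m _ => Finset.sum_le_sum fun n _ => pair_kernel_le ha ha0 m n
    _ = (∑ m ∈ Finset.range N, ∑ n ∈ Finset.range N, (m : ℝ) * a m ^ 2 * k ((n : ℤ) - m) +
        ∑ m ∈ Finset.range N, ∑ n ∈ Finset.range N, (n : ℝ) * a n ^ 2 * k ((n : ℤ) - m)) / 2 := by
        rw [← Finset.sum_add_distrib, Finset.sum_div]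
        refine Finset.sum_congr rfl fun m _ => ?_
        rw [← Finset.sum_add_distrib, Finset.sum_div]
        exact Finset.sum_congr rfl fun n _ => by ring
    _ ≤ _ := by linarith

/-- A finite piece of the cosine series approximating the lattice discrepancy. -/
def cosSum (a : ℕ → ℝ) (N : ℕ) (t : ℝ) : ℝ := ∑ n ∈ Finset.range N, a n * cos (2 * π * √n * t)

lemma continuous_cosSum (a : ℕ → ℝ) (N : ℕ) : Continuous (cosSum a N) := by
  unfold cosSum; fun_prop

lemma integral_cosSum_sq (a : ℕ → ℝ) (N : ℕ) (R : ℝ) :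
    ∫ t in 0..R, t ^ 3 * cosSum a N t ^ 2 = ∑ m ∈ Finset.range N, ∑ n ∈ Finset.range N,
      a m * a n / 2 * (cosMoment (2 * π * (√m - √n)) R + cosMoment (2 * π * (√m + √n)) R) := by
  have e : ∀ t : ℝ, t ^ 3 * cosSum a N t ^ 2 = ∑ m ∈ Finset.range N, ∑ n ∈ Finset.range N,
      a m * a n / 2 * (t ^ 3 * cos (2 * π * (√m - √n) * t) + t ^ 3 * cos (2 * π * (√m + √n) * t)) := by
    intro t
    rw [cosSum, sq, Finset.sum_mul_sum, Finset.mul_sum]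
    refine Finset.sum_congr rfl fun m _ => ?_
    rw [Finset.mul_sum]
    refine Finset.sum_congr rfl fun n _ => ?_
    rw [show 2 * π * (√m - √n) * t = 2 * π * √m * t - 2 * π * √n * t by ring,
      show 2 * π * (√m + √n) * t = 2 * π * √m * t + 2 * π * √n * t by ring, cos_sub, cos_add]
    ring
  simp_rw [e]
  rw [intervalIntegral.integral_finsetSum fun m _ => (by fun_prop : Continuous _).intervalIntegrable _ _]
  refine Finset.sum_congr rfl fun m _ => ?_
  rw [intervalIntegral.integral_finsetSum fun n _ => (by fun_prop : Continuous _).intervalIntegrable _ _]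
  refine Finset.sum_congr rfl fun n _ => ?_
  rw [intervalIntegral.integral_const_mul, intervalIntegral.integral_add
    ((by fun_prop : Continuous _).intervalIntegrable _ _)
    ((by fun_prop : Continuous _).intervalIntegrable _ _)]
  rfl

lemma average_cosSum_sq : ∃ K : ℝ, 0 ≤ K ∧ ∀ a : ℕ → ℝ, (∀ n, 0 ≤ a n) → a 0 = 0 → ∀ (N : ℕ) (R₁ R₂ : ℝ),
    0 ≤ R₁ → R₁ ≤ R₂ →
    |(∫ R in R₁..R₂, ∫ t in 0..R, t ^ 3 * cosSum a N t ^ 2) -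
      (∑ n ∈ Finset.range N, a n ^ 2) * ∫ R in R₁..R₂, R ^ 4 / 8| ≤
      K * R₂ ^ 3 * ∑ n ∈ Finset.range N, n * a n ^ 2 := by
  obtain ⟨K, hK, h⟩ := schur_sqrt
  refine ⟨K, hK, fun a ha ha0 N R₁ R₂ h0 h12 => ?_⟩
  have hR2 : 0 ≤ R₂ := h0.trans h12
  let G : ℝ → ℝ := fun ξ => ∫ R in R₁..R₂, cosMoment ξ R
  have hi : ∀ ξ, IntervalIntegrable (cosMoment ξ) volume R₁ R₂ := fun ξ =>
    (continuous_cosMoment ξ).intervalIntegrable _ _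
  have hG0 : G 0 = 2 * ∫ R in R₁..R₂, R ^ 4 / 8 := by
    simp only [G, cosMoment_zero]
    rw [← intervalIntegral.integral_const_mul]
    exact intervalIntegral.integral_congr fun t _ => by ring
  have e1 : ∫ R in R₁..R₂, ∫ t in 0..R, t ^ 3 * cosSum a N t ^ 2 =
      ∑ m ∈ Finset.range N, ∑ n ∈ Finset.range N,
        a m * a n / 2 * (G (2 * π * (√m - √n)) + G (2 * π * (√m + √n))) := by
    simp_rw [integral_cosSum_sq]
    have hc : ∀ m n : ℕ, Continuous fun R => a m * a n / 2 *
        (cosMoment (2 * π * (√m - √n)) R + cosMoment (2 * π * (√m + √n)) R) := fun m n =>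
      ((continuous_cosMoment _).add (continuous_cosMoment _)).const_mul _
    rw [intervalIntegral.integral_finsetSum fun m _ =>
      (continuous_finsetSum _ fun n _ => hc m n).intervalIntegrable _ _]
    refine Finset.sum_congr rfl fun m _ => ?_
    rw [intervalIntegral.integral_finsetSum fun n _ => (hc m n).intervalIntegrable _ _]
    refine Finset.sum_congr rfl fun n _ => ?_
    rw [intervalIntegral.integral_const_mul, intervalIntegral.integral_add (hi _) (hi _)]
  have e2 : (∑ n ∈ Finset.range N, a n ^ 2) * ∫ R in R₁..R₂, R ^ 4 / 8 =
      ∑ m ∈ Finset.range N, ∑ n ∈ Finset.range N, a m * a n / 2 * (if m = n then G 0 else 0) := by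
    rw [Finset.sum_mul]
    refine Finset.sum_congr rfl fun m hm => ?_
    simp only [mul_ite, mul_zero]
    rw [Finset.sum_ite_eq, if_pos hm, hG0]
    ring
  rw [e1, e2, ← Finset.sum_sub_distrib]
  have hpair : ∀ m n : ℕ, |a m * a n / 2 * (G (2 * π * (√m - √n)) + G (2 * π * (√m + √n))) -
      a m * a n / 2 * (if m = n then G 0 else 0)| ≤
      R₂ ^ 3 * (a m * a n * (1 / (√m - √n) ^ 2 + 1 / (√m + √n) ^ 2)) := by
    intro m n
    have h00 := mul_nonneg (ha m) (ha n)
    by_cases hmn : m = 0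
    · simp [hmn, ha0]
    have hbd : ∀ x : ℝ, x ≠ 0 → |G (2 * π * x)| ≤ 2 * R₂ ^ 3 * (1 / x ^ 2) := by
      intro x hx
      refine (abs_integral_cosMoment_le h0 h12 (by positivity)).trans ?_
      have : 8 * R₂ ^ 3 / (2 * π * x) ^ 2 = (2 / π ^ 2) * (R₂ ^ 3 * (1 / x ^ 2)) := by field_simp; ring
      rw [this, mul_assoc]
      refine mul_le_mul_of_nonneg_right ?_ (by positivity)
      rw [div_le_iff₀ (by positivity)]
      nlinarith [pi_gt_three]
    have hplus := hbd (√m + √n) (by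
      have : 0 < √(m : ℝ) := Real.sqrt_pos.2 (by exact_mod_cast Nat.pos_of_ne_zero hmn)
      positivity)
    have hminus : |G (2 * π * (√m - √n)) - (if m = n then G 0 else 0)| ≤ 2 * R₂ ^ 3 * (1 / (√m - √n) ^ 2) := by
      split_ifs with hh
      · subst hh; simp
      · rw [sub_zero]
        refine hbd _ (sub_ne_zero.2 fun h => hh ?_)
        exact_mod_cast (Real.sqrt_inj (Nat.cast_nonneg m) (Nat.cast_nonneg n)).1 h
    rw [← mul_sub, abs_mul, abs_of_nonneg (by positivity), add_sub_right_comm]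
    calc _ ≤ a m * a n / 2 * (2 * R₂ ^ 3 * (1 / (√m - √n) ^ 2) + 2 * R₂ ^ 3 * (1 / (√m + √n) ^ 2)) := by
          gcongr
          exact (abs_add_le _ _).trans (add_le_add hminus hplus)
      _ = _ := by ring
  calc _ ≤ ∑ m ∈ Finset.range N, ∑ n ∈ Finset.range N,
        R₂ ^ 3 * (a m * a n * (1 / (√m - √n) ^ 2 + 1 / (√m + √n) ^ 2)) := by
        refine (Finset.abs_sum_le_sum_abs _ _).trans (Finset.sum_le_sum fun m _ => ?_)
        rw [← Finset.sum_sub_distrib]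
        exact (Finset.abs_sum_le_sum_abs _ _).trans (Finset.sum_le_sum fun n _ => hpair m n)
    _ = R₂ ^ 3 * ∑ m ∈ Finset.range N, ∑ n ∈ Finset.range N,
        a m * a n * (1 / (√m - √n) ^ 2 + 1 / (√m + √n) ^ 2) := by
        simp_rw [Finset.mul_sum]
    _ ≤ R₂ ^ 3 * (K * ∑ n ∈ Finset.range N, n * a n ^ 2) := by
        gcongr; exact h a ha ha0 N
    _ = _ := by ring

lemma meanSq_cosSum : ∃ C : ℝ, 0 ≤ C ∧ ∀ a : ℕ → ℝ, (∀ n, 0 ≤ a n) → a 0 = 0 → ∀ (N : ℕ) (T η : ℝ),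
    0 < T → 0 < η → η ≤ 1 →
    |(∫ t in 0..T, t ^ 3 * cosSum a N t ^ 2) - T ^ 4 / 8 * ∑ n ∈ Finset.range N, a n ^ 2| ≤
      C * (η * T ^ 4 * ∑ n ∈ Finset.range N, a n ^ 2 + T ^ 2 / η * ∑ n ∈ Finset.range N, n * a n ^ 2) := by
  obtain ⟨K, hK, h⟩ := average_cosSum_sq
  refine ⟨2 + 8 * K, by positivity, fun a ha ha0 N T η hT hη hη1 => ?_⟩
  set A := ∑ n ∈ Finset.range N, a n ^ 2 with hA
  set B := ∑ n ∈ Finset.range N, (n : ℝ) * a n ^ 2 with hB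
  have hA0 : 0 ≤ A := Finset.sum_nonneg fun n _ => sq_nonneg _
  have hB0 : 0 ≤ B := Finset.sum_nonneg fun n _ => by positivity
  let F : ℝ → ℝ := fun R => ∫ t in 0..R, t ^ 3 * cosSum a N t ^ 2
  have hcv : Continuous fun t : ℝ => t ^ 3 * cosSum a N t ^ 2 :=
    (continuous_pow 3).mul ((continuous_cosSum a N).pow 2)
  have hFc : Continuous F := intervalIntegral.continuous_primitive (fun a b => hcv.intervalIntegrable a b) 0
  have hFm : ∀ R R' : ℝ, 0 ≤ R → R ≤ R' → F R ≤ F R' := by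
    intro R R' hR hRR
    have : F R' - F R = ∫ t in R..R', t ^ 3 * cosSum a N t ^ 2 :=
      intervalIntegral.integral_interval_sub_left (hcv.intervalIntegrable _ _) (hcv.intervalIntegrable _ _)
    have h2 : 0 ≤ ∫ t in R..R', t ^ 3 * cosSum a N t ^ 2 :=
      intervalIntegral.integral_nonneg hRR fun t ht => by
        have := hR.trans ht.1
        positivity
    linarith
  have hq : Continuous fun R : ℝ => R ^ 4 / 8 := by fun_prop
  have hηT : 0 < η * T := by positivity
  have hup := h a ha ha0 N T (T + η * T) hT.le (by linarith)
  have hlo := h a ha ha0 N (T - η * T) T (by nlinarith) (by linarith)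
  have iup : η * T * F T ≤ ∫ R in T..(T + η * T), F R := by
    calc η * T * F T = ∫ R in T..(T + η * T), F T := by
          rw [intervalIntegral.integral_const, smul_eq_mul]; ring
      _ ≤ _ := intervalIntegral.integral_mono_on (by linarith) intervalIntegrable_const
          (hFc.intervalIntegrable _ _) fun R hR => hFm _ _ hT.le hR.1
  have ilo : ∫ R in (T - η * T)..T, F R ≤ η * T * F T := by
    calc _ ≤ ∫ R in (T - η * T)..T, F T :=
          intervalIntegral.integral_mono_on (by linarith) (hFc.intervalIntegrable _ _)
            intervalIntegrable_const fun R hR => hFm _ _ (le_trans (by nlinarith) hR.1) hR.2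
      _ = _ := by rw [intervalIntegral.integral_const, smul_eq_mul]; ring
  have qup : ∫ R in T..(T + η * T), R ^ 4 / 8 ≤ η * T * (T ^ 4 / 8 * (1 + 15 * η)) := by
    calc _ ≤ ∫ R in T..(T + η * T), (T + η * T) ^ 4 / 8 :=
          intervalIntegral.integral_mono_on (by linarith) (hq.intervalIntegrable _ _)
            intervalIntegrable_const fun R hR => by
              have := hT.le.trans hR.1
              have := hR.2
              gcongr
      _ = η * T * (T ^ 4 / 8 * (1 + η) ^ 4) := by
          rw [intervalIntegral.integral_const, smul_eq_mul]; ring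
      _ ≤ _ := by
          gcongr
          nlinarith [mul_nonneg hη.le (sub_nonneg.2 hη1), mul_nonneg (sq_nonneg η) (sub_nonneg.2 hη1),
            mul_nonneg (pow_nonneg hη.le 3) (sub_nonneg.2 hη1)]
  have qlo : η * T * (T ^ 4 / 8 * (1 - 4 * η)) ≤ ∫ R in (T - η * T)..T, R ^ 4 / 8 := by
    calc _ ≤ η * T * (T ^ 4 / 8 * (1 - η) ^ 4) := by
          gcongr
          nlinarith [sq_nonneg η, sq_nonneg (η * (η - 1)), mul_nonneg (sq_nonneg η) (sub_nonneg.2 hη1)]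
      _ = ∫ R in (T - η * T)..T, (T - η * T) ^ 4 / 8 := by
          rw [intervalIntegral.integral_const, smul_eq_mul]; ring
      _ ≤ _ :=
          intervalIntegral.integral_mono_on (by linarith) intervalIntegrable_const
            (hq.intervalIntegrable _ _) fun R hR => by
              have : 0 ≤ T - η * T := by nlinarith
              have := hR.1
              gcongr
  have hK1 : K * (T + η * T) ^ 3 * B ≤ η * T * (8 * K * (T ^ 2 / η * B)) := by
    have : η * T * (8 * K * (T ^ 2 / η * B)) = K * (T + T) ^ 3 * B := by field_simp; ring
    rw [this]
    gcongr
    nlinarith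
  have hK2 : K * T ^ 3 * B ≤ η * T * (8 * K * (T ^ 2 / η * B)) := by
    refine le_trans ?_ hK1
    gcongr
    linarith
  have a1 := mul_le_mul_of_nonneg_left qup hA0
  have a2 := mul_le_mul_of_nonneg_left qlo hA0
  have u : η * T * F T ≤ η * T * (A * (T ^ 4 / 8 * (1 + 15 * η)) + 8 * K * (T ^ 2 / η * B)) := by
    have := (abs_le.1 hup).2
    linarith
  have l : η * T * (A * (T ^ 4 / 8 * (1 - 4 * η)) - 8 * K * (T ^ 2 / η * B)) ≤ η * T * F T := by
    have := (abs_le.1 hlo).1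
    linarith
  have u' := le_of_mul_le_mul_left u hηT
  have l' := le_of_mul_le_mul_left l hηT
  have p1 : 0 ≤ η * T ^ 4 * A := by positivity
  have p2 : 0 ≤ T ^ 2 / η * B := by positivity
  have p3 : 0 ≤ K * (η * T ^ 4 * A) := by positivity
  change |F T - _| ≤ _
  rw [abs_le]
  constructor <;> nlinarith

/-- The cosine series approximating the lattice discrepancy. -/
def cosSeries (a : ℕ → ℝ) (t : ℝ) : ℝ := ∑' n : ℕ, a n * cos (2 * π * √n * t)

lemma norm_mul_cos_le {a : ℕ → ℝ} (ha : ∀ n, 0 ≤ a n) (n : ℕ) (x : ℝ) : ‖a n * cos x‖ ≤ a n := by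
  rw [norm_mul, Real.norm_of_nonneg (ha n)]
  exact mul_le_of_le_one_right (ha n) (abs_cos_le_one _)

lemma summable_mul_cos {a : ℕ → ℝ} (ha : ∀ n, 0 ≤ a n) (hs : Summable a) (θ : ℕ → ℝ) :
    Summable fun n => a n * cos (θ n) :=
  Summable.of_norm_bounded hs fun n => norm_mul_cos_le ha n _

lemma continuous_cosSeries {a : ℕ → ℝ} (ha : ∀ n, 0 ≤ a n) (hs : Summable a) :
    Continuous (cosSeries a) :=
  continuous_tsum (fun n => by fun_prop) hs fun n t => norm_mul_cos_le ha n _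

lemma meanSq_cosSeries : ∃ C : ℝ, 0 ≤ C ∧ ∀ a : ℕ → ℝ, (∀ n, 0 ≤ a n) → a 0 = 0 → Summable a →
    Summable (fun n => a n ^ 2) → Summable (fun n => n * a n ^ 2) → ∀ T η : ℝ,
    0 < T → 0 < η → η ≤ 1 →
    |(∫ t in 0..T, t ^ 3 * cosSeries a t ^ 2) - T ^ 4 / 8 * ∑' n, a n ^ 2| ≤
      C * (η * T ^ 4 * ∑' n, a n ^ 2 + T ^ 2 / η * ∑' n : ℕ, n * a n ^ 2) := by
  obtain ⟨C, hC, h⟩ := meanSq_cosSum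
  refine ⟨C, hC, fun a ha ha0 hs hs2 hs3 T η hT hη hη1 => ?_⟩
  have hA := hs2.hasSum.tendsto_sum_nat
  have hB := hs3.hasSum.tendsto_sum_nat
  have hI : Tendsto (fun N => ∫ t in 0..T, t ^ 3 * cosSum a N t ^ 2) atTop
      (𝓝 (∫ t in 0..T, t ^ 3 * cosSeries a t ^ 2)) := by
    refine intervalIntegral.tendsto_integral_filter_of_dominated_convergence
      (fun t => T ^ 3 * (∑' n, a n) ^ 2) ?_ ?_ intervalIntegrable_const ?_
    · exact Eventually.of_forall fun N =>
        ((continuous_pow 3).mul ((continuous_cosSum a N).pow 2)).aestronglyMeasurable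
    · refine Eventually.of_forall fun N => ae_of_all _ fun t ht => ?_
      rw [uIoc_of_le hT.le] at ht
      have ht0 := ht.1.le
      have hb : ‖cosSum a N t‖ ≤ ∑' n, a n :=
        (norm_sum_le_of_le _ fun n _ => norm_mul_cos_le ha n _).trans (hs.sum_le_tsum _ fun n _ => ha n)
      rw [norm_mul, norm_pow, norm_pow, Real.norm_of_nonneg ht0]
      gcongr
      exact ht.2
    · refine ae_of_all _ fun t _ => ?_
      exact ((summable_mul_cos ha hs _).hasSum.tendsto_sum_nat.pow 2).const_mul _
  exact le_of_tendsto_of_tendsto' ((hI.sub (hA.const_mul _)).abs)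
    (((hA.const_mul _).add (hB.const_mul _)).const_mul C) fun N => h a ha ha0 N T η hT hη hη1

/-- The coefficients of the smoothed discrepancy. -/
def coef (X : ℝ) (n : ℕ) : ℝ := r3 n * rexp (-(π / X) * n) / n

lemma coef_nonneg (X : ℝ) (n : ℕ) : 0 ≤ coef X n := by unfold coef; positivity

lemma coef_zero (X : ℝ) : coef X 0 = 0 := by simp [coef]

lemma summable_coef {X : ℝ} (hX : 0 < X) : Summable (coef X) := by
  refine Summable.of_nonneg_of_le (coef_nonneg X) (fun n => ?_)
    (hasSum_fiber (f := fun n => rexp (-(π / X) * n)) (summable_exp_normSq (by positivity))).summable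
  rcases Nat.eq_zero_or_pos n with rfl | hn
  · rw [coef_zero]; positivity
  · exact div_le_self (by positivity) (by exact_mod_cast hn)

lemma coef_sq (X : ℝ) (n : ℕ) : coef X n ^ 2 = r3Sq n / n ^ 2 * rexp (-(2 * π / X) * n) := by
  rcases Nat.eq_zero_or_pos n with rfl | hn
  · simp [coef_zero]
  · rw [coef, r3Sq, if_neg hn.ne', div_pow, mul_pow, ← Real.exp_nat_mul]
    push_cast
    ring_nf

lemma mul_coef_sq (X : ℝ) (n : ℕ) : n * coef X n ^ 2 = r3Sq n / n * rexp (-(2 * π / X) * n) := by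
  rw [coef_sq]
  rcases Nat.eq_zero_or_pos n with rfl | hn
  · simp
  · field_simp

lemma summable_coef_sq {X : ℝ} (hX : 0 < X) :
    Summable (fun n => coef X n ^ 2) ∧ Summable fun n => n * coef X n ^ 2 := by
  have hs := (hasSum_r3Sq (s := 2 * π / X) (by positivity)).summable
  have h2 : Summable fun n => n * coef X n ^ 2 := by
    refine Summable.of_nonneg_of_le (fun n => by positivity) (fun n => ?_) hs
    rw [mul_coef_sq]
    gcongr
    rcases Nat.eq_zero_or_pos n with rfl | hn
    · simp [r3Sq_zero]
    · exact div_le_self (r3Sq_nonneg n) (by exact_mod_cast hn)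
  refine ⟨Summable.of_nonneg_of_le (fun n => by positivity) (fun n => ?_) h2, h2⟩
  rcases Nat.eq_zero_or_pos n with rfl | hn
  · simp [coef_zero]
  · exact le_mul_of_one_le_left (sq_nonneg _) (by exact_mod_cast hn)

lemma meanSq_coef : ∃ c C : ℝ, 0 < c ∧ 0 ≤ C ∧ ∀ X : ℝ, 8 ≤ X →
    |(∫ t in 0..√X, t ^ 3 * cosSeries (coef X) t ^ 2) - c * (X ^ 2 * log X)| ≤ C * (X ^ 2 * √(log X)) := by
  obtain ⟨C, hC, h⟩ := meanSq_cosSeries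
  obtain ⟨c, D, hc, hD, hJ, hJ1, -⟩ := logSum_asymp
  have hπ0 := pi_pos
  refine ⟨c / 8, c * log (2 * π) + D + C * (c + D + D), by positivity, ?_, fun X hX => ?_⟩
  · have : 0 ≤ log (2 * π) := log_nonneg (by linarith [pi_gt_three])
    positivity
  have hX0 : 0 < X := by linarith
  have hlog1 : 1 ≤ log X := by
    rw [Real.le_log_iff_exp_le hX0]
    linarith [exp_one_lt_d9]
  have hl2π : 0 ≤ log (2 * π) := log_nonneg (by linarith [pi_gt_three])
  have hsq1 : 1 ≤ √(log X) := Real.one_le_sqrt.2 hlog1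
  have hsq : √(log X) ^ 2 = log X := Real.sq_sqrt (by linarith)
  have hs0 : 0 < 2 * π / X := by positivity
  have hs1 : 2 * π / X ≤ 1 := by
    rw [div_le_one hX0]; linarith [pi_lt_four]
  have hm := h (coef X) (coef_nonneg X) (coef_zero X) (summable_coef hX0) (summable_coef_sq hX0).1
    (summable_coef_sq hX0).2 (√X) (1 / √(log X)) (Real.sqrt_pos.2 hX0) (by positivity)
    (by rw [div_le_one (by positivity)]; exact hsq1)
  have hA := hJ _ hs0 hs1
  have hB := hJ1 _ hs0 hs1
  rw [← tsum_congr (coef_sq X)] at hA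
  rw [← tsum_congr (mul_coef_sq X)] at hB
  have hX2 : √X ^ 2 = X := Real.sq_sqrt hX0.le
  have hX4 : √X ^ 4 = X ^ 2 := by rw [show (4 : ℕ) = 2 * 2 from rfl, pow_mul, hX2]
  rw [hX2, hX4] at hm
  have hl : log (1 / (2 * π / X)) = log X - log (2 * π) := by
    rw [one_div_div, Real.log_div hX0.ne' (by positivity)]
  rw [hl] at hA
  have hB0 : 0 ≤ ∑' n : ℕ, n * coef X n ^ 2 := tsum_nonneg fun n => by positivity
  set A := ∑' n, coef X n ^ 2 with hAdef
  set B := ∑' n : ℕ, n * coef X n ^ 2 with hBdef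
  set L := √(log X) with hL
  rw [← hsq] at hA ⊢
  rw [abs_le] at hA
  have hA1 : A ≤ (c + D) * L ^ 2 := by nlinarith [hA.2]
  have hB1 : B ≤ D * X := by
    refine hB.trans ?_
    rw [div_div_eq_mul_div, div_le_iff₀ (by positivity)]
    have : 0 ≤ D * X := by positivity
    nlinarith [pi_gt_three]
  have hL0 : 0 < L := by linarith
  have herr : C * (1 / L * X ^ 2 * A + X / (1 / L) * B) ≤ C * (c + D + D) * (X ^ 2 * L) := by
    calc _ ≤ C * (1 / L * X ^ 2 * ((c + D) * L ^ 2) + X / (1 / L) * (D * X)) := by gcongr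
      _ = _ := by field_simp
  have hmain : |X ^ 2 / 8 * A - c / 8 * (X ^ 2 * L ^ 2)| ≤ (c * log (2 * π) + D) * (X ^ 2 * L) := by
    have e : X ^ 2 / 8 * A - c / 8 * (X ^ 2 * L ^ 2) = X ^ 2 / 8 * (A - c * L ^ 2) := by ring
    rw [e, abs_mul, abs_of_nonneg (by positivity)]
    have h1 : |A - c * L ^ 2| ≤ c * log (2 * π) + D := by
      have : 0 ≤ c * log (2 * π) := by positivity
      rw [abs_le]; constructor <;> linarith [hA.1, hA.2]
    calc X ^ 2 / 8 * |A - c * L ^ 2| ≤ X ^ 2 * (c * log (2 * π) + D) := by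
          gcongr; linarith [sq_nonneg X]
      _ = (c * log (2 * π) + D) * (X ^ 2 * 1) := by ring
      _ ≤ _ := by gcongr
  have := (abs_sub_le _ _ _).trans (add_le_add (hm.trans herr) hmain)
  calc _ ≤ _ := this
    _ = _ := by ring

/-- Euclidean three-space, with the first coordinate split off. -/
abbrev Space := WithLp 2 (ℝ × EuclideanSpace ℝ (Fin 2))

/-- The Fourier transform of the ball of radius `t` at frequencies of norm `κ`. -/
def ballFourier (t κ : ℝ) : ℝ := ∫ s in -t..t, π * (t ^ 2 - s ^ 2) * cos (2 * π * κ * s)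

lemma ballFourier_zero (t : ℝ) : ballFourier t 0 = 4 * π / 3 * t ^ 3 := by
  simp only [ballFourier, mul_zero, zero_mul, cos_zero, mul_one]
  rw [intervalIntegral.integral_const_mul, intervalIntegral.integral_sub intervalIntegrable_const
    ((continuous_pow 2).intervalIntegrable _ _), integral_pow, intervalIntegral.integral_const]
  push_cast
  simp only [smul_eq_mul]
  ring

lemma ballFourier_eq {κ : ℝ} (hκ : κ ≠ 0) (t : ℝ) :
    ballFourier t κ = sin (2 * π * κ * t) / (2 * π ^ 2 * κ ^ 3) - t / π * (cos (2 * π * κ * t) / κ ^ 2) := by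
  have hπ := pi_ne_zero
  set α := 2 * π * κ with hα
  have hα0 : α ≠ 0 := by positivity
  have hd : ∀ s : ℝ, HasDerivAt (fun s => π * ((t ^ 2 - s ^ 2) * (sin (α * s) / α) - 2 * s * (cos (α * s) / α ^ 2) +
      2 * (sin (α * s) / α ^ 3))) (π * (t ^ 2 - s ^ 2) * cos (α * s)) s := by
    intro s
    have hs : HasDerivAt (fun s => sin (α * s)) (cos (α * s) * (α * 1)) s :=
      ((hasDerivAt_id s).const_mul α).sin
    have hc : HasDerivAt (fun s => cos (α * s)) (-sin (α * s) * (α * 1)) s :=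
      ((hasDerivAt_id s).const_mul α).cos
    have hp : HasDerivAt (fun s : ℝ => t ^ 2 - s ^ 2) (-(2 * s)) s := by
      simpa using (hasDerivAt_pow 2 s).const_sub (t ^ 2)
    have h2 : HasDerivAt (fun s : ℝ => 2 * s) (2 * 1) s := (hasDerivAt_id s).const_mul 2
    refine ((((hp.fun_mul (hs.div_const α)).fun_sub (h2.fun_mul (hc.div_const (α ^ 2)))).fun_add
      ((hs.div_const (α ^ 3)).const_mul 2)).const_mul π).congr_deriv ?_
    field_simp
    ring
  rw [ballFourier, intervalIntegral.integral_eq_sub_of_hasDerivAt (fun s _ => hd s)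
    ((by fun_prop : Continuous fun s : ℝ => π * (t ^ 2 - s ^ 2) * cos (α * s)).intervalIntegrable _ _)]
  simp only [mul_neg, sin_neg, cos_neg]
  rw [hα]
  field_simp
  ring

lemma volume_slice (t s : ℝ) :
    (volume : Measure (EuclideanSpace ℝ (Fin 2))).real {z | s ^ 2 + ‖z‖ ^ 2 ≤ t ^ 2} =
      if s ^ 2 ≤ t ^ 2 then π * (t ^ 2 - s ^ 2) else 0 := by
  split_ifs with h
  · have : {z : EuclideanSpace ℝ (Fin 2) | s ^ 2 + ‖z‖ ^ 2 ≤ t ^ 2} = Metric.closedBall 0 (√(t ^ 2 - s ^ 2)) := by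
      ext z
      rw [mem_ofPred_eq, mem_closedBall_zero_iff, Real.le_sqrt (norm_nonneg _) (by linarith)]
      constructor <;> intro h <;> linarith
    rw [this, Measure.real, EuclideanSpace.volume_closedBall_fin_two]
    simp [Real.sq_sqrt (sub_nonneg.2 h), ENNReal.toReal_ofReal (Real.sqrt_nonneg _), pi_pos.le, mul_comm]
  · have : {z : EuclideanSpace ℝ (Fin 2) | s ^ 2 + ‖z‖ ^ 2 ≤ t ^ 2} = ∅ := by
      ext z
      simp only [mem_ofPred_eq, mem_empty_iff_false, iff_false]
      nlinarith [sq_nonneg ‖z‖]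
    rw [this]; simp

lemma integral_ball_cos_fst {t : ℝ} (ht : 0 ≤ t) (κ : ℝ) :
    ∫ y in Metric.closedBall (0 : Space) t, cos (2 * π * κ * y.fst) = ballFourier t κ := by
  let S : Set (ℝ × EuclideanSpace ℝ (Fin 2)) := {p | p.1 ^ 2 + ‖p.2‖ ^ 2 ≤ t ^ 2}
  have hpre : (WithLp.toLp 2) ⁻¹' Metric.closedBall (0 : Space) t = S := by
    ext p
    rw [mem_preimage, mem_closedBall_zero_iff, mem_ofPred_eq, ← sq_le_sq₀ (norm_nonneg _) ht,
      WithLp.prod_norm_sq_eq_of_L2]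
    simp
  have hS : MeasurableSet S := by
    apply measurableSet_le <;> fun_prop
  have hmp := WithLp.volume_preserving_toLp (U := ℝ) (V := EuclideanSpace ℝ (Fin 2))
  have hSvol : volume S < ⊤ := by
    rw [← hpre, hmp.measure_preimage measurableSet_closedBall.nullMeasurableSet]
    exact measure_closedBall_lt_top
  have hint : Integrable (S.indicator fun p : ℝ × EuclideanSpace ℝ (Fin 2) => cos (2 * π * κ * p.1)) := by
    rw [integrable_indicator_iff hS]
    refine Measure.integrableOn_of_bounded (M := 1) hSvol.ne ?_ (ae_of_all _ fun p => abs_cos_le_one _)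
    exact (by fun_prop : Continuous fun p : ℝ × EuclideanSpace ℝ (Fin 2) => cos (2 * π * κ * p.1)).aestronglyMeasurable
  rw [← hmp.setIntegral_preimage_emb (MeasurableEquiv.toLp 2 _).measurableEmbedding, hpre]
  simp only [WithLp.toLp_fst]
  rw [← integral_indicator hS, Measure.volume_eq_prod, integral_prod _ (by rwa [← Measure.volume_eq_prod])]
  have hin : ∀ s : ℝ, ∫ z : EuclideanSpace ℝ (Fin 2), S.indicator (fun p => cos (2 * π * κ * p.1)) (s, z) =
      (Icc (-t) t).indicator (fun s => π * (t ^ 2 - s ^ 2) * cos (2 * π * κ * s)) s := by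
    intro s
    have e : (fun z : EuclideanSpace ℝ (Fin 2) => S.indicator (fun p => cos (2 * π * κ * p.1)) (s, z)) =
        {z : EuclideanSpace ℝ (Fin 2) | s ^ 2 + ‖z‖ ^ 2 ≤ t ^ 2}.indicator fun _ => cos (2 * π * κ * s) := by
      ext z; rfl
    rw [e, integral_indicator (by apply measurableSet_le <;> fun_prop), setIntegral_const, volume_slice,
      smul_eq_mul, ite_mul, zero_mul, indicator_apply]
    congr 1
    rw [mem_Icc, ← abs_le, sq_le_sq, abs_of_nonneg ht]
  simp_rw [hin]
  rw [integral_indicator measurableSet_Icc, ballFourier, intervalIntegral.integral_of_le (by linarith),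
    integral_Icc_eq_integral_Ioc]

lemma integral_ball_cos_inner {t : ℝ} (ht : 0 ≤ t) (v : Space) :
    ∫ y in Metric.closedBall (0 : Space) t, cos (2 * π * inner ℝ v y) = ballFourier t ‖v‖ := by
  let w : Space := WithLp.toLp 2 (‖v‖, 0)
  have hw : ‖w‖ = ‖v‖ := by
    rw [← sq_eq_sq₀ (norm_nonneg _) (norm_nonneg _), WithLp.prod_norm_sq_eq_of_L2]
    simp [w]
  let R := (ℝ ∙ (v - w))ᗮ.reflection
  have hR : R v = w := Submodule.reflection_sub hw.symm
  have hb : R ⁻¹' Metric.closedBall (0 : Space) t = Metric.closedBall 0 t := by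
    ext y
    rw [mem_preimage, mem_closedBall_zero_iff, mem_closedBall_zero_iff, R.norm_map]
  have hmp := R.measurePreserving.setIntegral_preimage_emb R.toHomeomorph.measurableEmbedding
    (fun y : Space => cos (2 * π * ‖v‖ * y.fst)) (Metric.closedBall 0 t)
  rw [hb] at hmp
  rw [← integral_ball_cos_fst ht, ← hmp]
  refine integral_congr_ae (ae_of_all _ fun y => ?_)
  have : inner ℝ v y = ‖v‖ * (R y).fst := by
    rw [← R.inner_map_map, hR, WithLp.prod_inner_apply]
    simp [w, mul_comm]
  simp only [this, mul_assoc]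

/-- The embedding of the integer lattice into Euclidean space. -/
def toSpace (p : Z3) : Space := WithLp.toLp 2 ((p.1 : ℝ), !₂[(p.2.1 : ℝ), (p.2.2 : ℝ)])

lemma norm_sub_sq_eq (p : Z3) (y : Space) :
    ‖toSpace p - y‖ ^ 2 = (p.1 - y.fst) ^ 2 + ((p.2.1 - y.snd 0) ^ 2 + (p.2.2 - y.snd 1) ^ 2) := by
  rw [WithLp.prod_norm_sq_eq_of_L2, EuclideanSpace.norm_sq_eq]
  simp [toSpace, Fin.sum_univ_two]

lemma inner_toSpace (p : Z3) (y : Space) :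
    inner ℝ (toSpace p) y = p.1 * y.fst + (p.2.1 * y.snd 0 + p.2.2 * y.snd 1) := by
  rw [WithLp.prod_inner_apply, PiLp.inner_apply]
  simp [toSpace, Fin.sum_univ_two, mul_comm]

lemma norm_toSpace_sq (p : Z3) : ‖toSpace p‖ ^ 2 = normSq p := by
  have := norm_sub_sq_eq p 0
  rw [sub_zero] at this
  rw [this, normSq_cast]
  simp
  ring

lemma norm_toSpace (p : Z3) : ‖toSpace p‖ = √(normSq p) := by
  rw [← norm_toSpace_sq, Real.sqrt_sq (norm_nonneg _)]

lemma poisson_toSpace {X : ℝ} (hX : 0 < X) (y : Space) :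
    √X ^ 3 * ∑' m : Z3, rexp (-(π * X) * ‖toSpace m - y‖ ^ 2) =
      ∑' k : Z3, rexp (-(π / X) * normSq k) * cos (2 * π * inner ℝ (toSpace k) y) := by
  have hs : 0 < π * X := by positivity
  have h := tsum_gaussChar3 hs (y.fst, y.snd 0, y.snd 1) (0, 0, 0)
  have e1 : ∀ m : Z3, gaussChar (π * X) y.fst 0 m.1 * (gaussChar (π * X) (y.snd 0) 0 m.2.1 *
      gaussChar (π * X) (y.snd 1) 0 m.2.2) = ((rexp (-(π * X) * ‖toSpace m - y‖ ^ 2) : ℝ) : ℂ) := by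
    intro m
    rw [norm_sub_sq_eq]
    simp only [gaussChar, ← Complex.exp_add, Complex.ofReal_exp]
    congr 1
    push_cast
    ring
  have e2 : ∀ k : Z3, gaussCharDual (π * X) y.fst 0 k.1 * (gaussCharDual (π * X) (y.snd 0) 0 k.2.1 *
      gaussCharDual (π * X) (y.snd 1) 0 k.2.2) =
      (rexp (-(π / X) * normSq k) : ℝ) * Complex.exp ((-(2 * π * inner ℝ (toSpace k) y) : ℝ) * Complex.I) := by
    intro k
    rw [inner_toSpace, normSq_cast]
    simp only [gaussCharDual, ← Complex.exp_add, Complex.ofReal_exp]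
    have hπ : (π : ℂ) ≠ 0 := by exact_mod_cast pi_ne_zero
    have hXc : (X : ℂ) ≠ 0 := by exact_mod_cast hX.ne'
    congr 1
    push_cast
    field_simp
    ring
  simp only [e1, e2] at h
  have hsum : Summable fun k : Z3 => ((rexp (-(π / X) * normSq k) : ℝ) : ℂ) *
      Complex.exp ((-(2 * π * inner ℝ (toSpace k) y) : ℝ) * Complex.I) := by
    refine Summable.of_norm ((summable_exp_normSq (s := π / X) (by positivity)).congr fun k => ?_)
    rw [norm_mul, Complex.norm_exp_ofReal_mul_I, mul_one, Complex.norm_real, Real.norm_of_nonneg (exp_pos _).le]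
  rw [← Complex.ofReal_tsum] at h
  have hre := congrArg Complex.re h
  rw [Complex.ofReal_re, Complex.re_ofReal_mul, Complex.re_tsum hsum] at hre
  rw [hre, ← mul_assoc, ← mul_pow, ← Real.sqrt_mul hX.le]
  have : X * (π / (π * X)) = 1 := by
    have := pi_ne_zero
    field_simp
  rw [this, Real.sqrt_one, one_pow, one_mul]
  refine tsum_congr fun k => ?_
  rw [Complex.re_ofReal_mul, Complex.exp_ofReal_mul_I_re, cos_neg]

/-- The indicator function of the ball of radius `t`, smoothed by a Gaussian of variance `1 / X`. -/
def smoothInd (X t : ℝ) (v : Space) : ℝ :=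
  √X ^ 3 * ∫ y in Metric.closedBall (0 : Space) t, rexp (-(π * X) * ‖v - y‖ ^ 2)

lemma abs_ballFourier_le {t : ℝ} (ht : 0 ≤ t) (κ : ℝ) : |ballFourier t κ| ≤ ballFourier t 0 := by
  rw [ballFourier, ← Real.norm_eq_abs]
  refine intervalIntegral.norm_integral_le_of_norm_le (by linarith) (ae_of_all _ fun s hs => ?_)
    ((by fun_prop : Continuous fun s : ℝ => π * (t ^ 2 - s ^ 2) * cos (2 * π * 0 * s)).intervalIntegrable _ _)
  have h2 : 0 ≤ t ^ 2 - s ^ 2 := by nlinarith [hs.1, hs.2]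
  rw [mul_zero, zero_mul, cos_zero, mul_one, norm_mul, Real.norm_of_nonneg (by positivity)]
  exact mul_le_of_le_one_right (by positivity) (abs_cos_le_one _)

lemma hasSum_smoothInd {X t : ℝ} (hX : 0 < X) (ht : 0 ≤ t) :
    HasSum (fun m : Z3 => smoothInd X t (toSpace m))
      (∑' k : Z3, rexp (-(π / X) * normSq k) * ballFourier t √(normSq k)) := by
  set B := Metric.closedBall (0 : Space) t with hB
  have hBfin : volume B < ⊤ := measure_closedBall_lt_top
  have hI : ∀ {f : Space → ℝ}, Continuous f → IntegrableOn f B := fun hf =>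
    hf.continuousOn.integrableOn_compact (isCompact_closedBall _ _)
  have hBd : ∀ {f : Space → ℝ} {b : ℝ}, (∀ y ∈ B, ‖f y‖ ≤ b) → ∫ y in B, ‖f y‖ ≤ b * volume.real B := by
    intro f b hf
    refine (le_abs_self _).trans ?_
    rw [← Real.norm_eq_abs]
    exact norm_setIntegral_le_of_norm_le_const hBfin (f := fun y => ‖f y‖) fun y hy => by
      rw [norm_norm]; exact hf y hy
  have h1 : HasSum (fun m : Z3 => ∫ y in B, rexp (-(π * X) * ‖toSpace m - y‖ ^ 2))
      (∫ y in B, ∑' m : Z3, rexp (-(π * X) * ‖toSpace m - y‖ ^ 2)) := by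
    refine hasSum_integral_of_summable_integral_norm (fun m => hI (by fun_prop)) ?_
    refine Summable.of_nonneg_of_le (fun m => integral_nonneg fun y => norm_nonneg _) (fun m => ?_)
      (((summable_exp_normSq (s := π * X / 2) (by positivity)).mul_left (rexp (π * X * t ^ 2))).mul_right
        (volume.real B))
    refine hBd fun y hy => ?_
    rw [hB, mem_closedBall_zero_iff] at hy
    rw [Real.norm_of_nonneg (exp_pos _).le, ← Real.exp_add, Real.exp_le_exp, ← norm_toSpace_sq]
    have h3 : ‖toSpace m‖ ≤ ‖toSpace m - y‖ + ‖y‖ := by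
      simpa using norm_add_le (toSpace m - y) y
    have h4 : ‖toSpace m‖ ^ 2 / 2 ≤ ‖toSpace m - y‖ ^ 2 + t ^ 2 := by
      nlinarith [norm_nonneg (toSpace m), norm_nonneg y, norm_nonneg (toSpace m - y),
        sq_nonneg (‖toSpace m - y‖ - ‖y‖)]
    have := mul_le_mul_of_nonneg_left h4 (by positivity : 0 ≤ π * X)
    linarith
  have h2 : HasSum (fun k : Z3 => ∫ y in B, rexp (-(π / X) * normSq k) * cos (2 * π * inner ℝ (toSpace k) y))
      (∫ y in B, ∑' k : Z3, rexp (-(π / X) * normSq k) * cos (2 * π * inner ℝ (toSpace k) y)) := by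
    refine hasSum_integral_of_summable_integral_norm (fun m => hI (by fun_prop)) ?_
    refine Summable.of_nonneg_of_le (fun m => integral_nonneg fun y => norm_nonneg _) (fun m => ?_)
      ((summable_exp_normSq (s := π / X) (by positivity)).mul_right (volume.real B))
    refine hBd fun y hy => ?_
    rw [norm_mul, Real.norm_of_nonneg (exp_pos _).le]
    exact mul_le_of_le_one_right (exp_pos _).le (abs_cos_le_one _)
  have h3 := h1.mul_left (√X ^ 3)
  rw [← integral_const_mul] at h3
  simp_rw [poisson_toSpace hX] at h3
  rw [← h2.tsum_eq] at h3
  have e : ∀ k : Z3, ∫ y in B, rexp (-(π / X) * normSq k) * cos (2 * π * inner ℝ (toSpace k) y) =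
      rexp (-(π / X) * normSq k) * ballFourier t √(normSq k) := fun k => by
    rw [integral_const_mul, integral_ball_cos_inner ht, norm_toSpace]
  rw [tsum_congr e] at h3
  exact h3

lemma exists_tsum_coef_div_sqrt_le : ∃ C : ℝ, 0 ≤ C ∧ ∀ X : ℝ, 8 ≤ X →
    Summable (fun n : ℕ => coef X n / √n) ∧ ∑' n : ℕ, coef X n / √n ≤ C * √X := by
  obtain ⟨-, D, -, hD, -, hJ1, -⟩ := logSum_asymp
  have hS := Real.summable_one_div_nat_pow.2 one_lt_two
  have hS0 : 0 ≤ ∑' n : ℕ, 1 / (n : ℝ) ^ 2 := tsum_nonneg fun n => by positivity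
  refine ⟨(D + ∑' n : ℕ, 1 / (n : ℝ) ^ 2) / 2, by positivity, fun X hX => ?_⟩
  have hX0 : 0 < X := by linarith
  have hB := hJ1 (2 * π / X) (by positivity) (by rw [div_le_one hX0]; linarith [pi_lt_four])
  rw [← tsum_congr (mul_coef_sq X)] at hB
  have hr : 0 < √X := Real.sqrt_pos.2 hX0
  have hrr : √X ^ 2 = X := Real.sq_sqrt hX0.le
  have hsum := (((summable_coef_sq hX0).2.mul_left (1 / √X)).add (hS.mul_left √X)).mul_left (1 / 2)
  have hle : ∀ n : ℕ, coef X n / √n ≤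
      1 / 2 * (1 / √X * (n * coef X n ^ 2) + √X * (1 / (n : ℝ) ^ 2)) := by
    intro n
    rcases Nat.eq_zero_or_pos n with rfl | hn
    · simp [coef_zero]
    · have hn0 : (0 : ℝ) < √n := Real.sqrt_pos.2 (by exact_mod_cast hn)
      have hnn : (n : ℝ) = √n ^ 2 := (Real.sq_sqrt n.cast_nonneg).symm
      have h1 := sq_nonneg (√n * coef X n / √X - 1 / √n ^ 2)
      have h2 : 1 / √X * (n * coef X n ^ 2) + √X * (1 / (n : ℝ) ^ 2) - 2 * (coef X n / √n) =
          √X * (√n * coef X n / √X - 1 / √n ^ 2) ^ 2 := by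
        rw [hnn, Real.sqrt_sq hn0.le]
        field_simp
        ring
      have := mul_nonneg hr.le h1
      linarith
  have hs : Summable (fun n : ℕ => coef X n / √n) :=
    Summable.of_nonneg_of_le (fun n => div_nonneg (coef_nonneg X n) (Real.sqrt_nonneg _)) hle hsum
  refine ⟨hs, (hs.tsum_le_tsum hle hsum).trans ?_⟩
  rw [tsum_mul_left, ((summable_coef_sq hX0).2.mul_left _).tsum_add (hS.mul_left √X), tsum_mul_left, tsum_mul_left]
  have hB1 : ∑' n : ℕ, n * coef X n ^ 2 ≤ D * X := by
    refine hB.trans ?_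
    rw [div_div_eq_mul_div, div_le_iff₀ (by positivity)]
    have : 0 ≤ D * X := by positivity
    nlinarith [pi_gt_three]
  have : 1 / √X * ∑' n : ℕ, n * coef X n ^ 2 ≤ D * √X := by
    rw [one_div, inv_mul_le_iff₀ hr]
    nlinarith
  linarith

lemma exists_abs_tsum_smoothInd_le : ∃ C : ℝ, 0 ≤ C ∧ ∀ X : ℝ, 8 ≤ X → ∀ t : ℝ, 0 ≤ t →
    |(∑' m : Z3, smoothInd X t (toSpace m)) - 4 * π / 3 * t ^ 3 + t / π * cosSeries (coef X) t| ≤ C * √X := by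
  obtain ⟨C, hC, h⟩ := exists_tsum_coef_div_sqrt_le
  refine ⟨C, hC, fun X hX t ht => ?_⟩
  obtain ⟨hs, hle⟩ := h X hX
  have hX0 : 0 < X := by linarith
  have hf : Summable fun p : Z3 => rexp (-(π / X) * normSq p) * ballFourier t √(normSq p) :=
    Summable.of_norm_bounded ((summable_exp_normSq (s := π / X) (by positivity)).mul_right (ballFourier t 0))
      fun p => by
        rw [norm_mul, Real.norm_of_nonneg (exp_pos _).le]
        exact mul_le_mul_of_nonneg_left (abs_ballFourier_le ht _) (exp_pos _).le
  have h1 := hasSum_fiber (f := fun n => rexp (-(π / X) * n) * ballFourier t √n) hf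
  have hterm : ∀ n : ℕ, ‖coef X n / √n * (sin (2 * π * √n * t) / (2 * π ^ 2))‖ ≤ coef X n / √n := by
    intro n
    have h0 := div_nonneg (coef_nonneg X n) (Real.sqrt_nonneg n)
    rw [norm_mul, Real.norm_of_nonneg h0]
    refine mul_le_of_le_one_right h0 ?_
    have hp : 1 ≤ 2 * π ^ 2 := by nlinarith [pi_gt_three]
    rw [norm_div, Real.norm_of_nonneg (by positivity : 0 ≤ 2 * π ^ 2), div_le_one (by positivity)]
    exact (abs_sin_le_one _).trans hp
  have hU : Summable fun n : ℕ => coef X n / √n * (sin (2 * π * √n * t) / (2 * π ^ 2)) :=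
    Summable.of_norm_bounded hs hterm
  have h2 := ((hasSum_ite_eq 0 (4 * π / 3 * t ^ 3)).add hU.hasSum).sub
    ((summable_mul_cos (coef_nonneg X) (summable_coef hX0) fun n => 2 * π * √n * t).hasSum.mul_left (t / π))
  have e : ∀ n : ℕ, (r3 n : ℝ) * (rexp (-(π / X) * n) * ballFourier t √n) =
      (if n = 0 then 4 * π / 3 * t ^ 3 else 0) + coef X n / √n * (sin (2 * π * √n * t) / (2 * π ^ 2)) -
        t / π * (coef X n * cos (2 * π * √n * t)) := by
    intro n
    rcases Nat.eq_zero_or_pos n with rfl | hn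
    · simp [coef_zero, r3_zero, ballFourier_zero]
    · have hn0 : (0 : ℝ) < √n := Real.sqrt_pos.2 (by exact_mod_cast hn)
      have hnn : (n : ℝ) = √n ^ 2 := (Real.sq_sqrt n.cast_nonneg).symm
      rw [if_neg hn.ne', ballFourier_eq hn0.ne', coef, zero_add]
      generalize rexp (-(π / X) * n) = E
      rw [hnn, Real.sqrt_sq hn0.le]
      field_simp
  have h3 := (((hasSum_congr e).1 h1).unique h2)
  rw [(hasSum_smoothInd hX0 ht).tsum_eq, h3, cosSeries, add_sub_assoc, add_sub_cancel_left, sub_add_cancel]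
  exact (tsum_of_norm_bounded hs.hasSum hterm).trans hle

lemma integrable_exp_norm_sub {b : ℝ} (hb : 0 < b) (v : Space) :
    Integrable fun y : Space => rexp (-b * ‖v - y‖ ^ 2) := by
  have h : Integrable fun y : Space => rexp (-b * ‖y‖ ^ 2) := by
    refine (GaussianFourier.integrable_cexp_neg_mul_sq_norm_add (V := Space) (b := (b : ℂ))
      (by simpa using hb) 0 0).norm.congr (ae_of_all _ fun y => ?_)
    simp [Complex.norm_exp, ← Complex.ofReal_pow]
  exact h.comp_sub_left v

lemma sqrt_pow_mul_integral_exp_norm_sub {a X : ℝ} (ha : 0 < a) (hX : 0 < X) (v : Space) :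
    √X ^ 3 * ∫ y : Space, rexp (-(π / a * X) * ‖v - y‖ ^ 2) = √a ^ 3 := by
  have hb : 0 < π / a * X := by positivity
  rw [integral_sub_left_eq_self (fun y : Space => rexp (-(π / a * X) * ‖y‖ ^ 2)) volume v,
    GaussianFourier.integral_rexp_neg_mul_sq_norm hb]
  have e1 : Module.finrank ℝ Space = 3 := by
    rw [(WithLp.linearEquiv 2 ℝ (ℝ × EuclideanSpace ℝ (Fin 2))).finrank_eq]
    simp
  have e2 : π / (π / a * X) = a / X := by
    have := pi_ne_zero
    field_simp
  have e : (a / X) ^ (((3 : ℕ) : ℝ) / 2) = √(a / X) ^ 3 := by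
    rw [Real.sqrt_eq_rpow, ← Real.rpow_natCast, ← Real.rpow_mul (by positivity)]
    norm_num
  rw [e1, e2, e, ← mul_pow, ← Real.sqrt_mul hX.le, mul_div_cancel₀ _ hX.ne']

lemma setIntegral_exp_norm_sub_le {X d : ℝ} (hX : 0 < X) (hd : 0 ≤ d) (v : Space) {S : Set Space}
    (hS : MeasurableSet S) (h : ∀ y ∈ S, d ≤ ‖v - y‖) :
    √X ^ 3 * ∫ y in S, rexp (-(π * X) * ‖v - y‖ ^ 2) ≤ 3 * rexp (-(π / 2 * X * d ^ 2)) := by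
  have hb : 0 < π / 2 * X := by positivity
  have hI := integrable_exp_norm_sub hb v
  have h1 : ∫ y in S, rexp (-(π * X) * ‖v - y‖ ^ 2) ≤
      ∫ y in S, rexp (-(π / 2 * X * d ^ 2)) * rexp (-(π / 2 * X) * ‖v - y‖ ^ 2) := by
    refine setIntegral_mono_on (integrable_exp_norm_sub (by positivity) v).integrableOn
      (hI.const_mul _).integrableOn hS fun y hy => ?_
    rw [← Real.exp_add, Real.exp_le_exp]
    have := mul_le_mul_of_nonneg_left (pow_le_pow_left₀ hd (h y hy) 2) hb.le
    linarith
  have h2 : ∫ y in S, rexp (-(π / 2 * X) * ‖v - y‖ ^ 2) ≤ ∫ y, rexp (-(π / 2 * X) * ‖v - y‖ ^ 2) :=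
    setIntegral_le_integral hI (ae_of_all _ fun y => (exp_pos _).le)
  have h3 : √2 ^ 3 ≤ (3 : ℝ) := by
    have h4 : √2 ^ 2 = (2 : ℝ) := Real.sq_sqrt zero_le_two
    have h5 : √2 ≤ (3 : ℝ) / 2 := Real.sqrt_le_iff.2 ⟨by norm_num, by norm_num⟩
    nlinarith
  rw [← sqrt_pow_mul_integral_exp_norm_sub two_pos hX v] at h3
  rw [integral_const_mul] at h1
  calc _ ≤ √X ^ 3 * (rexp (-(π / 2 * X * d ^ 2)) * ∫ y, rexp (-(π / 2 * X) * ‖v - y‖ ^ 2)) := by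
        gcongr
        exact h1.trans (mul_le_mul_of_nonneg_left h2 (exp_pos _).le)
    _ = √X ^ 3 * (∫ y, rexp (-(π / 2 * X) * ‖v - y‖ ^ 2)) * rexp (-(π / 2 * X * d ^ 2)) := by ring
    _ ≤ _ := by gcongr

lemma abs_ind_sub_smoothInd_le {X t : ℝ} (hX : 0 < X) (v : Space) :
    |(if ‖v‖ ≤ t then 1 else 0) - smoothInd X t v| ≤ 3 * rexp (-(π / 2 * X * (‖v‖ - t) ^ 2)) := by
  have hB : MeasurableSet (Metric.closedBall (0 : Space) t) := Metric.isClosed_closedBall.measurableSet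
  have h0 : 0 ≤ smoothInd X t v :=
    mul_nonneg (by positivity) (integral_nonneg fun y => (exp_pos _).le)
  split_ifs with h
  · have hI := integrable_exp_norm_sub (b := π * X) (by positivity) v
    have h1 : √X ^ 3 * ∫ y : Space, rexp (-(π * X) * ‖v - y‖ ^ 2) = 1 := by
      simpa using sqrt_pow_mul_integral_exp_norm_sub one_pos hX v
    have h2 : 1 - smoothInd X t v =
        √X ^ 3 * ∫ y in (Metric.closedBall (0 : Space) t)ᶜ, rexp (-(π * X) * ‖v - y‖ ^ 2) := by
      rw [← h1, ← integral_add_compl hB hI, smoothInd]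
      ring
    rw [h2, abs_of_nonneg (mul_nonneg (by positivity) (integral_nonneg fun y => (exp_pos _).le)),
      ← neg_sub, neg_sq]
    refine setIntegral_exp_norm_sub_le hX (sub_nonneg.2 h) v hB.compl fun y hy => ?_
    rw [mem_compl_iff, mem_closedBall_zero_iff, not_le] at hy
    have := norm_sub_norm_le y v
    rw [norm_sub_rev] at this
    linarith
  · rw [zero_sub, abs_neg, abs_of_nonneg h0]
    refine setIntegral_exp_norm_sub_le hX (sub_nonneg.2 (not_le.1 h).le) v hB fun y hy => ?_
    rw [mem_closedBall_zero_iff] at hy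
    linarith [norm_sub_norm_le v y]

lemma exp_sqrt_sub_sqrt_le {X x y : ℝ} (hX : 1 ≤ X) (hx0 : 0 ≤ x) (hx : x ≤ X) (hy : 0 ≤ y) :
    3 * rexp (-(π / 2 * X * (√y - √x) ^ 2)) ≤ 6 * rexp (-|y - x| / 3) := by
  have hxx : √x ^ 2 = x := Real.sq_sqrt hx0
  have hyy : √y ^ 2 = y := Real.sq_sqrt hy
  have hd : |y - x| ≤ (√y - √x) ^ 2 + 2 * √x * |√y - √x| := by
    have e : y - x = (√y - √x) ^ 2 + 2 * √x * (√y - √x) := by linear_combination hxx - hyy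
    rw [e]
    refine (abs_add_le _ _).trans (le_of_eq ?_)
    rw [abs_of_nonneg (sq_nonneg _), abs_mul, abs_of_nonneg (by positivity : 0 ≤ 2 * √x)]
  have h1 : 2 / 3 * √x * |√y - √x| ≤ X * (√y - √x) ^ 2 + 1 / 9 := by
    have h2 := sq_nonneg (√x * |√y - √x| - 1 / 3)
    have h3 : √x ^ 2 * |√y - √x| ^ 2 ≤ X * (√y - √x) ^ 2 := by
      rw [sq_abs, hxx]; gcongr
    linarith
  have h4 : (√y - √x) ^ 2 ≤ X * (√y - √x) ^ 2 := le_mul_of_one_le_left (sq_nonneg _) hX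
  have h5 : 3 * (X * (√y - √x) ^ 2) ≤ π * (X * (√y - √x) ^ 2) :=
    mul_le_mul_of_nonneg_right pi_gt_three.le (by positivity)
  have h6 : rexp (1 / 9) ≤ 2 := by
    have := Real.exp_bound_div_one_sub_of_interval (x := 1 / 9) (by norm_num) (by norm_num)
    linarith
  have h7 : rexp (-(π / 2 * X * (√y - √x) ^ 2)) ≤ rexp (1 / 9) * rexp (-|y - x| / 3) := by
    rw [← Real.exp_add, Real.exp_le_exp]
    have : 0 ≤ X * (√y - √x) ^ 2 := by positivity
    linarith
  have := mul_le_mul_of_nonneg_right h6 (exp_pos (-|y - x| / 3)).le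
  linarith

lemma finite_latticeA3 (x : ℝ) :
    {p : Z3 | (p.1 : ℝ) ^ 2 + (p.2.1 : ℝ) ^ 2 + (p.2.2 : ℝ) ^ 2 ≤ x}.Finite := by
  refine (finite_normSq_le ⌊x⌋₊).subset fun p hp => ?_
  rw [Set.mem_ofPred_eq, ← normSq_cast] at hp
  exact Nat.le_floor hp

lemma hasSum_latticeA3 {x : ℝ} (hx : 0 ≤ x) :
    HasSum (fun m : Z3 => if ‖toSpace m‖ ≤ √x then (1 : ℝ) else 0) (latticeA3 x) := by
  have e : ∀ m : Z3, (if ‖toSpace m‖ ≤ √x then (1 : ℝ) else 0) =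
      if m ∈ (finite_latticeA3 x).toFinset then 1 else 0 := by
    intro m
    congr 1
    rw [Set.Finite.mem_toFinset, Set.mem_ofPred_eq, ← normSq_cast, norm_toSpace,
      Real.sqrt_le_sqrt_iff hx]
  rw [hasSum_congr e, latticeA3, Set.ncard_eq_toFinset_card _ (finite_latticeA3 x)]
  have h := hasSum_sum_of_ne_finset_zero (L := SummationFilter.unconditional _) (s := (finite_latticeA3 x).toFinset)
    (f := fun m => if m ∈ (finite_latticeA3 x).toFinset then (1 : ℝ) else 0) (fun m hm => if_neg hm)
  rw [Finset.sum_congr rfl fun m hm => if_pos hm] at h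
  simpa using h

lemma monotone_latticeA3 : Monotone latticeA3 := fun _ y h =>
  Set.ncard_le_ncard (fun _ hp => le_trans hp h) (finite_latticeA3 y)

lemma abs_latticeA3_sub_le {X x : ℝ} (hX : 1 ≤ X) (hx0 : 0 ≤ x) (hx : x ≤ X) :
    Summable (fun n : ℕ => r3 n * rexp (-|n - x| / 3)) ∧
    |latticeA3 x - ∑' m : Z3, smoothInd X √x (toSpace m)| ≤
      6 * ∑' n : ℕ, r3 n * rexp (-|n - x| / 3) := by
  have hX0 : 0 < X := by linarith
  have hs : Summable fun m : Z3 => rexp (-|normSq m - x| / 3) := by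
    refine Summable.of_nonneg_of_le (fun _ => (exp_pos _).le) (fun m => ?_)
      ((summable_exp_normSq (s := 1 / 3) (by norm_num)).mul_left (rexp (x / 3)))
    rw [← Real.exp_add, Real.exp_le_exp]
    linarith [le_abs_self ((normSq m : ℝ) - x)]
  have h1 := hasSum_fiber (f := fun n => rexp (-|n - x| / 3)) hs
  refine ⟨h1.summable, ?_⟩
  have hle : ∀ m : Z3, ‖(if ‖toSpace m‖ ≤ √x then (1 : ℝ) else 0) - smoothInd X √x (toSpace m)‖ ≤
      6 * rexp (-|normSq m - x| / 3) := by
    intro m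
    refine (abs_ind_sub_smoothInd_le hX0 _).trans ?_
    rw [norm_toSpace]
    exact exp_sqrt_sub_sqrt_le hX hx0 hx (Nat.cast_nonneg _)
  have h2 := (hasSum_latticeA3 hx0).sub (hasSum_smoothInd hX0 (Real.sqrt_nonneg x)).summable.hasSum
  rw [← h2.tsum_eq, h1.tsum_eq]
  exact tsum_of_norm_bounded (hs.hasSum.mul_left 6) hle

lemma exists_tsum_exp_neg_abs_sub_le : ∃ K : ℝ, 0 < K ∧ ∀ x : ℝ, 0 ≤ x →
    Summable (fun n : ℕ => rexp (-|n - x| / 3)) ∧ ∑' n : ℕ, rexp (-|n - x| / 3) ≤ K := by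
  have hN : Summable fun n : ℕ => rexp (-(n : ℝ) / 3) := by
    refine (summable_geometric_of_lt_one (exp_pos (-(1 / 3))).le (by simp)).congr fun n => ?_
    rw [← Real.exp_nat_mul]
    ring_nf
  have hZ : Summable fun m : ℤ => rexp (-|(m : ℝ)| / 3) :=
    Summable.of_nat_of_neg (by simpa using hN) (by simpa using hN)
  refine ⟨rexp (1 / 3) * ∑' m : ℤ, rexp (-|(m : ℝ)| / 3),
    mul_pos (exp_pos _) (hZ.tsum_pos (fun _ => (exp_pos _).le) 0 (exp_pos _)), fun x hx => ?_⟩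
  have hi : Function.Injective fun n : ℕ => (n : ℤ) - ⌊x⌋₊ := fun a b h => by
    simpa using h
  have hle : ∀ n : ℕ, rexp (-|n - x| / 3) ≤
      rexp (1 / 3) * rexp (-|(((n : ℤ) - ⌊x⌋₊ : ℤ) : ℝ)| / 3) := by
    intro n
    rw [← Real.exp_add, Real.exp_le_exp]
    push_cast
    have h1 := Nat.floor_le hx
    have h2 := Nat.lt_floor_add_one x
    have h3 : |(n : ℝ) - ⌊x⌋₊| ≤ |n - x| + |x - ⌊x⌋₊| := abs_sub_le _ _ _
    rw [abs_of_nonneg (sub_nonneg.2 h1)] at h3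
    linarith
  have hs := (hZ.comp_injective hi).mul_left (rexp (1 / 3))
  have hs' := Summable.of_nonneg_of_le (fun n => (exp_pos _).le) hle hs
  refine ⟨hs', (hs'.tsum_le_tsum hle hs).trans ?_⟩
  rw [tsum_mul_left]
  gcongr
  exact tsum_comp_le_tsum_of_inj hZ (fun _ => (exp_pos _).le) hi

lemma integral_exp_neg_abs_sub_le (y X : ℝ) (hX : 0 ≤ X) :
    ∫ x in 0..X, rexp (-|y - x| / 6) ≤ 72 * π := by
  have h1 : ∀ x, rexp (-|y - x| / 6) ≤ 72 * (1 + (y - x) ^ 2)⁻¹ := by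
    intro x
    have h := Real.quadratic_le_exp_of_nonneg (x := |y - x| / 6) (by positivity)
    rw [neg_div, Real.exp_neg, ← div_eq_mul_inv, inv_eq_one_div, div_le_div_iff₀ (exp_pos _) (by positivity)]
    have := abs_nonneg (y - x)
    have := sq_abs (y - x)
    nlinarith
  have hc : Continuous fun x => 72 * (1 + (y - x) ^ 2)⁻¹ := by
    refine continuous_const.mul (Continuous.inv₀ (by fun_prop) fun x => by positivity)
  refine (intervalIntegral.integral_mono_on hX ((by fun_prop : Continuous fun x => rexp (-|y - x| / 6)).intervalIntegrable _ _)
    (hc.intervalIntegrable _ _) fun x _ => h1 x).trans ?_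
  rw [intervalIntegral.integral_const_mul,
    intervalIntegral.integral_comp_sub_left (fun x => (1 + x ^ 2)⁻¹), integral_inv_one_add_sq]
  have := arctan_lt_pi_div_two (y - 0)
  have := neg_pi_div_two_lt_arctan (y - X)
  linarith

lemma sq_tsum_mul_le {r w : ℕ → ℝ} {K : ℝ} (hK : 0 < K) (hw : Summable w) (hwK : ∑' n, w n ≤ K)
    (hw0 : ∀ n, 0 ≤ w n) (h1 : Summable fun n => r n * w n) (h2 : Summable fun n => r n ^ 2 * w n) :
    (∑' n, r n * w n) ^ 2 ≤ K * ∑' n, r n ^ 2 * w n := by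
  set S := ∑' n, r n * w n with hS
  have h := ((h1.mul_left (2 * (S / K)))).tsum_le_tsum (g := fun n => r n ^ 2 * w n + (S / K) ^ 2 * w n)
    (fun n => by nlinarith [mul_nonneg (hw0 n) (sq_nonneg (r n - S / K))]) (h2.add (hw.mul_left _))
  rw [tsum_mul_left, h2.tsum_add (hw.mul_left _), tsum_mul_left, ← hS] at h
  have h3 := mul_le_mul_of_nonneg_left hwK (sq_nonneg (S / K))
  have h4 : K * (2 * (S / K) * S) = 2 * S ^ 2 := by field_simp
  have h5 : K * ((S / K) ^ 2 * K) = S ^ 2 := by field_simp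
  have := mul_le_mul_of_nonneg_left (h.trans (add_le_add_right h3 _)) hK.le
  linarith

lemma exists_meanSq_majorant : ∃ C : ℝ, 0 ≤ C ∧ ∀ X : ℝ, 1 ≤ X → ∃ Q : ℝ → ℝ, Continuous Q ∧
    (∀ x, 0 ≤ x → x ≤ X → (∑' n : ℕ, r3 n * rexp (-|n - x| / 3)) ^ 2 ≤ Q x) ∧
    ∫ x in 0..X, Q x ≤ C * X ^ 2 := by
  obtain ⟨K, hK, hw⟩ := exists_tsum_exp_neg_abs_sub_le
  obtain ⟨-, D, -, hD, -, -, hL⟩ := logSum_asymp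
  have hπ := pi_pos
  refine ⟨2 * K * (72 * π) * (D * 36), by positivity, fun X hX => ?_⟩
  have hX0 : 0 < X := by linarith
  have hs0 : 0 < 1 / (6 * X) := by positivity
  have hsum := (hasSum_laplaceSq hs0).summable
  set q : ℕ → ℝ → ℝ := fun n x => (r3 n : ℝ) ^ 2 * rexp (-(1 / (6 * X)) * n) * rexp (-|n - x| / 6) with hq
  have hq0 : ∀ n x, 0 ≤ q n x := fun n x => by positivity
  have hqle : ∀ n x, ‖q n x‖ ≤ (r3 n : ℝ) ^ 2 * rexp (-(1 / (6 * X)) * n) := by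
    intro n x
    rw [Real.norm_of_nonneg (hq0 n x)]
    refine mul_le_of_le_one_right (by positivity) (Real.exp_le_one_iff.2 ?_)
    linarith [abs_nonneg ((n : ℝ) - x)]
  have hqc : ∀ n, Continuous (q n) := fun n => by fun_prop
  refine ⟨fun x => 2 * K * ∑' n, q n x, continuous_const.mul (continuous_tsum hqc hsum hqle), ?_, ?_⟩
  · intro x hx0 hx
    obtain ⟨hw1, hw2⟩ := hw x hx0
    have hle : ∀ n : ℕ, (r3 n : ℝ) ^ 2 * rexp (-|n - x| / 3) ≤ 2 * q n x := by
      intro n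
      have h1 : rexp (1 / 6) ≤ 2 := by
        have := Real.exp_bound_div_one_sub_of_interval (x := 1 / 6) (by norm_num) (by norm_num)
        linarith
      have h2 : rexp (-|n - x| / 3) ≤ rexp (1 / 6) * (rexp (-(1 / (6 * X)) * n) * rexp (-|n - x| / 6)) := by
        rw [← Real.exp_add, ← Real.exp_add, Real.exp_le_exp]
        have h3 : (n : ℝ) / X ≤ |(n : ℝ) - x| + 1 := by
          rw [div_le_iff₀ hX0]
          nlinarith [le_abs_self ((n : ℝ) - x), abs_nonneg ((n : ℝ) - x)]
        have h4 : 1 / (6 * X) * n = n / X / 6 := by field_simp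
        rw [neg_mul, h4]
        linarith
      calc _ ≤ (r3 n : ℝ) ^ 2 * (2 * (rexp (-(1 / (6 * X)) * n) * rexp (-|n - x| / 6))) := by
            gcongr
            exact h2.trans (by gcongr)
        _ = _ := by rw [hq]; ring
    have hqs : Summable fun n => 2 * q n x := (Summable.of_norm_bounded hsum fun n => hqle n x).mul_left 2
    have hs2 := Summable.of_nonneg_of_le (fun n => by positivity) hle hqs
    refine (sq_tsum_mul_le hK hw1 hw2 (fun _ => (exp_pos _).le) (abs_latticeA3_sub_le hX hx0 hx).1 hs2).trans ?_
    beta_reduce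
    rw [mul_comm 2 K, mul_assoc, ← tsum_mul_left (f := fun n => q n x)]
    exact mul_le_mul_of_nonneg_left (hs2.tsum_le_tsum hle hqs) hK.le
  · have h := intervalIntegral.hasSum_integral_of_dominated_convergence (μ := volume) (a := 0) (b := X)
      (F := q) (f := fun x => ∑' n, q n x) (fun n _ => (r3 n : ℝ) ^ 2 * rexp (-(1 / (6 * X)) * n))
      (fun n => (hqc n).aestronglyMeasurable) (fun n => ae_of_all _ fun x _ => hqle n x)
      (ae_of_all _ fun _ _ => hsum) intervalIntegrable_const
      (ae_of_all _ fun x _ => (Summable.of_norm_bounded hsum fun n => hqle n x).hasSum)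
    have hI : ∫ x in 0..X, ∑' n, q n x ≤ laplaceSq (1 / (6 * X)) * (72 * π) := by
      refine hasSum_le (fun n => ?_) h ((hasSum_laplaceSq hs0).mul_right (72 * π))
      rw [hq, intervalIntegral.integral_const_mul]
      exact mul_le_mul_of_nonneg_left (integral_exp_neg_abs_sub_le _ _ hX0.le) (by positivity)
    have hl := hL _ hs0 (by rw [div_le_one (by positivity)]; linarith)
    have e : D / (1 / (6 * X)) ^ 2 = D * 36 * X ^ 2 := by field_simp; norm_num
    rw [e] at hl
    rw [intervalIntegral.integral_const_mul]
    calc _ ≤ 2 * K * (D * 36 * X ^ 2 * (72 * π)) := by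
          gcongr
          exact hI.trans (by gcongr)
      _ = _ := by ring

/-- The main part of the discrepancy, obtained from the smoothed count. -/
def mainPart (X x : ℝ) : ℝ := √x / π * cosSeries (coef X) √x

lemma continuous_mainPart {X : ℝ} (hX : 0 < X) : Continuous (mainPart X) :=
  (Real.continuous_sqrt.div_const π).mul
    ((continuous_cosSeries (coef_nonneg X) (summable_coef hX)).comp Real.continuous_sqrt)

lemma integral_mainPart_sq {X : ℝ} (hX : 0 < X) :
    ∫ x in 0..X, mainPart X x ^ 2 = 2 / π ^ 2 * ∫ t in 0..√X, t ^ 3 * cosSeries (coef X) t ^ 2 := by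
  have h := intervalIntegral.integral_comp_mul_deriv (a := 0) (b := √X) (f := fun t => t ^ 2)
    (f' := fun t => 2 * t) (g := fun x => mainPart X x ^ 2)
    (fun t _ => by simpa using hasDerivAt_pow 2 t) (by fun_prop) ((continuous_mainPart hX).pow 2)
  rw [Real.sq_sqrt hX.le, zero_pow two_ne_zero] at h
  rw [← h, ← intervalIntegral.integral_const_mul]
  refine intervalIntegral.integral_congr fun t ht => ?_
  rw [uIcc_of_le (Real.sqrt_nonneg X)] at ht
  simp only [Function.comp, mainPart, Real.sqrt_sq ht.1]
  ring

lemma rpow_three_halves {x : ℝ} (hx : 0 ≤ x) : x ^ ((3 : ℝ) / 2) = √x ^ 3 := by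
  rw [Real.sqrt_eq_rpow, ← Real.rpow_natCast, ← Real.rpow_mul hx]
  norm_num

lemma intervalIntegrable_latticeP3_sq (X : ℝ) :
    IntervalIntegrable (fun x => latticeP3 x ^ 2) volume 0 X := by
  have hm : Monotone fun x => (latticeA3 x : ℝ) := fun _ _ h => Nat.cast_le.2 (monotone_latticeA3 h)
  have hm2 : Monotone fun x => (latticeA3 x : ℝ) ^ 2 := fun _ _ h =>
    pow_le_pow_left₀ (Nat.cast_nonneg _) (hm h) 2
  have hc : Continuous fun x : ℝ => 4 * π / 3 * x ^ ((3 : ℝ) / 2) :=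
    continuous_const.mul (Real.continuous_rpow_const (by norm_num))
  have h1 : IntervalIntegrable (fun x => (latticeA3 x : ℝ) * (2 * (4 * π / 3 * x ^ ((3 : ℝ) / 2)))) volume 0 X :=
    hm.intervalIntegrable.mul_continuousOn (continuous_const.mul hc).continuousOn
  refine ((hm2.intervalIntegrable.sub h1).add ((hc.pow 2).intervalIntegrable 0 X)).congr fun x _ => ?_
  simp only [latticeP3, Pi.pow_apply]
  ring

lemma exists_meanSq_remainder_le : ∃ C : ℝ, 0 ≤ C ∧ ∀ X : ℝ, 8 ≤ X →
    ∃ Q : ℝ → ℝ, Continuous Q ∧ (∀ x ∈ Icc 0 X, (latticeP3 x + mainPart X x) ^ 2 ≤ Q x) ∧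
      ∫ x in 0..X, Q x ≤ C * X ^ 2 := by
  obtain ⟨C, hC, hU⟩ := exists_abs_tsum_smoothInd_le
  obtain ⟨D, hD, hQ⟩ := exists_meanSq_majorant
  refine ⟨2 * C ^ 2 + 72 * D, by positivity, fun X hX => ?_⟩
  have hX0 : 0 < X := by linarith
  obtain ⟨Q, hQc, hQle, hQI⟩ := hQ X (by linarith)
  refine ⟨fun x => 2 * C ^ 2 * X + 72 * Q x, by fun_prop, fun x hx => ?_, ?_⟩
  · have h1 := hU X hX √x (Real.sqrt_nonneg x)
    have h2 := (abs_latticeA3_sub_le (by linarith) hx.1 hx.2).2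
    have h3 := hQle x hx.1 hx.2
    have e : latticeP3 x + mainPart X x = (latticeA3 x - ∑' m : Z3, smoothInd X √x (toSpace m)) +
        ((∑' m : Z3, smoothInd X √x (toSpace m)) - 4 * π / 3 * √x ^ 3 + √x / π * cosSeries (coef X) √x) := by
      rw [latticeP3, mainPart, rpow_three_halves hx.1]
      ring
    have h4 : |latticeP3 x + mainPart X x| ≤ 6 * (∑' n : ℕ, r3 n * rexp (-|n - x| / 3)) + C * √X := by
      rw [e]
      exact (abs_add_le _ _).trans (add_le_add h2 h1)
    have h5 := pow_le_pow_left₀ (abs_nonneg _) h4 2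
    rw [sq_abs] at h5
    have h6 := sq_nonneg (6 * (∑' n : ℕ, r3 n * rexp (-|n - x| / 3)) - C * √X)
    have h7 : √X ^ 2 = X := Real.sq_sqrt hX0.le
    have h8 : (C * √X) ^ 2 = C ^ 2 * X := by rw [mul_pow, h7]
    linarith
  · rw [intervalIntegral.integral_add intervalIntegrable_const ((hQc.intervalIntegrable _ _).const_mul 72),
      intervalIntegral.integral_const, intervalIntegral.integral_const_mul, smul_eq_mul]
    nlinarith

lemma abs_integral_sq_sub_le {P M Q : ℝ → ℝ} {X L : ℝ} (hX : 0 ≤ X) (hL : 0 < L)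
    (hP : IntervalIntegrable (fun x => P x ^ 2) volume 0 X) (hM : Continuous M) (hQ : Continuous Q)
    (h : ∀ x ∈ Icc 0 X, (P x + M x) ^ 2 ≤ Q x) :
    |(∫ x in 0..X, P x ^ 2) - ∫ x in 0..X, M x ^ 2| ≤
      (1 + L) * (∫ x in 0..X, Q x) + 1 / L * ∫ x in 0..X, M x ^ 2 := by
  have hM2 : IntervalIntegrable (fun x => M x ^ 2) volume 0 X := (hM.pow 2).intervalIntegrable _ _
  have hQi : IntervalIntegrable Q volume 0 X := hQ.intervalIntegrable _ _
  rw [← intervalIntegral.integral_sub hP hM2, ← Real.norm_eq_abs, ← intervalIntegral.integral_const_mul,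
    ← intervalIntegral.integral_const_mul, ← intervalIntegral.integral_add (hQi.const_mul _) (hM2.const_mul _)]
  refine intervalIntegral.norm_integral_le_of_norm_le hX (ae_of_all _ fun x hx => ?_)
    ((hQi.const_mul _).add (hM2.const_mul _))
  have h1 := h x ⟨hx.1.le, hx.2⟩
  have h2 : 0 ≤ L * ((P x + M x) - M x / L) ^ 2 := by positivity
  have h3 : 0 ≤ L * ((P x + M x) + M x / L) ^ 2 := by positivity
  have e2 : L * ((P x + M x) - M x / L) ^ 2 = L * (P x + M x) ^ 2 - 2 * M x * (P x + M x) + 1 / L * M x ^ 2 := by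
    field_simp; ring
  have e3 : L * ((P x + M x) + M x / L) ^ 2 = L * (P x + M x) ^ 2 + 2 * M x * (P x + M x) + 1 / L * M x ^ 2 := by
    field_simp; ring
  have h4 : L * (P x + M x) ^ 2 ≤ L * Q x := by gcongr
  have e : P x ^ 2 - M x ^ 2 = (P x + M x) ^ 2 - 2 * M x * (P x + M x) := by ring
  have := sq_nonneg (P x + M x)
  rw [Real.norm_eq_abs, e, abs_le]
  constructor <;> linarith

end SphereLattice

end

theorem jarnik_mean_square_sphere :
    ∃ c₃ : ℝ, 0 < c₃ ∧
      (fun X : ℝ => (∫ x in (0 : ℝ)..X, (latticeP3 x) ^ 2) - c₃ * X ^ 2 * Real.log X)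
        =O[atTop] (fun X : ℝ => X ^ 2 * Real.log X ^ ((1 : ℝ) / 2)) := by
  obtain ⟨c, C, hc, hC, hV⟩ := SphereLattice.meanSq_coef
  obtain ⟨D, hD, hW⟩ := SphereLattice.exists_meanSq_remainder_le
  have hπ := Real.pi_pos
  refine ⟨2 / π ^ 2 * c, by positivity,
    IsBigO.of_bound (2 * D + 2 / π ^ 2 * (c + C) + 2 / π ^ 2 * C) ?_⟩
  filter_upwards [eventually_ge_atTop 8] with X hX
  have hX0 : 0 < X := by linarith
  have hlog1 : 1 ≤ log X := by
    rw [Real.le_log_iff_exp_le hX0]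
    linarith [exp_one_lt_d9]
  rw [← Real.sqrt_eq_rpow, Real.norm_eq_abs, Real.norm_of_nonneg (by positivity)]
  have hV := hV X hX
  obtain ⟨Q, hQc, hQle, hQI⟩ := hW X hX
  have hL1 : 1 ≤ √(log X) := Real.one_le_sqrt.2 hlog1
  have hLL : √(log X) ^ 2 = log X := Real.sq_sqrt (by linarith)
  set L := √(log X)
  rw [← hLL] at hV ⊢
  have hmain := SphereLattice.abs_integral_sq_sub_le hX0.le (by linarith : 0 < L)
    (SphereLattice.intervalIntegrable_latticeP3_sq X) (SphereLattice.continuous_mainPart hX0) hQc hQle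
  rw [SphereLattice.integral_mainPart_sq hX0] at hmain
  set I := ∫ t in 0..√X, t ^ 3 * SphereLattice.cosSeries (SphereLattice.coef X) t ^ 2
  set p := 2 / π ^ 2
  have hp : 0 ≤ p := by positivity
  have hI : I ≤ (c + C) * (X ^ 2 * L ^ 2) := by
    have h1 := (abs_le.1 hV).2
    have h2 : C * (X ^ 2 * L) ≤ C * (X ^ 2 * L ^ 2) := by
      gcongr
      exact le_self_pow₀ hL1 two_ne_zero
    linarith
  have h1 : (1 + L) * (∫ x in 0..X, Q x) ≤ 2 * D * (X ^ 2 * L) := by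
    calc _ ≤ (1 + L) * (D * X ^ 2) := by gcongr
      _ ≤ (L + L) * (D * X ^ 2) := by gcongr
      _ = _ := by ring
  have h2 : 1 / L * (p * I) ≤ p * (c + C) * (X ^ 2 * L) := by
    calc _ ≤ 1 / L * (p * ((c + C) * (X ^ 2 * L ^ 2))) := by gcongr
      _ = _ := by field_simp
  have h3 : |p * I - p * c * X ^ 2 * L ^ 2| ≤ p * C * (X ^ 2 * L) := by
    have e : p * I - p * c * X ^ 2 * L ^ 2 = p * (I - c * (X ^ 2 * L ^ 2)) := by ring
    rw [e, abs_mul, abs_of_nonneg hp, mul_assoc]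
    exact mul_le_mul_of_nonneg_left hV hp
  have := (abs_sub_le _ _ _).trans (add_le_add hmain h3)
  linarith
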